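/- arXiv:1110.1960 — 3 statements merged into one kernel-verified Lean document; each statement's English description precedes it below -/
import Mathlib

section
/- Assume c ∈ O_K with v(c^p − c) ≥ 1 and v(c) < p/((q+1)(p−1)). Let y ∈ Ω be a root of L_c(X) and let M := K(y, z) ⊆ Ω where z ∈ Ω satisfies z^p = f_{q,c}(y). Then M/K is a Galois extension of degree p·q², and its Galois group G = Gal(M/K) is an extra-special p-group of order p·q² = p^{2n+1}: G is non-abelian and its derived subgroup, center and Frattini subgroup coincide and have order p. -/
open Polynomial

noncomputable section

/-- `K₀`: the fraction field of the Witt vectors over `𝔽̄_p`, i.e. the completion of `ℚ_p^ur`. -/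
abbrev Kzero (p : ℕ) [Fact p.Prime] : Type :=
  FractionRing (WittVector p (AlgebraicClosure (ZMod p)))

/-- `Ω`: a fixed algebraic closure of `K₀`. -/
abbrev Omg (p : ℕ) [Fact p.Prime] : Type := AlgebraicClosure (Kzero p)

/-- `a_n = (-1)^q · (-p)^(p + p² + ⋯ + pⁿ)` as an element of a commutative ring. -/
def aCoef (R : Type) [CommRing R] (p n : ℕ) : R :=
  (-1) ^ p ^ n * (-(p : R)) ^ (Finset.sum (Finset.range n) fun i => p ^ (i + 1))

/-- `f_{q,c}(X) = 1 + c·X^q + X^(1+q)` with `q = pⁿ`. -/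
def fqc (R : Type) [CommRing R] (p n : ℕ) (c : R) : Polynomial R :=
  1 + C c * X ^ p ^ n + X ^ (p ^ n + 1)

/-- The modified monodromy polynomial `L_c(X) = X^(q²) − a_n·(c+X)·f_{q,c}(X)^(q−1)`. -/
def Lpoly (R : Type) [CommRing R] (p n : ℕ) (c : R) : Polynomial R :=
  X ^ (p ^ n * p ^ n) - C (aCoef R p n) * (C c + X) * fqc R p n c ^ (p ^ n - 1)

set_option maxHeartbeats 2000000
set_option synthInstance.maxHeartbeats 1000000

/-- A rank-one valuation with values in `ℚ`, written additively; its value at `0` carries no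
information. -/
structure RatVal (Ω : Type) [Field Ω] where
  /-- The underlying function. -/
  w : Ω → ℚ
  map_mul : ∀ x y : Ω, x ≠ 0 → y ≠ 0 → w (x * y) = w x + w y
  map_add : ∀ x y : Ω, x ≠ 0 → y ≠ 0 → x + y ≠ 0 → min (w x) (w y) ≤ w (x + y)

namespace RatVal

variable {Ω : Type} [Field Ω] (v : RatVal Ω)

lemma w_one : v.w 1 = 0 := by
  have := v.map_mul 1 1 one_ne_zero one_ne_zero
  rw [mul_one] at this
  linarith

lemma w_neg (x : Ω) : v.w (-x) = v.w x := by
  by_cases hx : x = 0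
  · simp [hx]
  have h1 : v.w (-1) = 0 := by
    have := v.map_mul (-1) (-1) (by simp) (by simp)
    rw [neg_mul_neg, mul_one, w_one] at this
    linarith
  have := v.map_mul (-1) x (by simp) hx
  rw [neg_one_mul] at this
  linarith

lemma w_pow {x : Ω} (hx : x ≠ 0) (k : ℕ) : v.w (x ^ k) = k * v.w x := by
  induction k with
  | zero => simp [w_one]
  | succ k ih =>
    rw [pow_succ, v.map_mul _ _ (pow_ne_zero _ hx) hx, ih]
    push_cast
    ring

lemma w_inv {x : Ω} (hx : x ≠ 0) : v.w x⁻¹ = -v.w x := by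
  have := v.map_mul x x⁻¹ hx (inv_ne_zero hx)
  rw [mul_inv_cancel₀ hx, w_one] at this
  linarith

lemma w_div {x y : Ω} (hx : x ≠ 0) (hy : y ≠ 0) : v.w (x / y) = v.w x - v.w y := by
  rw [div_eq_mul_inv, v.map_mul _ _ hx (inv_ne_zero hy), w_inv v hy]
  ring

/-- The elements of valuation at least `r`. -/
def ge (r : ℚ) : AddSubgroup Ω where
  carrier := {x | x = 0 ∨ r ≤ v.w x}
  zero_mem' := Or.inl rfl
  add_mem' := by
    rintro x y hx hy
    simp only [Set.mem_ofPred_eq] at *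
    by_cases h0 : x + y = 0
    · exact Or.inl h0
    rcases hx with rfl | hx
    · simpa using hy
    rcases hy with rfl | hy
    · simpa using Or.inr hx
    by_cases hx0 : x = 0
    · subst hx0
      simpa using Or.inr hy
    by_cases hy0 : y = 0
    · subst hy0
      simpa using Or.inr hx
    exact Or.inr ((le_min hx hy).trans (v.map_add x y hx0 hy0 h0))
  neg_mem' := by
    rintro x hx
    simpa [w_neg] using hx

/-- The elements of valuation greater than `r`. -/
def gt (r : ℚ) : AddSubgroup Ω where
  carrier := {x | x = 0 ∨ r < v.w x}
  zero_mem' := Or.inl rfl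
  add_mem' := by
    rintro x y hx hy
    simp only [Set.mem_ofPred_eq] at *
    by_cases h0 : x + y = 0
    · exact Or.inl h0
    rcases hx with rfl | hx
    · simpa using hy
    rcases hy with rfl | hy
    · simpa using Or.inr hx
    by_cases hx0 : x = 0
    · subst hx0
      simpa using Or.inr hy
    by_cases hy0 : y = 0
    · subst hy0
      simpa using Or.inr hx
    exact Or.inr ((lt_min hx hy).trans_le (v.map_add x y hx0 hy0 h0))
  neg_mem' := by
    rintro x hx
    simpa [w_neg] using hx

variable {v}

lemma mem_ge {r : ℚ} {x : Ω} : x ∈ v.ge r ↔ x = 0 ∨ r ≤ v.w x := Iff.rfl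

lemma mem_gt {r : ℚ} {x : Ω} : x ∈ v.gt r ↔ x = 0 ∨ r < v.w x := Iff.rfl

lemma le_w {r : ℚ} {x : Ω} (h : x ∈ v.ge r) (hx : x ≠ 0) : r ≤ v.w x := h.resolve_left hx

lemma lt_w {r : ℚ} {x : Ω} (h : x ∈ v.gt r) (hx : x ≠ 0) : r < v.w x := h.resolve_left hx

lemma mem_ge_of_eq {r : ℚ} {x : Ω} (h : v.w x = r) : x ∈ v.ge r := Or.inr h.ge

lemma mem_ge_self (x : Ω) : x ∈ v.ge (v.w x) := Or.inr le_rfl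

lemma ge_mono {r s : ℚ} {x : Ω} (h : x ∈ v.ge r) (hrs : s ≤ r) : x ∈ v.ge s :=
  h.imp_right hrs.trans

lemma gt_mono {r s : ℚ} {x : Ω} (h : x ∈ v.gt r) (hrs : s ≤ r) : x ∈ v.gt s :=
  h.imp_right hrs.trans_lt

lemma gt_of_ge {r s : ℚ} {x : Ω} (h : x ∈ v.ge r) (hrs : s < r) : x ∈ v.gt s :=
  h.imp_right hrs.trans_le

lemma ge_of_gt {r s : ℚ} {x : Ω} (h : x ∈ v.gt r) (hrs : s ≤ r) : x ∈ v.ge s :=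
  h.imp_right fun h => hrs.trans h.le

lemma one_mem : (1 : Ω) ∈ v.ge 0 := mem_ge_of_eq v.w_one

lemma mul_mem {r s : ℚ} {x y : Ω} (hx : x ∈ v.ge r) (hy : y ∈ v.ge s) : x * y ∈ v.ge (r + s) := by
  by_cases hx0 : x = 0
  · exact Or.inl (by simp [hx0])
  by_cases hy0 : y = 0
  · exact Or.inl (by simp [hy0])
  right
  rw [v.map_mul x y hx0 hy0]
  exact add_le_add (le_w hx hx0) (le_w hy hy0)

lemma mul_mem_gt {r s : ℚ} {x y : Ω} (hx : x ∈ v.ge r) (hy : y ∈ v.gt s) :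
    x * y ∈ v.gt (r + s) := by
  by_cases hx0 : x = 0
  · exact Or.inl (by simp [hx0])
  by_cases hy0 : y = 0
  · exact Or.inl (by simp [hy0])
  right
  rw [v.map_mul x y hx0 hy0]
  exact add_lt_add_of_le_of_lt (le_w hx hx0) (lt_w hy hy0)

lemma pow_mem {r : ℚ} {x : Ω} (hx : x ∈ v.ge r) (k : ℕ) : x ^ k ∈ v.ge (k * r) := by
  induction k with
  | zero => simpa using one_mem
  | succ k ih =>
    rw [pow_succ]
    exact ge_mono (mul_mem ih hx) (by push_cast; linarith)

lemma div_mem {r : ℚ} {x y : Ω} (hx : x ∈ v.ge r) (hy : y ≠ 0) :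
    x / y ∈ v.ge (r - v.w y) := by
  rw [div_eq_mul_inv, sub_eq_add_neg, ← w_inv v hy]
  exact mul_mem hx (mem_ge_self _)

lemma div_mem_gt {r : ℚ} {x y : Ω} (hx : x ∈ v.gt r) (hy : y ≠ 0) :
    x / y ∈ v.gt (r - v.w y) := by
  rw [div_eq_mul_inv, mul_comm, sub_eq_add_neg, ← w_inv v hy, add_comm]
  exact mul_mem_gt (mem_ge_self _) hx

lemma mul_mem_of_ge_zero {r : ℚ} {x y : Ω} (hx : x ∈ v.ge 0) (hy : y ∈ v.ge r) :
    x * y ∈ v.ge r := by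
  simpa using mul_mem hx hy

lemma natCast_mem (k : ℕ) : (k : Ω) ∈ v.ge 0 := by
  rw [← nsmul_one]
  exact (v.ge 0).nsmul_mem one_mem k

lemma intCast_mem (k : ℤ) : (k : Ω) ∈ v.ge 0 := by
  rw [← zsmul_one]
  exact (v.ge 0).zsmul_mem one_mem k

lemma natCast_mem_of_dvd {p k : ℕ} (h : p ∣ k) : (k : Ω) ∈ v.ge (v.w p) := by
  obtain ⟨m, rfl⟩ := h
  rw [Nat.cast_mul, mul_comm]
  exact mul_mem_of_ge_zero (natCast_mem m) (mem_ge_self _)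

/-- A term of larger valuation does not influence the valuation of a sum. -/
lemma w_add_of_gt {x y : Ω} (hx : x ≠ 0) (hy : y ∈ v.gt (v.w x)) :
    x + y ≠ 0 ∧ v.w (x + y) = v.w x := by
  have h0 : x + y ≠ 0 := by
    intro h
    have : x = -y := by linear_combination h
    have hx' : x ∈ v.gt (v.w x) := by
      have h1 := (v.gt _).neg_mem hy
      rwa [← this] at h1
    exact lt_irrefl _ (lt_w hx' hx)
  refine ⟨h0, ?_⟩
  have h1 : x + y ∈ v.ge (v.w x) := (v.ge _).add_mem (mem_ge_self x) (ge_of_gt hy le_rfl)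
  refine le_antisymm ?_ (le_w h1 h0)
  by_contra! hlt
  have h2 : (x + y) - y ∈ v.gt (v.w x) := (v.gt _).sub_mem (Or.inr hlt) hy
  rw [add_sub_cancel_right] at h2
  exact lt_irrefl _ (lt_w h2 hx)

/-- If `x - y` has larger valuation than `y`, then `x` and `y` have the same valuation. -/
lemma w_eq_of_sub {x y : Ω} (hy : y ≠ 0) (h : x - y ∈ v.gt (v.w y)) :
    x ≠ 0 ∧ v.w x = v.w y := by
  have := w_add_of_gt hy h
  rwa [add_sub_cancel] at this

lemma w_eq_of_pow {x : Ω} {k : ℕ} {r : ℚ} (hk : k ≠ 0) (hx : x ≠ 0) (h : v.w (x ^ k) = k * r) :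
    v.w x = r := by
  rw [w_pow v hx] at h
  exact mul_left_cancel₀ (by exact_mod_cast hk) h

/-- The binomial theorem for a prime power exponent, up to multiples of `p`. -/
lemma add_pow_sub_mem {p k : ℕ} (hp : p.Prime) {a b : ℚ} (hab : a ≤ b) {x y : Ω}
    (hx : x ∈ v.ge a) (hy : y ∈ v.ge b) :
    (x + y) ^ p ^ k - x ^ p ^ k - y ^ p ^ k ∈ v.ge (v.w p + (p ^ k * a + (b - a))) := by
  obtain ⟨m, hm⟩ : ∃ m, p ^ k = m + 1 := ⟨p ^ k - 1, by have := pow_pos hp.pos k; omega⟩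
  have hm' : ((p : ℚ) ^ k) = m + 1 := by exact_mod_cast hm
  rw [add_comm x y, add_pow, Finset.sum_range_succ, hm, Finset.sum_range_succ']
  have : (∑ i ∈ Finset.range m, y ^ (i + 1) * x ^ (m + 1 - (i + 1)) * ((m + 1).choose (i + 1) : Ω) +
      y ^ 0 * x ^ (m + 1 - 0) * ((m + 1).choose 0 : Ω) +
      y ^ (m + 1) * x ^ (m + 1 - (m + 1)) * ((m + 1).choose (m + 1) : Ω)) - x ^ (m + 1)
      - y ^ (m + 1) = ∑ i ∈ Finset.range m,
        y ^ (i + 1) * x ^ (m + 1 - (i + 1)) * ((m + 1).choose (i + 1) : Ω) := by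
    simp
    ring
  rw [this]
  refine (v.ge _).sum_mem fun i hi => ?_
  have hi' := Finset.mem_range.1 hi
  have hd : p ∣ (m + 1).choose (i + 1) := by
    rw [← hm]
    exact hp.dvd_choose_pow (by omega) (by omega)
  obtain ⟨j, hj⟩ : ∃ j, m = i + j + 1 := ⟨m - i - 1, by omega⟩
  have h2 : m + 1 - (i + 1) = j + 1 := by omega
  rw [h2]
  refine ge_mono (mul_mem (mul_mem (pow_mem hy _) (pow_mem hx _)) (natCast_mem_of_dvd hd)) ?_
  have hjq : (m : ℚ) = i + j + 1 := by exact_mod_cast hj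
  rw [hm', hjq]
  push_cast
  have : 0 ≤ (i : ℚ) * (b - a) := mul_nonneg (Nat.cast_nonneg _) (by linarith)
  linarith

/-- The `p`-th power of a finite sum is the sum of the `p`-th powers, up to multiples of `p`. -/
lemma sum_pow_sub_mem {p : ℕ} (hp : p.Prime) {a : ℚ} (x : ℕ → Ω) (n : ℕ)
    (hx : ∀ i < n, x i ∈ v.ge a) :
    (∑ i ∈ Finset.range n, x i) ^ p - ∑ i ∈ Finset.range n, x i ^ p ∈ v.ge (v.w p + p * a) := by
  induction n with
  | zero =>
    simp [hp.ne_zero]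
  | succ n ih =>
    rw [Finset.sum_range_succ, Finset.sum_range_succ]
    have h1 := ih fun i hi => hx i (by omega)
    have h0 : ∑ i ∈ Finset.range n, x i ∈ v.ge a :=
      (v.ge a).sum_mem fun i hi => hx i (by have := Finset.mem_range.1 hi; omega)
    have h2 := add_pow_sub_mem (k := 1) hp le_rfl h0 (hx n (by omega))
    rw [pow_one, pow_one, sub_self, add_zero] at h2
    convert (v.ge _).add_mem h1 h2 using 1
    ring

/-- If the product of `x - r` over a multiset has positive valuation, so has some factor. -/
lemma exists_sub_mem_gt_of_prod (s : Multiset Ω) {x : Ω} {r : ℚ}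
    (h : (s.map fun r => x - r).prod ∈ v.gt (s.card * r)) : ∃ a ∈ s, x - a ∈ v.gt r := by
  induction s using Multiset.induction with
  | empty =>
    simp only [Multiset.map_zero, Multiset.prod_zero, Multiset.card_zero, Nat.cast_zero,
      zero_mul] at h
    exact absurd (lt_w h one_ne_zero) (by simp [w_one])
  | cons a s ih =>
    rw [Multiset.map_cons, Multiset.prod_cons, Multiset.card_cons] at h
    by_cases ha : x - a ∈ v.gt r
    · exact ⟨a, Multiset.mem_cons_self _ _, ha⟩
    have ha' : x - a ≠ 0 ∧ v.w (x - a) ≤ r := by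
      simpa [mem_gt] using ha
    obtain ⟨b, hb, hb'⟩ := ih (by
      rcases mem_gt.1 h with h | h
      · exact Or.inl ((mul_eq_zero.1 h).resolve_left ha'.1)
      · by_cases h0 : (s.map fun r => x - r).prod = 0
        · exact Or.inl h0
        · rw [v.map_mul _ _ ha'.1 h0] at h
          right
          push_cast at h
          linarith [ha'.2])
    exact ⟨b, Multiset.mem_cons_of_mem hb, hb'⟩

/-- A polynomial of degree `d` with unit leading coefficient cannot take values of positive
valuation at more than `d` pairwise incongruent points. -/
lemma card_le_natDegree [IsAlgClosed Ω] (Q : Polynomial Ω) (hQ : v.w Q.leadingCoeff = 0)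
    (hQ0 : Q ≠ 0) (T : Finset Ω) (hT : ∀ t ∈ T, Q.eval t ∈ v.gt 0)
    (hinj : ∀ t ∈ T, ∀ t' ∈ T, t - t' ∈ v.gt 0 → t = t') : T.card ≤ Q.natDegree := by
  classical
  have hsplit := IsAlgClosed.splits Q
  have key : ∀ t ∈ T, ∃ a ∈ Q.roots, t - a ∈ v.gt 0 := by
    intro t ht
    apply exists_sub_mem_gt_of_prod
    have h1 := hT t ht
    rw [hsplit.eq_prod_roots, Polynomial.eval_mul, Polynomial.eval_C,
      Polynomial.eval_multiset_prod, Multiset.map_map] at h1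
    simp only [Function.comp_apply, Polynomial.eval_sub, Polynomial.eval_X,
      Polynomial.eval_C] at h1
    have h2 := div_mem_gt h1 (Polynomial.leadingCoeff_ne_zero.2 hQ0)
    rw [mul_div_cancel_left₀ _ (Polynomial.leadingCoeff_ne_zero.2 hQ0), hQ] at h2
    simpa using h2
  choose! g hg hg' using key
  calc T.card = (T.image g).card := by
        rw [Finset.card_image_of_injOn]
        intro t ht t' ht' h
        apply hinj t ht t' ht'
        have h3 := (v.gt 0).sub_mem (hg' t ht) (hg' t' ht')
        rw [h] at h3
        simpa using h3
    _ ≤ Q.roots.toFinset.card := by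
        apply Finset.card_le_card
        intro a ha
        obtain ⟨t, ht, rfl⟩ := Finset.mem_image.1 ha
        exact Multiset.mem_toFinset.2 (hg t ht)
    _ ≤ Q.roots.card := Multiset.toFinset_card_le _
    _ ≤ Q.natDegree := Q.card_roots'

/-- Elements whose valuations are pairwise incongruent modulo the value group of the base field
are linearly independent. -/
lemma linearIndependent_of_w {K ι : Type} [Field K] [Algebra K Ω] [Finite ι] (x : ι → Ω)
    (hx : ∀ i, x i ≠ 0)
    (h : ∀ i j, i ≠ j → ∀ a : K, a ≠ 0 → v.w (x i) - v.w (x j) ≠ v.w (algebraMap K Ω a)) :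
    LinearIndependent K x := by
  classical
  have := Fintype.ofFinite ι
  rw [Fintype.linearIndependent_iff]
  intro g hg i
  by_contra hi
  set S := Finset.univ.filter fun i => g i ≠ 0 with hS
  have hSn : S.Nonempty := ⟨i, by simp [hS, hi]⟩
  have hne : ∀ i ∈ S, g i • x i ≠ 0 := by
    intro i hi
    exact smul_ne_zero (by simpa [hS] using hi) (hx i)
  obtain ⟨j, hj, hjmin⟩ := S.exists_min_image (fun i => v.w (g i • x i)) hSn
  have hsum : g j • x j + ∑ i ∈ S.erase j, g i • x i = 0 := by
    rw [Finset.add_sum_erase S (fun i => g i • x i) hj, ← hg]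
    apply Finset.sum_subset (Finset.subset_univ _)
    intro k _ hk
    have : g k = 0 := by simpa [hS] using hk
    simp [this]
  have hw : ∀ i ∈ S, v.w (g i • x i) = v.w (algebraMap K Ω (g i)) + v.w (x i) := by
    intro i hi
    rw [Algebra.smul_def, v.map_mul _ _ ((_root_.map_ne_zero _).2 (by simpa [hS] using hi)) (hx i)]
  refine (w_add_of_gt (hne j hj) ((v.gt _).sum_mem fun k hk => ?_)).1 hsum
  obtain ⟨hkj, hk⟩ := Finset.mem_erase.1 hk
  refine Or.inr (lt_of_le_of_ne (hjmin k hk) fun heq => ?_)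
  rw [hw j hj, hw k hk] at heq
  have hgj : g j ≠ 0 := by simpa [hS] using hj
  have hgk : g k ≠ 0 := by simpa [hS] using hk
  apply h j k (Ne.symm hkj) (g k / g j) (div_ne_zero hgk hgj)
  rw [map_div₀, w_div _ ((_root_.map_ne_zero _).2 hgk) ((_root_.map_ne_zero _).2 hgj)]
  linarith

end RatVal

/-- The two lowest and the highest term of `(1 + x) ^ p`. -/
lemma exists_one_add_pow_prime {R : Type} [CommRing R] {p : ℕ} (hp : p.Prime) :
    ∃ S : Polynomial ℤ, ∀ x : R,
      (1 + x) ^ p = 1 + p * x + x ^ p + p * x ^ 2 * Polynomial.aeval x S := by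
  obtain ⟨m, rfl⟩ : ∃ m, p = m + 2 := ⟨p - 2, by have := hp.two_le; omega⟩
  refine ⟨∑ i ∈ Finset.range m,
    Polynomial.C (((m + 2).choose (i + 2) / (m + 2) : ℕ) : ℤ) * Polynomial.X ^ i, fun x => ?_⟩
  rw [add_comm 1 x, add_pow, Finset.sum_range_succ, Finset.sum_range_succ',
    Finset.sum_range_succ', map_sum, Finset.mul_sum]
  have : ∀ i ∈ Finset.range m,
      x ^ (i + 1 + 1) * 1 ^ (m + 2 - (i + 1 + 1)) * ((m + 2).choose (i + 1 + 1) : R) =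
      ((m + 2 : ℕ) : R) * x ^ 2 * Polynomial.aeval x
        (Polynomial.C (((m + 2).choose (i + 2) / (m + 2) : ℕ) : ℤ) * Polynomial.X ^ i) := by
    intro i hi
    have hi := Finset.mem_range.1 hi
    have hd : m + 2 ∣ (m + 2).choose (i + 2) :=
      hp.dvd_choose_self (by omega) (by omega)
    conv_lhs => rw [show i + 1 + 1 = i + 2 from rfl, ← Nat.mul_div_cancel' hd]
    generalize (m + 2).choose (i + 2) / (m + 2) = k
    simp only [map_mul, map_pow, Polynomial.aeval_X, Polynomial.aeval_C]
    push_cast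
    simp
    ring
  rw [Finset.sum_congr rfl this]
  simp
  ring

lemma RatVal.aeval_int_mem {Ω : Type} [Field Ω] {v : RatVal Ω} {x : Ω} (hx : x ∈ v.ge 0)
    (S : Polynomial ℤ) : Polynomial.aeval x S ∈ v.ge 0 := by
  rw [Polynomial.aeval_eq_sum_range]
  refine (v.ge 0).sum_mem fun i _ => ?_
  rw [zsmul_eq_mul]
  refine mul_mem_of_ge_zero (intCast_mem _) ?_
  simpa using pow_mem hx i

lemma RatVal.pow_sub_one_mem {Ω : Type} [Field Ω] {v : RatVal Ω} {x : Ω} {r : ℚ} (hr : 0 ≤ r)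
    (hx : x - 1 ∈ v.ge r) (k : ℕ) : x ^ k - 1 ∈ v.ge r := by
  have hx0 : x ∈ v.ge 0 := by
    simpa using (v.ge 0).add_mem (ge_mono hx hr) one_mem
  induction k with
  | zero => simp
  | succ k ih =>
    have : x ^ (k + 1) - 1 = x * (x ^ k - 1) + (x - 1) := by ring
    rw [this]
    exact (v.ge r).add_mem (mul_mem_of_ge_zero hx0 ih) hx

lemma RatVal.pow_sub_pow_mem {Ω : Type} [Field Ω] {v : RatVal Ω} {x y : Ω} {r : ℚ}
    (hx : x ∈ v.ge 0) (hy : y ∈ v.ge 0) (h : x - y ∈ v.ge r) (k : ℕ) :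
    x ^ k - y ^ k ∈ v.ge r := by
  induction k with
  | zero => simp
  | succ k ih =>
    have : x ^ (k + 1) - y ^ (k + 1) = x * (x ^ k - y ^ k) + y ^ k * (x - y) := by ring
    rw [this]
    exact (v.ge r).add_mem (mul_mem_of_ge_zero hx ih)
      (mul_mem_of_ge_zero (by simpa using pow_mem hy k) h)

/-- The equation satisfied by `ω - 1` for a primitive `p`-th root of unity `ω`. -/
lemma RatVal.primitiveRoot_sub_one {Ω : Type} [Field Ω] {v : RatVal Ω} {p : ℕ} (hp : p.Prime)
    (p_ne : (p : Ω) ≠ 0) (hw : 0 < v.w (p : Ω)) {ω : Ω} (hω : IsPrimitiveRoot ω p) :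
    ω - 1 ≠ 0 ∧ ((p : ℚ) - 1) * v.w (ω - 1) = v.w (p : Ω) ∧
      (ω - 1) ^ (p - 1) + p ∈ v.ge (v.w (p : Ω) + v.w (ω - 1)) := by
  have hne : ω - 1 ≠ 0 := sub_ne_zero.2 (hω.ne_one hp.one_lt)
  obtain ⟨F, hF⟩ := exists_one_add_pow_prime (R := Ω) hp
  have h1 := hF (ω - 1)
  rw [add_sub_cancel, hω.pow_eq_one] at h1
  have hω0 : v.w ω = 0 := by
    apply w_eq_of_pow hp.ne_zero (hω.ne_zero hp.ne_zero)
    rw [hω.pow_eq_one, w_one, mul_zero]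
  have hge : ω - 1 ∈ v.ge 0 := (v.ge 0).sub_mem (mem_ge_of_eq hω0) one_mem
  set s := Polynomial.aeval (ω - 1) F with hs
  have hs0 : s ∈ v.ge 0 := aeval_int_mem hge F
  have hpow : (ω - 1) ^ p = (ω - 1) ^ (p - 1) * (ω - 1) := by
    rw [← pow_succ, Nat.sub_add_cancel hp.one_le]
  rw [hpow] at h1
  have h2 : (ω - 1) ^ (p - 1) = -p * (1 + (ω - 1) * s) := by
    have : (ω - 1) * ((ω - 1) ^ (p - 1) + p * (1 + (ω - 1) * s)) = 0 := by linear_combination -h1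
    linear_combination (mul_eq_zero.1 this).resolve_left hne
  have hp1 : ((p - 1 : ℕ) : ℚ) = p - 1 := by rw [Nat.cast_sub hp.one_le, Nat.cast_one]
  have hp2 : (1 : ℚ) < p := by exact_mod_cast hp.one_lt
  have h1s : 1 + (ω - 1) * s ∈ v.ge 0 := (v.ge 0).add_mem one_mem (mul_mem_of_ge_zero hge hs0)
  have hpos : 0 < v.w (ω - 1) := by
    have h3 : (ω - 1) ^ (p - 1) ∈ v.ge (v.w (p : Ω)) := by
      rw [h2, mul_comm]
      exact mul_mem_of_ge_zero h1s (by simpa using mem_ge_self (v := v) (p : Ω))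
    have h4 := le_w h3 (pow_ne_zero _ hne)
    rw [w_pow _ hne, hp1] at h4
    by_contra! hle
    nlinarith
  have hunit := w_add_of_gt (v := v) (y := (ω - 1) * s) one_ne_zero (by
    rw [w_one, mul_comm]
    simpa using mul_mem_gt hs0 (Or.inr hpos : ω - 1 ∈ v.gt 0))
  refine ⟨hne, ?_, ?_⟩
  · rw [← hp1, ← w_pow _ hne, h2, v.map_mul _ _ (neg_ne_zero.2 p_ne) hunit.1, hunit.2, w_one, w_neg,
      add_zero]
  · rw [h2, show -(p : Ω) * (1 + (ω - 1) * s) + p = -(p * ((ω - 1) * s)) by ring]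
    refine (v.ge _).neg_mem (mul_mem (mem_ge_self _) ?_)
    rw [mul_comm]
    exact mul_mem_of_ge_zero hs0 (mem_ge_self _)

/-- A field `K` inside an algebraically closed valued field `Ω`, with valuation group `ℤ` and
no residue extension in `Ω`, containing the parameter `c` of the curve `Y ^ p = f_{q,c}(X)` and
an element `μ` with `μ ^ (q + 1) = ζ - 1`, which has valuation `1`. -/
structure MonodromySetting (K Ω : Type) [Field K] [Field Ω] [Algebra K Ω] (p n : ℕ) where
  /-- The valuation, normalized on `K`. -/
  v : RatVal Ω
  hp : p.Prime
  hn : 1 ≤ n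
  p_ne : (p : Ω) ≠ 0
  w_p : v.w (p : Ω) = ((p : ℚ) - 1) * ((p : ℚ) ^ n + 1)
  w_map : ∀ (σ : Ω ≃ₐ[K] Ω) (x : Ω), v.w (σ x) = v.w x
  inertia : ∀ (σ : Ω ≃ₐ[K] Ω) (x : Ω), x ∈ v.ge 0 → σ x - x ∈ v.gt 0
  w_int : ∀ a : K, a ≠ 0 → ∃ m : ℤ, v.w (algebraMap K Ω a) = m
  /-- A primitive `p`-th root of unity. -/
  ζ : Ω
  hζ : IsPrimitiveRoot ζ p
  /-- A uniformizer of `K`. -/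
  μ : K
  hμ : (algebraMap K Ω μ) ^ (p ^ n + 1) = ζ - 1
  /-- The parameter of the curve. -/
  c : K
  c_ne : c ≠ 0
  c_nonneg : 0 ≤ v.w (algebraMap K Ω c)
  c_lt : v.w (algebraMap K Ω c) < p
  c_pow : (algebraMap K Ω c) ^ p - algebraMap K Ω c ∈ v.ge (v.w (p : Ω))

namespace MonodromySetting

open RatVal

variable {K Ω : Type} [Field K] [Field Ω] [Algebra K Ω] {p n : ℕ}
variable (S : MonodromySetting K Ω p n)

/-- The prime `p` as a rational number. -/
def P (_ : MonodromySetting K Ω p n) : ℚ := p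

/-- The prime power `q` as a rational number. -/
def Q (_ : MonodromySetting K Ω p n) : ℚ := (p : ℚ) ^ n

/-- The quotient `p / q`. -/
def κ (S : MonodromySetting K Ω p n) : ℚ := S.P / S.Q

/-- The quotient `p / q ^ 2`. -/
def τ (S : MonodromySetting K Ω p n) : ℚ := S.κ / S.Q

lemma two_le_P : 2 ≤ S.P := by
  have := S.hp.two_le
  unfold P
  exact_mod_cast this

lemma P_le_Q : S.P ≤ S.Q := by
  have h1 : (1 : ℚ) ≤ p := by exact_mod_cast S.hp.one_le
  simpa [P, Q] using pow_le_pow_right₀ h1 S.hn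

/-- The numerical facts used to compare valuations. -/
lemma facts : 2 ≤ S.P ∧ S.P ≤ S.Q ∧ 2 * S.P ≤ S.P * S.Q ∧ 2 * S.Q ≤ S.P * S.Q ∧
    0 < S.κ ∧ S.κ ≤ 1 ∧ 0 < S.τ ∧ 2 * S.τ ≤ S.κ ∧ S.κ * S.Q = S.P ∧ S.τ * S.Q = S.κ ∧
    S.τ * S.Q * S.Q = S.P := by
  have h1 := S.two_le_P
  have h2 := S.P_le_Q
  have hQ : 0 < S.Q := by linarith
  have hκ : S.κ * S.Q = S.P := by unfold κ; field_simp
  have hτ : S.τ * S.Q = S.κ := by unfold τ; field_simp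
  have hκ0 : 0 < S.κ := div_pos (by linarith) hQ
  have hτ0 : 0 < S.τ := div_pos hκ0 hQ
  refine ⟨h1, h2, ?_, ?_, hκ0, ?_, hτ0, ?_, hκ, hτ, by rw [hτ, hκ]⟩
  · nlinarith
  · nlinarith
  · exact (div_le_one hQ).2 h2
  · nlinarith

lemma w_p' : S.v.w (p : Ω) = S.P * S.Q + S.P - S.Q - 1 := by
  rw [S.w_p]
  unfold P Q
  ring

lemma pow_p_mem {x : Ω} {r : ℚ} (hx : x ∈ S.v.ge r) : x ^ p ∈ S.v.ge (S.P * r) :=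
  pow_mem hx p

lemma pow_q_mem {x : Ω} {r : ℚ} (hx : x ∈ S.v.ge r) : x ^ p ^ n ∈ S.v.ge (S.Q * r) := by
  simpa [Q] using pow_mem hx (p ^ n)

lemma neg_one_pow_add_one_mem : (-1 : Ω) ^ p ^ n + 1 ∈ S.v.ge (S.v.w (p : Ω)) := by
  rcases S.hp.eq_two_or_odd' with h | h
  · have : Even (p ^ n) := by
      rw [h]
      exact (even_two).pow_of_ne_zero (by have := S.hn; omega)
    rw [this.neg_one_pow, one_add_one_eq_two]
    have h2 : (p : Ω) = 2 := by rw [h]; norm_num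
    rw [h2]
    exact mem_ge_self _
  · rw [(h.pow).neg_one_pow]
    simp

/-- The element `λ = ζ - 1`. -/
def lam : Ω := S.ζ - 1

lemma root_sub_one {ω : Ω} (hω : IsPrimitiveRoot ω p) :
    ω - 1 ≠ 0 ∧ S.v.w (ω - 1) = S.Q + 1 ∧
      (ω - 1) ^ (p - 1) + p ∈ S.v.ge (S.v.w (p : Ω) + (S.Q + 1)) := by
  obtain ⟨hP, hPQ, -⟩ := S.facts
  have hw := S.w_p'
  obtain ⟨h1, h2, h3⟩ := primitiveRoot_sub_one S.hp S.p_ne (by nlinarith) hω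
  change (S.P - 1) * _ = _ at h2
  have h4 : S.v.w (ω - 1) = S.Q + 1 := by
    have : (S.P - 1) * (S.v.w (ω - 1) - (S.Q + 1)) = 0 := by linarith
    rcases mul_eq_zero.1 this with h | h <;> linarith
  rw [h4] at h3
  exact ⟨h1, h4, h3⟩

lemma lam_ne : S.lam ≠ 0 := (S.root_sub_one S.hζ).1

lemma w_lam : S.v.w S.lam = S.Q + 1 := (S.root_sub_one S.hζ).2.1

/-- The uniformizer of `K` as an element of `Ω`. -/
def mu : Ω := algebraMap K Ω S.μ

lemma mu_pow : S.mu ^ (p ^ n + 1) = S.lam := S.hμ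

lemma mu_ne : S.mu ≠ 0 := by
  intro h
  have := S.mu_pow
  rw [h, zero_pow (by omega)] at this
  exact S.lam_ne this.symm

lemma w_mu : S.v.w S.mu = 1 := by
  apply w_eq_of_pow (k := p ^ n + 1) (by omega) S.mu_ne
  rw [S.mu_pow, S.w_lam]
  simp [Q]

lemma map_mu (σ : Ω ≃ₐ[K] Ω) : σ S.mu = S.mu := σ.commutes _

lemma map_lam (σ : Ω ≃ₐ[K] Ω) : σ S.lam = S.lam := by
  rw [← S.mu_pow, map_pow, S.map_mu]

lemma map_ζ (σ : Ω ≃ₐ[K] Ω) : σ S.ζ = S.ζ := by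
  have := S.map_lam σ
  simpa [lam] using this

lemma w_mu_pow_p : S.v.w (S.mu ^ p) = S.P := by
  rw [w_pow _ S.mu_ne, S.w_mu]
  simp [P]

/-- A `p`-th root of unity congruent to `1` to high order is `1`. -/
lemma root_eq_one {ω : Ω} (hω : ω ^ p = 1) (h : ω - 1 ∈ S.v.gt (S.Q + 1)) : ω = 1 := by
  by_contra hne
  have : IsPrimitiveRoot ω p := by
    have := Fact.mk S.hp
    rw [← orderOf_eq_prime hω hne]
    exact IsPrimitiveRoot.orderOf ω
  have h2 := S.root_sub_one this
  have := lt_w h h2.1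
  linarith [h2.2.1]

/-- The quotient `λ ^ (p - 1) / (-p)` is congruent to `1` modulo `λ`. -/
lemma lam_div : -(p : Ω) / S.lam ^ (p - 1) - 1 ∈ S.v.ge (S.Q + 1) := by
  have h := (S.root_sub_one S.hζ).2.2
  have hl := S.lam_ne
  have hw : S.v.w (S.lam ^ (p - 1)) = S.v.w (p : Ω) := by
    rw [w_pow _ hl, S.w_lam, Nat.cast_sub S.hp.one_le, S.w_p]
    simp [Q]
  have h2 := div_mem h (pow_ne_zero (p - 1) hl)
  rw [hw] at h2
  have : -(p : Ω) / S.lam ^ (p - 1) - 1 =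
      -(((S.ζ - 1) ^ (p - 1) + p) / S.lam ^ (p - 1)) := by
    have := pow_ne_zero (p - 1) hl
    field_simp
    rw [lam]
    ring
  rw [this]
  exact ge_mono ((S.v.ge _).neg_mem h2) (by linarith)

lemma lam_pow_div : S.lam ^ p / -(p : Ω) - S.lam ∈ S.v.ge (2 * (S.Q + 1)) := by
  have hl := S.lam_ne
  have h := S.lam_div
  obtain ⟨hP, hPQ, -⟩ := S.facts
  have hx : -(p : Ω) / S.lam ^ (p - 1) ≠ 0 := div_ne_zero (neg_ne_zero.2 S.p_ne) (pow_ne_zero _ hl)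
  have hw : S.v.w (-(p : Ω) / S.lam ^ (p - 1)) = 0 := by
    rw [← w_one S.v]
    refine (w_eq_of_sub one_ne_zero (gt_of_ge h ?_)).2
    rw [w_one]
    linarith
  have h2 := div_mem h hx
  rw [hw] at h2
  have hpow : S.lam ^ p = S.lam ^ (p - 1) * S.lam := by
    rw [← pow_succ, Nat.sub_add_cancel S.hp.one_le]
  have : S.lam ^ p / -(p : Ω) - S.lam = -(S.lam *
      ((-(p : Ω) / S.lam ^ (p - 1) - 1) / (-(p : Ω) / S.lam ^ (p - 1)))) := by
    have := pow_ne_zero (p - 1) hl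
    have := S.p_ne
    rw [hpow]
    field_simp
    ring
  rw [this]
  refine (S.v.ge _).neg_mem (ge_mono (mul_mem (mem_ge_of_eq S.w_lam) h2) (by linarith))

/-- The constant `a_n`. -/
def a (_ : MonodromySetting K Ω p n) : Ω := aCoef Ω p n

/-- The exponent of `-p` in the constant `a_n`. -/
def expo (_ : MonodromySetting K Ω p n) : ℕ := ∑ i ∈ Finset.range n, p ^ (i + 1)

lemma expo_eq : (p - 1) * S.expo + p = p * p ^ n := by
  obtain ⟨m, hm⟩ : ∃ m, p = m + 1 := ⟨p - 1, by have := S.hp.pos; omega⟩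
  unfold expo
  rw [← pow_succ']
  subst hm
  simp only [Nat.add_sub_cancel]
  clear S
  induction n with
  | zero => simp
  | succ n ih =>
    rw [Finset.sum_range_succ, mul_add, pow_succ (m + 1) (n + 1)]
    linarith

lemma expo_eq' : (S.P - 1) * S.expo = S.P * S.Q - S.P := by
  have h := S.expo_eq
  have h1 : ((p - 1 : ℕ) : ℚ) = S.P - 1 := by
    rw [Nat.cast_sub S.hp.one_le]
    simp [P]
  have h2 : (((p - 1) * S.expo + p : ℕ) : ℚ) = ((p * p ^ n : ℕ) : ℚ) := by rw [h]
  rw [Nat.cast_add, Nat.cast_mul, Nat.cast_mul, h1] at h2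
  simp only [P, Q] at *
  push_cast at h2
  linarith

lemma a_eq : S.a = (-1) ^ p ^ n * (-(p : Ω)) ^ S.expo := rfl

lemma a_ne : S.a ≠ 0 := by
  rw [a_eq]
  exact mul_ne_zero (by simp) (pow_ne_zero _ (neg_ne_zero.2 S.p_ne))

lemma w_a : S.v.w S.a = S.P * S.Q * S.Q - S.P := by
  rw [a_eq, S.v.map_mul _ _ (by simp) (pow_ne_zero _ (neg_ne_zero.2 S.p_ne)),
    w_pow _ (by simp), w_neg, w_one, w_pow _ (neg_ne_zero.2 S.p_ne), w_neg, S.w_p']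
  linear_combination (S.Q + 1) * S.expo_eq'

lemma a_div : S.a / S.lam ^ ((p - 1) * S.expo) + 1 ∈ S.v.gt S.κ := by
  have h1 := pow_sub_one_mem (by linarith [S.facts.1, S.facts.2.1]) S.lam_div S.expo
  have h2 := S.neg_one_pow_add_one_mem
  obtain ⟨hP, hPQ, hPQ1, hPQ2, hκ0, hκ1, -⟩ := S.facts
  have : S.a / S.lam ^ ((p - 1) * S.expo) + 1 =
      (-1) ^ p ^ n * ((-(p : Ω) / S.lam ^ (p - 1)) ^ S.expo - 1) + ((-1) ^ p ^ n + 1) := by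
    rw [a_eq, pow_mul, div_pow]
    ring
  rw [this, S.w_p'] at *
  refine (S.v.gt _).add_mem (gt_of_ge (mul_mem_of_ge_zero ?_ h1) ?_) (gt_of_ge h2 ?_)
  · exact mem_ge_of_eq (by rw [w_pow _ (by simp), w_neg, w_one, mul_zero])
  · linarith
  · linarith

lemma mu_pow_pow : (S.mu ^ p) ^ (p ^ n * p ^ n) = S.lam ^ ((p - 1) * S.expo) * S.mu ^ p := by
  have h : p * (p ^ n * p ^ n) = (p ^ n + 1) * ((p - 1) * S.expo) + p := by
    have h := S.expo_eq
    generalize (p - 1) * S.expo = x at *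
    zify at h ⊢
    linear_combination (-(p : ℤ) ^ n - 1) * h
  calc (S.mu ^ p) ^ (p ^ n * p ^ n) = S.mu ^ ((p ^ n + 1) * ((p - 1) * S.expo) + p) := by
        rw [← pow_mul, h]
    _ = _ := by rw [pow_add, pow_mul, S.mu_pow]

/-- The parameter `c` as an element of `Ω`. -/
def cc : Ω := algebraMap K Ω S.c

lemma cc_ne : S.cc ≠ 0 := (_root_.map_ne_zero _).2 S.c_ne

lemma map_cc (σ : Ω ≃ₐ[K] Ω) : σ S.cc = S.cc := σ.commutes _

lemma w_cc : S.v.w S.cc = 0 := by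
  by_contra h
  have h0 : 0 < S.v.w S.cc := lt_of_le_of_ne S.c_nonneg (Ne.symm h)
  obtain ⟨hP, hPQ, hPQ1, hPQ2, hκ0, hκ1, -⟩ := S.facts
  have h1 := S.pow_p_mem (mem_ge_self S.cc)
  have h2 : S.cc ^ p ∈ S.v.gt (S.v.w S.cc) := gt_of_ge h1 (by nlinarith)
  have h3 := (S.v.gt _).sub_mem h2 (gt_of_ge S.c_pow (by
    have : S.v.w S.cc < S.P := S.c_lt
    rw [S.w_p']
    linarith))
  have h4 : S.cc ^ p - (algebraMap K Ω S.c ^ p - algebraMap K Ω S.c) = S.cc := by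
    rw [cc]
    ring
  rw [h4] at h3
  exact lt_irrefl _ (lt_w h3 S.cc_ne)

/-- The polynomial function `f_{q,c}`. -/
def f (x : Ω) : Ω := 1 + S.cc * x ^ p ^ n + x ^ (p ^ n + 1)

/-- The roots of the monodromy polynomial `L_c`. -/
def IsRt (y : Ω) : Prop := y ^ (p ^ n * p ^ n) = S.a * (S.cc + y) * S.f y ^ (p ^ n - 1)

lemma map_f (σ : Ω ≃ₐ[K] Ω) (x : Ω) : σ (S.f x) = S.f (σ x) := by
  simp [f, S.map_cc]

lemma map_a (σ : Ω ≃ₐ[K] Ω) : σ S.a = S.a := by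
  simp [a_eq]

variable {S} in
lemma IsRt.map {y : Ω} (hy : S.IsRt y) (σ : Ω ≃ₐ[K] Ω) : S.IsRt (σ y) := by
  have h := congrArg σ hy
  simpa [IsRt, S.map_f, S.map_a, S.map_cc] using h

lemma cast_q_sub_one : ((p ^ n - 1 : ℕ) : ℚ) = S.Q - 1 := by
  rw [Nat.cast_sub (Nat.one_le_pow _ _ S.hp.pos)]
  simp [Q]

variable {S} in
lemma f_sub_one_mem {y : Ω} {r : ℚ} (hr : 0 ≤ r) (hy : y ∈ S.v.ge r) :
    S.f y - 1 ∈ S.v.ge (S.Q * r) := by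
  have h1 := S.pow_q_mem hy
  have h2 : S.f y - 1 = S.cc * y ^ p ^ n + y * y ^ p ^ n := by
    unfold f
    ring
  rw [h2]
  exact (S.v.ge _).add_mem (mul_mem_of_ge_zero (mem_ge_of_eq S.w_cc) h1)
    (mul_mem_of_ge_zero (ge_mono hy hr) h1)

namespace IsRt

variable {S} {y : Ω} (hy : S.IsRt y)
include hy

lemma ne_zero : y ≠ 0 := by
  rintro rfl
  have h1 : p ^ n ≠ 0 := pow_ne_zero _ S.hp.ne_zero
  have h2 := hy
  rw [IsRt, f, zero_pow (mul_ne_zero h1 h1), zero_pow h1, zero_pow (Nat.succ_ne_zero _)] at h2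
  simp [S.a_ne, S.cc_ne] at h2

lemma w_pos : 0 < S.v.w y := by
  by_contra! hle
  obtain ⟨hP, hPQ, hPQ1, hPQ2, hκ0, hκ1, -⟩ := S.facts
  have hyr := mem_ge_self (v := S.v) y
  have h1 := pow_mem hyr (p ^ n + 1)
  have h2 := S.pow_q_mem hyr
  have hf : S.f y ∈ S.v.ge ((S.Q + 1) * S.v.w y) := by
    refine (S.v.ge _).add_mem ((S.v.ge _).add_mem (ge_mono one_mem ?_)
      (ge_mono (mul_mem_of_ge_zero (mem_ge_of_eq S.w_cc) h2) ?_)) (ge_mono h1 ?_)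
    · nlinarith
    · linarith
    · simp [Q]
  have h3 := mul_mem (mul_mem (mem_ge_of_eq S.w_a)
    ((S.v.ge (S.v.w y)).add_mem (ge_mono (mem_ge_of_eq S.w_cc) hle) hyr)) (pow_mem hf (p ^ n - 1))
  have h4 : y ^ (p ^ n * p ^ n) = S.a * (S.cc + y) * S.f y ^ (p ^ n - 1) := hy
  rw [← h4, S.cast_q_sub_one] at h3
  have h5 := le_w h3 (pow_ne_zero _ hy.ne_zero)
  rw [w_pow _ hy.ne_zero] at h5
  have h6 : ((p ^ n * p ^ n : ℕ) : ℚ) = S.Q * S.Q := by simp [Q]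
  rw [h6] at h5
  nlinarith

lemma f_unit : S.f y ≠ 0 ∧ S.v.w (S.f y) = 0 := by
  obtain ⟨hP, hPQ, hPQ1, hPQ2, hκ0, hκ1, -⟩ := S.facts
  have h := f_sub_one_mem hy.w_pos.le (mem_ge_self y)
  rw [← w_one S.v]
  refine w_eq_of_sub one_ne_zero (gt_of_ge h ?_)
  rw [w_one]
  exact mul_pos (by linarith) hy.w_pos

lemma c_add_unit : S.cc + y ≠ 0 ∧ S.v.w (S.cc + y) = 0 := by
  have h := w_add_of_gt S.cc_ne (Or.inr (by rw [S.w_cc]; exact hy.w_pos) : y ∈ S.v.gt _)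
  rwa [S.w_cc] at h

lemma w_eq : S.v.w y = S.P - S.τ := by
  obtain ⟨hP, hPQ, hPQ1, hPQ2, hκ0, hκ1, hτ0, hτκ, hκQ, hτQ, hτQQ⟩ := S.facts
  have h4 : y ^ (p ^ n * p ^ n) = S.a * (S.cc + y) * S.f y ^ (p ^ n - 1) := hy
  have h5 := congrArg S.v.w h4
  rw [S.v.map_mul _ _ (mul_ne_zero S.a_ne hy.c_add_unit.1) (pow_ne_zero _ hy.f_unit.1),
    S.v.map_mul _ _ S.a_ne hy.c_add_unit.1, w_pow _ hy.f_unit.1, hy.f_unit.2, hy.c_add_unit.2,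
    S.w_a, w_pow _ hy.ne_zero] at h5
  have h6 : ((p ^ n * p ^ n : ℕ) : ℚ) = S.Q * S.Q := by simp [Q]
  rw [h6] at h5
  have hQQ : S.Q * S.Q ≠ 0 := by
    have : S.Q ≠ 0 := by linarith
    exact mul_ne_zero this this
  apply mul_left_cancel₀ hQQ
  linarith

lemma mem : y ∈ S.v.ge (S.P - S.τ) := mem_ge_of_eq hy.w_eq

lemma f_sub_one : S.f y - 1 ∈ S.v.ge (S.P * S.Q - S.κ) := by
  obtain ⟨hP, hPQ, hPQ1, hPQ2, hκ0, hκ1, hτ0, hτκ, hκQ, hτQ, hτQQ⟩ := S.facts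
  exact ge_mono (f_sub_one_mem (by linarith) hy.mem) (by linarith)

end IsRt

end MonodromySetting

namespace RatVal

variable {Ω : Type} [Field Ω] {v : RatVal Ω}

lemma pow_sub_pow_mem_gt {x y : Ω} {r : ℚ} (hx : x ∈ v.ge 0) (hy : y ∈ v.ge 0)
    (h : x - y ∈ v.gt r) (k : ℕ) : x ^ k - y ^ k ∈ v.gt r := by
  by_cases h0 : x - y = 0
  · rw [sub_eq_zero.1 h0, sub_self]
    exact (v.gt r).zero_mem
  · exact gt_of_ge (pow_sub_pow_mem hx hy (mem_ge_self _) k) (lt_w h h0)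

lemma pow_mem_gt {x : Ω} {r : ℚ} (hx : x ∈ v.gt r) {k : ℕ} (hk : k ≠ 0) :
    x ^ k ∈ v.gt (k * r) := by
  rcases mem_gt.1 hx with rfl | h
  · rw [zero_pow hk]
    exact (v.gt _).zero_mem
  · refine gt_of_ge (pow_mem (mem_ge_self x) k) ?_
    exact mul_lt_mul_of_pos_left h (by positivity)

end RatVal

namespace MonodromySetting

open RatVal

variable {K Ω : Type} [Field K] [Field Ω] [Algebra K Ω] {p n : ℕ}
variable {S : MonodromySetting K Ω p n}

lemma cast_qq (S : MonodromySetting K Ω p n) : ((p ^ n * p ^ n : ℕ) : ℚ) = S.Q * S.Q := by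
  simp [Q]

/-- The binomial theorem for the exponent `q`. -/
lemma add_pow_q_sub_mem (S : MonodromySetting K Ω p n) {a b : ℚ} (hab : a ≤ b) {x y : Ω}
    (hx : x ∈ S.v.ge a) (hy : y ∈ S.v.ge b) :
    (x + y) ^ p ^ n - x ^ p ^ n - y ^ p ^ n ∈ S.v.ge (S.v.w p + (S.Q * a + (b - a))) :=
  add_pow_sub_mem S.hp hab hx hy

/-- The binomial theorem for the exponent `q ^ 2`. -/
lemma add_pow_qq_sub_mem (S : MonodromySetting K Ω p n) {a b : ℚ} (hab : a ≤ b) {x y : Ω}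
    (hx : x ∈ S.v.ge a) (hy : y ∈ S.v.ge b) :
    (x + y) ^ (p ^ n * p ^ n) - x ^ (p ^ n * p ^ n) - y ^ (p ^ n * p ^ n) ∈
      S.v.ge (S.v.w p + (S.Q * S.Q * a + (b - a))) := by
  have := add_pow_sub_mem (k := n + n) S.hp hab hx hy
  rw [pow_add] at this
  simpa only [Q, pow_add] using this

lemma f_sub (S : MonodromySetting K Ω p n) (x y : Ω) :
    S.f x - S.f y = (S.cc + x) * (x ^ p ^ n - y ^ p ^ n) + y ^ p ^ n * (x - y) := by
  unfold f
  ring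

namespace IsRt

variable {y y' : Ω}

/-- Two distinct roots of the monodromy polynomial have distance exactly `p`. -/
lemma w_sub (hy : S.IsRt y) (hy' : S.IsRt y') (hne : y' - y ≠ 0) : S.v.w (y' - y) = S.P := by
  obtain ⟨hP, hPQ, hPQ1, hPQ2, hκ0, hκ1, hτ0, hτκ, hκQ, hτQ, hτQQ⟩ := S.facts
  obtain ⟨d, rfl⟩ : ∃ d, y' = y + d := ⟨y' - y, by ring⟩
  rw [add_sub_cancel_left] at *
  set r := S.v.w d with hr
  have hd : d ∈ S.v.ge r := mem_ge_self d
  have hr0 : S.P - S.τ ≤ r := by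
    have := (S.v.ge _).sub_mem hy'.mem hy.mem
    rw [add_sub_cancel_left] at this
    exact le_w this hne
  have hw := S.w_p'
  have hdq := S.pow_q_mem hd
  have hyq := S.pow_q_mem hy.mem
  have h1 := S.add_pow_q_sub_mem hr0 hy.mem hd
  have h2 : (y + d) ^ p ^ n - y ^ p ^ n ∈ S.v.gt r := by
    have := (S.v.gt r).add_mem (gt_of_ge h1 (by nlinarith)) (gt_of_ge hdq (by nlinarith))
    rwa [sub_add_cancel] at this
  have hf : S.f (y + d) - S.f y ∈ S.v.gt r := by
    rw [f_sub, add_sub_cancel_left]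
    refine (S.v.gt r).add_mem ?_ (gt_of_ge (mul_mem hyq hd) (by nlinarith))
    simpa using mul_mem_gt (mem_ge_of_eq hy'.c_add_unit.2) h2
  have hF := pow_sub_pow_mem_gt (mem_ge_of_eq hy'.f_unit.2) (mem_ge_of_eq hy.f_unit.2) hf
    (p ^ n - 1)
  have h3 := S.add_pow_qq_sub_mem hr0 hy.mem hd
  have e1 : y ^ (p ^ n * p ^ n) = S.a * (S.cc + y) * S.f y ^ (p ^ n - 1) := hy
  have e2 : (y + d) ^ (p ^ n * p ^ n) = S.a * (S.cc + (y + d)) * S.f (y + d) ^ (p ^ n - 1) := hy'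
  have hm : S.a * d * S.f (y + d) ^ (p ^ n - 1) ≠ 0 :=
    mul_ne_zero (mul_ne_zero S.a_ne hne) (pow_ne_zero _ hy'.f_unit.1)
  have hwm : S.v.w (S.a * d * S.f (y + d) ^ (p ^ n - 1)) = S.P * S.Q * S.Q - S.P + r := by
    rw [S.v.map_mul _ _ (mul_ne_zero S.a_ne hne) (pow_ne_zero _ hy'.f_unit.1),
      S.v.map_mul _ _ S.a_ne hne, w_pow _ hy'.f_unit.1, hy'.f_unit.2, S.w_a]
    ring
  have h4 : d ^ (p ^ n * p ^ n) - S.a * d * S.f (y + d) ^ (p ^ n - 1) ∈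
      S.v.gt (S.v.w (S.a * d * S.f (y + d) ^ (p ^ n - 1))) := by
    have e3 : d ^ (p ^ n * p ^ n) - S.a * d * S.f (y + d) ^ (p ^ n - 1) =
        S.a * (S.cc + y) * (S.f (y + d) ^ (p ^ n - 1) - S.f y ^ (p ^ n - 1)) -
        ((y + d) ^ (p ^ n * p ^ n) - y ^ (p ^ n * p ^ n) - d ^ (p ^ n * p ^ n)) := by
      rw [e1, e2]
      ring
    rw [e3, hwm]
    refine (S.v.gt _).sub_mem ?_ (gt_of_ge h3 ?_)
    · have := mul_mem_gt (mul_mem (mem_ge_of_eq S.w_a) (mem_ge_of_eq hy.c_add_unit.2)) hF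
      rwa [add_zero] at this
    · have : S.Q * S.Q * (S.P - S.τ) = S.P * S.Q * S.Q - S.P := by
        rw [← hτQQ]
        ring
      rw [this]
      nlinarith
  have h5 := (w_eq_of_sub hm h4).2
  rw [hwm, w_pow _ hne, S.cast_qq] at h5
  have : (S.Q * S.Q - 1) * (r - S.P) = 0 := by linarith
  have h6 : S.Q * S.Q - 1 ≠ 0 := by nlinarith
  linarith [(mul_eq_zero.1 this).resolve_left h6]

lemma sub_mem (hy : S.IsRt y) (hy' : S.IsRt y') : y' - y ∈ S.v.ge S.P := by
  by_cases h : y' - y = 0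
  · exact Or.inl h
  · exact mem_ge_of_eq (hy.w_sub hy' h)

lemma eq_of_sub_mem (hy : S.IsRt y) (hy' : S.IsRt y') (h : y' - y ∈ S.v.gt S.P) : y' = y := by
  by_contra hne
  have hne : y' - y ≠ 0 := sub_ne_zero.2 hne
  have := lt_w h hne
  rw [hy.w_sub hy' hne] at this
  exact lt_irrefl _ this

lemma pow_q_sub_mem (hy : S.IsRt y) (hy' : S.IsRt y') :
    y' ^ p ^ n - y ^ p ^ n - (y' - y) ^ p ^ n ∈ S.v.ge (S.v.w p + (S.P * S.Q - S.κ + S.τ)) := by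
  obtain ⟨hP, hPQ, hPQ1, hPQ2, hκ0, hκ1, hτ0, hτκ, hκQ, hτQ, hτQQ⟩ := S.facts
  have := S.add_pow_q_sub_mem (by linarith) hy.mem (hy.sub_mem hy')
  rw [add_sub_cancel] at this
  exact ge_mono this (by nlinarith)

lemma f_sub_mem (hy : S.IsRt y) (hy' : S.IsRt y') : S.f y' - S.f y ∈ S.v.ge (S.P * S.Q) := by
  obtain ⟨hP, hPQ, hPQ1, hPQ2, hκ0, hκ1, hτ0, hτκ, hκQ, hτQ, hτQQ⟩ := S.facts
  have hw := S.w_p'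
  have h1 := hy.pow_q_sub_mem hy'
  have hd := hy.sub_mem hy'
  rw [f_sub]
  refine (S.v.ge _).add_mem (mul_mem_of_ge_zero (mem_ge_of_eq hy'.c_add_unit.2) ?_)
    (ge_mono (mul_mem (S.pow_q_mem hy.mem) hd) (by nlinarith))
  have := (S.v.ge (S.P * S.Q)).add_mem (ge_mono h1 (by linarith))
    (ge_mono (S.pow_q_mem hd) (by linarith))
  rwa [sub_add_cancel] at this

/-- The normalized difference of two roots satisfies `t ^ (q ^ 2) + t = 0` to high order. -/
lemma pow_add_mem (hy : S.IsRt y) (hy' : S.IsRt y') :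
    ((y' - y) / S.mu ^ p) ^ (p ^ n * p ^ n) + (y' - y) / S.mu ^ p ∈ S.v.gt S.κ := by
  obtain ⟨hP, hPQ, hPQ1, hPQ2, hκ0, hκ1, hτ0, hτκ, hκQ, hτQ, hτQQ⟩ := S.facts
  have hw := S.w_p'
  have hd := hy.sub_mem hy'
  have hf := hy.f_sub_mem hy'
  have hF := pow_sub_pow_mem (mem_ge_of_eq hy'.f_unit.2) (mem_ge_of_eq hy.f_unit.2) hf (p ^ n - 1)
  have hF1 := pow_sub_one_mem (by nlinarith) hy'.f_sub_one (p ^ n - 1)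
  have h3 := S.add_pow_qq_sub_mem (by linarith) hy.mem hd
  rw [add_sub_cancel] at h3
  have e1 : y ^ (p ^ n * p ^ n) = S.a * (S.cc + y) * S.f y ^ (p ^ n - 1) := hy
  have e2 : y' ^ (p ^ n * p ^ n) = S.a * (S.cc + y') * S.f y' ^ (p ^ n - 1) := hy'
  set d := y' - y with hdd
  have h4 : d ^ (p ^ n * p ^ n) - S.a * d ∈ S.v.gt (S.P * S.Q * S.Q + S.κ) := by
    have e3 : d ^ (p ^ n * p ^ n) - S.a * d =
        S.a * d * (S.f y' ^ (p ^ n - 1) - 1) +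
        S.a * (S.cc + y) * (S.f y' ^ (p ^ n - 1) - S.f y ^ (p ^ n - 1)) -
        (y' ^ (p ^ n * p ^ n) - y ^ (p ^ n * p ^ n) - d ^ (p ^ n * p ^ n)) := by
      rw [e1, e2, hdd]
      ring
    rw [e3]
    have hQQ : S.Q * S.Q * (S.P - S.τ) = S.P * S.Q * S.Q - S.P := by
      rw [← hτQQ]
      ring
    refine (S.v.gt _).sub_mem ((S.v.gt _).add_mem
      (gt_of_ge (mul_mem (mul_mem (mem_ge_of_eq S.w_a) hd) hF1) ?_)
      (gt_of_ge (mul_mem (mul_mem (mem_ge_of_eq S.w_a) (mem_ge_of_eq hy.c_add_unit.2)) hF) ?_))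
      (gt_of_ge h3 ?_)
    · linarith
    · linarith
    · rw [hQQ, hw]
      linarith
  have hl := pow_ne_zero ((p - 1) * S.expo) S.lam_ne
  have hm := pow_ne_zero p S.mu_ne
  have h5 := div_mem_gt h4 (mul_ne_zero hl hm)
  have hB : S.v.w (S.lam ^ ((p - 1) * S.expo) * S.mu ^ p) = S.P * S.Q * S.Q := by
    rw [← S.mu_pow_pow, w_pow _ hm, S.w_mu_pow_p, S.cast_qq]
    ring
  rw [hB, add_sub_cancel_left] at h5
  have h6 := div_mem hd hm
  rw [S.w_mu_pow_p, sub_self] at h6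
  have h7 := mul_mem_gt h6 S.a_div
  rw [zero_add] at h7
  have h8 := (S.v.gt _).add_mem h5 h7
  convert h8 using 1
  rw [div_pow, S.mu_pow_pow]
  field_simp
  ring

end IsRt

variable (S) in
/-- The normalized difference between `σ y` and `y`. -/
def t (y : Ω) (σ : Ω ≃ₐ[K] Ω) : Ω := (σ y - y) / S.mu ^ p

lemma t_mul (y : Ω) (σ : Ω ≃ₐ[K] Ω) : S.t y σ * S.mu ^ p = σ y - y :=
  div_mul_cancel₀ _ (pow_ne_zero p S.mu_ne)

lemma t_eq_zero {y : Ω} {σ : Ω ≃ₐ[K] Ω} : S.t y σ = 0 ↔ σ y = y := by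
  rw [t, div_eq_zero_iff, or_iff_left (pow_ne_zero p S.mu_ne), sub_eq_zero]

lemma t_mul_apply (y : Ω) (σ ρ : Ω ≃ₐ[K] Ω) : S.t y (σ * ρ) = σ (S.t y ρ) + S.t y σ := by
  rw [t, t, t, AlgEquiv.mul_apply, map_div₀, map_pow, S.map_mu, map_sub]
  ring

namespace IsRt

variable {y y' : Ω}

lemma t_mem (hy : S.IsRt y) (σ : Ω ≃ₐ[K] Ω) : S.t y σ ∈ S.v.ge 0 := by
  have := div_mem (hy.sub_mem (hy.map σ)) (pow_ne_zero p S.mu_ne)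
  rwa [S.w_mu_pow_p, sub_self] at this

lemma w_t (hy : S.IsRt y) {σ : Ω ≃ₐ[K] Ω} (h : σ y ≠ y) : S.v.w (S.t y σ) = 0 := by
  have h := sub_ne_zero.2 h
  rw [t, w_div _ h (pow_ne_zero p S.mu_ne), hy.w_sub (hy.map σ) h, S.w_mu_pow_p, sub_self]

/-- Automorphisms act on the normalized differences trivially to high order. -/
lemma map_t_sub_mem (hy : S.IsRt y) (σ ρ : Ω ≃ₐ[K] Ω) :
    σ (S.t y ρ) - S.t y ρ ∈ S.v.gt S.κ := by
  obtain ⟨hP, hPQ, hPQ1, hPQ2, hκ0, hκ1, hτ0, hτκ, hκQ, hτQ, hτQQ⟩ := S.facts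
  have hw := S.w_p'
  have h0 := S.inertia σ _ (hy.t_mem ρ)
  have h1 : S.t y ρ ^ (p ^ n * p ^ n) + S.t y ρ ∈ S.v.gt S.κ := hy.pow_add_mem (hy.map ρ)
  have h2 : σ (S.t y ρ) ^ (p ^ n * p ^ n) + σ (S.t y ρ) ∈ S.v.gt S.κ := by
    rw [← map_pow, ← _root_.map_add]
    rcases mem_gt.1 h1 with h | h
    · rw [h, map_zero]
      exact (S.v.gt _).zero_mem
    · exact Or.inr (by rwa [S.w_map])
  have hx := hy.t_mem ρ
  set x := S.t y ρ
  obtain ⟨u, hu⟩ : ∃ u, σ x = x + u := ⟨σ x - x, by ring⟩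
  rw [hu, add_sub_cancel_left] at h0 ⊢
  rw [hu] at h2
  have h3 := S.add_pow_qq_sub_mem le_rfl hx (ge_of_gt h0 le_rfl)
  have h4 : u ^ (p ^ n * p ^ n) + u ∈ S.v.gt S.κ := by
    have := (S.v.gt _).sub_mem ((S.v.gt _).sub_mem h2 h1) (gt_of_ge (s := S.κ) h3 (by
      rw [hw]
      linarith))
    convert this using 1
    ring
  by_cases hu0 : u = 0
  · exact Or.inl hu0
  have h5 : u ^ (p ^ n * p ^ n) ∈ S.v.gt (S.v.w u) := by
    refine Or.inr ?_
    rw [w_pow _ hu0, S.cast_qq]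
    have := lt_w h0 hu0
    nlinarith
  have h6 := w_add_of_gt hu0 h5
  rw [add_comm] at h6
  refine Or.inr ?_
  rw [← h6.2]
  exact lt_w h4 h6.1

/-- Krasner's lemma for the roots of the monodromy polynomial. -/
lemma map_eq (hy : S.IsRt y) (hy' : S.IsRt y') {σ : Ω ≃ₐ[K] Ω} (h : σ y = y) : σ y' = y' := by
  apply hy'.eq_of_sub_mem (hy'.map σ)
  have h1 := div_mem (hy.sub_mem hy') (pow_ne_zero p S.mu_ne)
  rw [S.w_mu_pow_p, sub_self] at h1
  have h2 := mul_mem_gt (mem_ge_of_eq S.w_mu_pow_p) (S.inertia σ _ h1)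
  rw [add_zero] at h2
  convert h2 using 1
  rw [map_div₀, map_pow, map_sub, h, S.map_mu]
  have := pow_ne_zero p S.mu_ne
  field_simp
  ring

/-- Automorphisms commute on a root. -/
lemma map_comm (hy : S.IsRt y) (σ ρ : Ω ≃ₐ[K] Ω) : σ (ρ y) = ρ (σ y) := by
  apply (hy.map σ |>.map ρ).eq_of_sub_mem (hy.map ρ |>.map σ)
  have h1 := (S.v.gt _).sub_mem (hy.map_t_sub_mem σ ρ) (hy.map_t_sub_mem ρ σ)
  have h2 := mul_mem_gt (mem_ge_of_eq S.w_mu_pow_p) h1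
  have h3 : σ (ρ y) - ρ (σ y) = (S.t y (σ * ρ) - S.t y (ρ * σ)) * S.mu ^ p := by
    rw [sub_mul, t_mul, t_mul, AlgEquiv.mul_apply, AlgEquiv.mul_apply]
    ring
  rw [h3, t_mul_apply, t_mul_apply, mul_comm]
  refine gt_mono ?_ (by linarith [S.facts.2.2.2.2.1] : S.P ≤ S.P + S.κ)
  convert h2 using 2
  ring

end IsRt

end MonodromySetting

namespace MonodromySetting

open RatVal

variable {K Ω : Type} [Field K] [Field Ω] [Algebra K Ω] {p n : ℕ}
variable {S : MonodromySetting K Ω p n}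

/-- The iterates of `x ↦ x ^ p / (-p)` at `A / (-p)`. -/
def gseq (S : MonodromySetting K Ω p n) (A : Ω) : ℕ → Ω
  | 0 => A / -(p : Ω)
  | j + 1 => gseq S A j ^ p / -(p : Ω)

/-- An approximate solution `G` of `(1 + G) ^ p = 1 + A + A ^ q / a_n`. -/
def approx (S : MonodromySetting K Ω p n) (A : Ω) : Ω :=
  (-1) ^ p ^ n * ∑ j ∈ Finset.range n, S.gseq A j

lemma map_gseq (σ : Ω ≃ₐ[K] Ω) (A : Ω) (j : ℕ) : σ (S.gseq A j) = S.gseq (σ A) j := by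
  induction j with
  | zero => simp [gseq]
  | succ j ih => simp [gseq, ih]

lemma map_approx (σ : Ω ≃ₐ[K] Ω) (A : Ω) : σ (S.approx A) = S.approx (σ A) := by
  simp [approx, map_gseq]

lemma neg_p_ne (S : MonodromySetting K Ω p n) : -(p : Ω) ≠ 0 := neg_ne_zero.2 S.p_ne

lemma w_neg_p (S : MonodromySetting K Ω p n) :
    S.v.w (-(p : Ω)) = S.P * S.Q + S.P - S.Q - 1 := by rw [w_neg, S.w_p']

lemma neg_p_mul_gseq (A : Ω) (j : ℕ) :
    -(p : Ω) * S.gseq A j = A ^ p ^ j / (-(p : Ω)) ^ ∑ i ∈ Finset.range j, p ^ (i + 1) := by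
  have hp := S.neg_p_ne
  induction j with
  | zero => simp [gseq, mul_div_cancel₀ _ hp]
  | succ j ih =>
    have h1 : S.gseq A j = A ^ p ^ j / (-(p : Ω)) ^ ((∑ i ∈ Finset.range j, p ^ (i + 1)) + 1) := by
      rw [pow_succ, ← div_div, ← ih, mul_div_cancel_left₀ _ hp]
    rw [gseq, mul_div_cancel₀ _ hp, h1, div_pow, ← pow_mul, ← pow_mul, ← pow_succ]
    congr 2
    rw [Finset.sum_range_succ', add_mul, Finset.sum_mul]
    simp [pow_succ]

lemma gseq_mem {A : Ω} (hA : A ∈ S.v.ge (S.P * S.Q + S.P - S.κ)) (j : ℕ) :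
    S.gseq A j ∈ S.v.ge (S.Q + 1 - S.κ * (p : ℚ) ^ j) := by
  induction j with
  | zero =>
    have := div_mem hA S.neg_p_ne
    rw [S.w_neg_p] at this
    exact ge_mono this (by simp; linarith)
  | succ j ih =>
    have := div_mem (S.pow_p_mem ih) S.neg_p_ne
    rw [S.w_neg_p] at this
    refine ge_mono this (le_of_eq ?_)
    rw [pow_succ]
    unfold P
    ring

lemma gseq_mem_of_lt {A : Ω} (hA : A ∈ S.v.ge (S.P * S.Q + S.P - S.κ)) {j : ℕ} (hj : j < n) :
    S.gseq A j ∈ S.v.ge S.Q := by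
  obtain ⟨hP, hPQ, hPQ1, hPQ2, hκ0, hκ1, hτ0, hτκ, hκQ, hτQ, hτQQ⟩ := S.facts
  refine ge_mono (gseq_mem hA j) ?_
  have h1 : (p : ℚ) ^ (j + 1) ≤ S.Q :=
    pow_le_pow_right₀ (by exact_mod_cast S.hp.one_le) hj
  have h2 : S.κ * (p : ℚ) ^ j * S.Q = (p : ℚ) ^ (j + 1) := by
    rw [mul_right_comm, hκQ, pow_succ, P]
    ring
  have h3 : S.κ * (p : ℚ) ^ j * S.Q ≤ 1 * S.Q := by linarith
  have := le_of_mul_le_mul_right h3 (by linarith)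
  linarith

lemma neg_one_pow_mem (S : MonodromySetting K Ω p n) (k : ℕ) : (-1 : Ω) ^ k ∈ S.v.ge 0 :=
  mem_ge_of_eq (by rw [w_pow _ (by simp), w_neg, w_one, mul_zero])

lemma approx_mem {A : Ω} (hA : A ∈ S.v.ge (S.P * S.Q + S.P - S.κ)) : S.approx A ∈ S.v.ge S.Q :=
  mul_mem_of_ge_zero (S.neg_one_pow_mem _)
    ((S.v.ge _).sum_mem fun _ hj => gseq_mem_of_lt hA (Finset.mem_range.1 hj))

lemma one_add_approx_pow {A : Ω} (hA : A ∈ S.v.ge (S.P * S.Q + S.P - S.κ)) :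
    (1 + S.approx A) ^ p - (1 + A + A ^ p ^ n / S.a) ∈ S.v.ge (S.P * S.Q + S.P) := by
  obtain ⟨hP, hPQ, hPQ1, hPQ2, hκ0, hκ1, hτ0, hτκ, hκQ, hτQ, hτQQ⟩ := S.facts
  have hw := S.w_p'
  obtain ⟨F, hF⟩ := exists_one_add_pow_prime (R := Ω) S.hp
  have hG := approx_mem hA
  have h1 : p * S.approx A ^ 2 * aeval (S.approx A) F ∈ S.v.ge (S.P * S.Q + S.P) := by
    have := mul_mem (mul_mem (mem_ge_self (v := S.v) (p : Ω)) (pow_mem hG 2))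
      (aeval_int_mem (ge_mono hG (by linarith)) F)
    refine ge_mono this ?_
    rw [hw]
    push_cast
    linarith
  have h2 := sum_pow_sub_mem S.hp (S.gseq A) n fun i hi => gseq_mem_of_lt hA hi
  have hε : ((-1 : Ω) ^ p ^ n) ^ p = (-1) ^ p ^ n := by
    rcases S.hp.eq_two_or_odd' with h | h
    · have : Even (p ^ n) := by
        rw [h]
        exact (even_two).pow_of_ne_zero (by have := S.hn; omega)
      rw [this.neg_one_pow, one_pow]
    · rw [(h.pow).neg_one_pow, h.neg_one_pow]
  have hε2 : ((-1 : Ω) ^ p ^ n) * (-1) ^ p ^ n = 1 := by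
    rw [← mul_pow]
    simp
  have h3 : ∑ i ∈ Finset.range n, S.gseq A i ^ p =
      -p * (∑ i ∈ Finset.range n, S.gseq A i + S.gseq A n - S.gseq A 0) := by
    rw [← Finset.sum_range_succ, Finset.sum_range_succ', add_sub_cancel_right, Finset.mul_sum]
    refine Finset.sum_congr rfl fun i _ => ?_
    rw [gseq, mul_div_cancel₀ _ S.neg_p_ne]
  have h4 : A ^ p ^ n / S.a = (-1) ^ p ^ n * (-p * S.gseq A n) := by
    rw [neg_p_mul_gseq, a_eq, expo]
    have := pow_ne_zero (∑ i ∈ Finset.range n, p ^ (i + 1)) S.neg_p_ne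
    rw [div_eq_iff (mul_ne_zero (by simp) this), mul_mul_mul_comm, hε2, one_mul,
      div_mul_cancel₀ _ this]
  have h5 : A = -p * S.gseq A 0 := by
    rw [gseq, mul_div_cancel₀ _ S.neg_p_ne]
  have h6 : (1 + S.approx A) ^ p - (1 + A + A ^ p ^ n / S.a) =
      p * S.approx A ^ 2 * aeval (S.approx A) F +
      (-1) ^ p ^ n * ((∑ i ∈ Finset.range n, S.gseq A i) ^ p -
        ∑ i ∈ Finset.range n, S.gseq A i ^ p) - ((-1) ^ p ^ n + 1) * A := by
    rw [hF, h3, h4]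
    generalize aeval (S.approx A) F = s
    rw [approx, mul_pow, hε]
    linear_combination (-1) ^ p ^ n * h5
  rw [h6]
  refine (S.v.ge _).sub_mem ((S.v.ge _).add_mem h1
    (mul_mem_of_ge_zero (S.neg_one_pow_mem _) (ge_mono h2 ?_)))
    (ge_mono (mul_mem S.neg_one_pow_add_one_mem hA) ?_)
  · rw [hw]
    change _ ≤ _ + S.P * S.Q
    linarith
  · rw [hw]
    linarith

/-- The effect of a small change of the argument on `gseq`. -/
lemma gseq_sub_mem {A A' m : Ω} (hA : A ∈ S.v.ge (S.P * S.Q + S.P - S.κ)) (hm : m ∈ S.v.ge 0)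
    (h : A' - A - S.lam ^ p * m ∈ S.v.gt (S.P * S.Q + S.P)) {j : ℕ} (hj : j < n) :
    S.gseq A' j - S.gseq A j - S.lam * m ^ p ^ j ∈ S.v.gt (S.Q + 1) := by
  obtain ⟨hP, hPQ, hPQ1, hPQ2, hκ0, hκ1, hτ0, hτκ, hκQ, hτQ, hτQQ⟩ := S.facts
  have hw := S.w_p'
  have hm' (j : ℕ) : m ^ j ∈ S.v.ge 0 := by simpa using pow_mem hm j
  induction j with
  | zero =>
    have h1 := div_mem_gt h S.neg_p_ne
    have h2 := gt_of_ge (s := S.Q + 1) (mul_mem_of_ge_zero hm S.lam_pow_div) (by linarith)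
    rw [S.w_neg_p] at h1
    have h3 := (S.v.gt _).add_mem (gt_mono (s := S.Q + 1) h1 (by linarith)) h2
    convert h3 using 1
    simp only [gseq, pow_zero, pow_one]
    field_simp [S.neg_p_ne]
    ring
  | succ j ih =>
    specialize ih (by omega)
    have hg := gseq_mem_of_lt hA (show j < n by omega)
    have hl : S.lam * m ^ p ^ j ∈ S.v.ge (S.Q + 1) := by
      simpa using mul_mem (mem_ge_of_eq S.w_lam) (hm' (p ^ j))
    obtain ⟨e, he⟩ : ∃ e, S.gseq A' j = S.gseq A j + (S.lam * m ^ p ^ j + e) :=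
      ⟨S.gseq A' j - S.gseq A j - S.lam * m ^ p ^ j, by ring⟩
    have he' : e ∈ S.v.gt (S.Q + 1) := by
      convert ih using 1
      rw [he]
      ring
    have hx := (S.v.ge _).add_mem hl (ge_of_gt he' le_rfl)
    have h1 := add_pow_sub_mem (k := 1) S.hp (by linarith) hg hx
    have h2 := add_pow_sub_mem (k := 1) S.hp le_rfl hl (ge_of_gt he' le_rfl)
    rw [← he] at h1
    rw [pow_one, hw] at h1 h2
    rw [pow_one] at h1 h2
    change _ ∈ S.v.ge (_ + (S.P * _ + _)) at h1
    change _ ∈ S.v.ge (_ + (S.P * _ + _)) at h2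
    have h3 : e ^ p ∈ S.v.gt (S.P * (S.Q + 1)) := pow_mem_gt he' S.hp.ne_zero
    have h4 := (S.v.gt (S.P * (S.Q + 1))).add_mem ((S.v.gt _).add_mem
      (gt_of_ge h1 (by nlinarith)) (gt_of_ge h2 (by nlinarith))) h3
    have h5 := div_mem_gt h4 S.neg_p_ne
    rw [S.w_neg_p] at h5
    have h6 := gt_of_ge (s := S.Q + 1) (mul_mem_of_ge_zero (hm' (p ^ (j + 1))) S.lam_pow_div)
      (by linarith)
    have h7 := (S.v.gt _).add_mem (gt_mono (s := S.Q + 1) h5 (by linarith)) h6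
    convert h7 using 1
    have hp := S.neg_p_ne
    have h8 : (S.lam * m ^ p ^ j) ^ p = S.lam ^ p * m ^ p ^ (j + 1) := by
      rw [mul_pow, ← pow_mul, ← pow_succ]
    rw [gseq, gseq, h8]
    field_simp
    ring

/-- If `r ^ p - 1` is divisible by `λ ^ p`, then `r - 1` is divisible by `λ`. -/
lemma sub_one_mem_of_pow {r : Ω} (h : r ^ p - 1 ∈ S.v.ge (S.P * S.Q + S.P)) :
    r - 1 ∈ S.v.ge (S.Q + 1) := by
  obtain ⟨hP, hPQ, hPQ1, hPQ2, hκ0, hκ1, hτ0, hτκ, hκQ, hτQ, hτQQ⟩ := S.facts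
  have hw := S.w_p'
  obtain ⟨F, hF⟩ := exists_one_add_pow_prime (R := Ω) S.hp
  have hr : r ^ p ≠ 0 ∧ S.v.w (r ^ p) = 0 := by
    rw [← w_one S.v]
    refine w_eq_of_sub one_ne_zero (gt_of_ge h ?_)
    rw [w_one]
    linarith
  have hr0 : r ≠ 0 := fun h0 => hr.1 (by rw [h0, zero_pow S.hp.ne_zero])
  have hr1 : S.v.w r = 0 := w_eq_of_pow S.hp.ne_zero hr0 (by rw [hr.2, mul_zero])
  have hx : r - 1 ∈ S.v.ge 0 := (S.v.ge 0).sub_mem (mem_ge_of_eq hr1) one_mem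
  obtain ⟨x, rfl⟩ : ∃ x, r = 1 + x := ⟨r - 1, by ring⟩
  rw [add_sub_cancel_left] at *
  by_contra hcon
  obtain ⟨hx0, hlt⟩ : x ≠ 0 ∧ S.v.w x < S.Q + 1 := by simpa [mem_ge] using hcon
  have hρ := le_w hx hx0
  have hwp : S.v.w (x ^ p) = S.P * S.v.w x := w_pow _ hx0 p
  have h1 : p * x * (1 + x * aeval x F) ∈ S.v.gt (S.v.w (x ^ p)) := by
    have h2 := mul_mem (mul_mem (mem_ge_self (v := S.v) (p : Ω)) (mem_ge_self x))
      ((S.v.ge 0).add_mem one_mem (mul_mem_of_ge_zero hx (aeval_int_mem hx F)))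
    refine gt_of_ge h2 ?_
    rw [hw, hwp]
    nlinarith
  have h2 := w_add_of_gt (pow_ne_zero p hx0) h1
  have h3 : x ^ p + p * x * (1 + x * aeval x F) = (1 + x) ^ p - 1 := by
    rw [hF]
    ring
  rw [h3] at h2
  have h4 := le_w h h2.1
  rw [h2.2, hwp] at h4
  nlinarith

variable (S) in
/-- The linear part of the change of `f` under an automorphism. -/
def A (y : Ω) (σ : Ω ≃ₐ[K] Ω) : Ω := y ^ p ^ n * (σ y - y) / S.f y

/-- The sum governing the commutators. -/
def pairing (_ : MonodromySetting K Ω p n) (s t : Ω) : Ω :=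
  ∑ j ∈ Finset.range n, (s ^ p ^ n * t) ^ p ^ j

namespace IsRt

variable {y : Ω}

lemma A_mem (hy : S.IsRt y) (σ : Ω ≃ₐ[K] Ω) :
    S.A y σ ∈ S.v.ge (S.P * S.Q + S.P - S.κ) := by
  obtain ⟨hP, hPQ, hPQ1, hPQ2, hκ0, hκ1, hτ0, hτκ, hκQ, hτQ, hτQQ⟩ := S.facts
  have := div_mem (mul_mem (S.pow_q_mem hy.mem) (hy.sub_mem (hy.map σ))) hy.f_unit.1
  exact ge_mono this (by rw [hy.f_unit.2]; linarith)

lemma f_div (hy : S.IsRt y) (σ : Ω ≃ₐ[K] Ω) :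
    S.f (σ y) / S.f y - (1 + S.A y σ + S.A y σ ^ p ^ n / S.a) ∈ S.v.ge (S.P * S.Q + S.P) := by
  obtain ⟨hP, hPQ, hPQ1, hPQ2, hκ0, hκ1, hτ0, hτκ, hκQ, hτQ, hτQQ⟩ := S.facts
  have hw := S.w_p'
  have h0 := hy.f_unit.1
  have hd := hy.sub_mem (hy.map σ)
  have h1 : S.A y σ ^ p ^ n / S.a = (S.cc + y) * (σ y - y) ^ p ^ n / S.f y := by
    have e1 : y ^ (p ^ n * p ^ n) = S.a * (S.cc + y) * S.f y ^ (p ^ n - 1) := hy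
    have e2 : S.f y ^ p ^ n = S.f y ^ (p ^ n - 1) * S.f y := by
      rw [← pow_succ, Nat.sub_add_cancel (Nat.one_le_pow _ _ S.hp.pos)]
    have := S.a_ne
    have := pow_ne_zero (p ^ n - 1) h0
    rw [A, div_pow, mul_pow, ← pow_mul, e1, e2]
    field_simp
  have h2 := S.f_sub (σ y) y
  have h3 : S.f (σ y) / S.f y - (1 + S.A y σ + S.A y σ ^ p ^ n / S.a) =
      ((S.cc + σ y) * ((σ y) ^ p ^ n - y ^ p ^ n - (σ y - y) ^ p ^ n) +
        (σ y - y) * (σ y - y) ^ p ^ n) / S.f y := by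
    rw [h1, A]
    field_simp
    linear_combination h2
  rw [h3]
  have h4 := div_mem ((S.v.ge (S.P * S.Q + S.P)).add_mem
    (mul_mem_of_ge_zero (mem_ge_of_eq (hy.map σ).c_add_unit.2)
      (ge_mono (hy.pow_q_sub_mem (hy.map σ)) (by linarith)))
    (ge_mono (mul_mem hd (S.pow_q_mem hd)) (by linarith))) h0
  rwa [hy.f_unit.2, sub_zero] at h4

lemma map_A_sub_mem (hy : S.IsRt y) (σ ρ : Ω ≃ₐ[K] Ω) :
    σ (S.A y ρ) - S.A y ρ - S.lam ^ p * (S.t y σ ^ p ^ n * S.t y ρ) ∈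
      S.v.gt (S.P * S.Q + S.P) := by
  obtain ⟨hP, hPQ, hPQ1, hPQ2, hκ0, hκ1, hτ0, hτκ, hκQ, hτQ, hτQQ⟩ := S.facts
  have hw := S.w_p'
  have h0 := hy.f_unit.1
  have h0' := (hy.map σ).f_unit.1
  have hρ := hy.sub_mem (hy.map ρ)
  have hσ := hy.sub_mem (hy.map σ)
  have hu := hy.map_t_sub_mem σ ρ
  set u := σ (S.t y ρ) - S.t y ρ with hu'
  have e1 : σ (ρ y - y) = ρ y - y + S.mu ^ p * u := by
    rw [hu', ← t_mul y ρ, _root_.map_mul, map_pow, S.map_mu]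
    ring
  have e2 : S.lam ^ p * (S.t y σ ^ p ^ n * S.t y ρ) = (σ y - y) ^ p ^ n * (ρ y - y) := by
    rw [← t_mul y ρ, ← t_mul y σ, ← S.mu_pow]
    ring
  have hmu := mul_mem_gt (mem_ge_of_eq S.w_mu_pow_p) hu
  have hq := hy.pow_q_sub_mem (hy.map σ)
  have h1 : (σ y) ^ p ^ n * (ρ y - y + S.mu ^ p * u) - y ^ p ^ n * (ρ y - y) -
      (σ y - y) ^ p ^ n * (ρ y - y) ∈ S.v.gt (S.P * S.Q + S.P) := by
    have e3 : (σ y) ^ p ^ n * (ρ y - y + S.mu ^ p * u) - y ^ p ^ n * (ρ y - y) -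
      (σ y - y) ^ p ^ n * (ρ y - y) =
      ((σ y) ^ p ^ n - y ^ p ^ n - (σ y - y) ^ p ^ n) * (ρ y - y) +
      (σ y) ^ p ^ n * (S.mu ^ p * u) := by ring
    rw [e3]
    refine (S.v.gt _).add_mem (gt_of_ge (mul_mem hq hρ) (by linarith))
      (gt_mono (mul_mem_gt (S.pow_q_mem (hy.map σ).mem) hmu) (by linarith))
  have hσρ := mul_mem (S.pow_q_mem hσ) hρ
  have h2 := (S.v.ge (S.P * S.Q + S.P)).add_mem (ge_of_gt h1 le_rfl) (ge_mono hσρ (by linarith))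
  rw [sub_add_cancel] at h2
  have h3 : 1 / S.f (σ y) - 1 ∈ S.v.ge (S.P * S.Q - S.κ) := by
    have := div_mem ((S.v.ge _).neg_mem (hy.map σ).f_sub_one) h0'
    rw [(hy.map σ).f_unit.2, sub_zero] at this
    convert this using 1
    field_simp
    ring
  have h4 : (S.f y - S.f (σ y)) / (S.f y * S.f (σ y)) ∈ S.v.ge (S.P * S.Q) := by
    have h := div_mem ((S.v.ge _).neg_mem (hy.f_sub_mem (hy.map σ))) (mul_ne_zero h0 h0')
    rw [S.v.map_mul _ _ h0 h0', hy.f_unit.2, (hy.map σ).f_unit.2] at h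
    convert h using 1
    · simp
    · rw [neg_sub]
  have h5 := mul_mem (mul_mem (S.pow_q_mem hy.mem) hρ) h4
  have h6 := mul_mem h2 h3
  have h7 := (S.v.gt _).add_mem ((S.v.gt _).add_mem h1
    (gt_of_ge (s := S.P * S.Q + S.P) h6 (by linarith)))
    (gt_of_ge (s := S.P * S.Q + S.P) h5 (by linarith))
  convert h7 using 1
  rw [e2, A, map_div₀, _root_.map_mul, map_pow, S.map_f, e1]
  field_simp
  ring

lemma map_approx_sub_mem (hy : S.IsRt y) (σ ρ : Ω ≃ₐ[K] Ω) :
    σ (S.approx (S.A y ρ)) - S.approx (S.A y ρ) -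
      (-1) ^ p ^ n * (S.lam * S.pairing (S.t y σ) (S.t y ρ)) ∈ S.v.gt (S.Q + 1) := by
  have hm : S.t y σ ^ p ^ n * S.t y ρ ∈ S.v.ge 0 := by
    simpa using mul_mem (S.pow_q_mem (hy.t_mem σ)) (hy.t_mem ρ)
  have h : ∑ j ∈ Finset.range n, (S.gseq (σ (S.A y ρ)) j - S.gseq (S.A y ρ) j -
      S.lam * (S.t y σ ^ p ^ n * S.t y ρ) ^ p ^ j) ∈ S.v.gt (S.Q + 1) :=
    (S.v.gt _).sum_mem fun j hj =>
      gseq_sub_mem (hy.A_mem ρ) hm (hy.map_A_sub_mem σ ρ) (Finset.mem_range.1 hj)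
  have h1 := mul_mem_gt (S.neg_one_pow_mem (p ^ n)) h
  rw [zero_add] at h1
  convert h1 using 1
  rw [map_approx, Finset.sum_sub_distrib, Finset.sum_sub_distrib, ← Finset.mul_sum]
  unfold approx pairing
  ring

end IsRt

end MonodromySetting

namespace MonodromySetting

open RatVal

variable {K Ω : Type} [Field K] [Field Ω] [Algebra K Ω] {p n : ℕ}
variable {S : MonodromySetting K Ω p n}

lemma w_one_add_approx {A : Ω} (hA : A ∈ S.v.ge (S.P * S.Q + S.P - S.κ)) :
    1 + S.approx A ≠ 0 ∧ S.v.w (1 + S.approx A) = 0 := by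
  obtain ⟨hP, hPQ, -⟩ := S.facts
  have := w_add_of_gt (v := S.v) (y := S.approx A) one_ne_zero (by
    rw [w_one]
    exact gt_of_ge (approx_mem hA) (by linarith))
  rwa [w_one] at this

/-- The commutator pairing as a polynomial in its second argument. -/
def pairingPoly (_ : MonodromySetting K Ω p n) (s : Ω) : Polynomial Ω :=
  ∑ j ∈ Finset.range n, (C (s ^ p ^ n) * X) ^ p ^ j -
    ∑ j ∈ Finset.range n, (X ^ p ^ n * C s) ^ p ^ j

lemma eval_pairingPoly (s t : Ω) :
    (S.pairingPoly s).eval t = S.pairing s t - S.pairing t s := by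
  simp [pairingPoly, pairing, eval_finsetSum, mul_comm s]

lemma pairingPoly_facts (S : MonodromySetting K Ω p n) {s : Ω}
    (hs : s ≠ 0) :
    S.pairingPoly s ≠ 0 ∧ (S.pairingPoly s).natDegree < p ^ n * p ^ n ∧
      (S.pairingPoly s).leadingCoeff = -s ^ p ^ (n - 1) := by
  obtain ⟨m, rfl⟩ : ∃ m, n = m + 1 := ⟨n - 1, by have := S.hn; omega⟩
  have hp := S.hp.one_lt
  have hq : 1 < p ^ (m + 1) := Nat.one_lt_pow (by omega) hp
  have hlt (j : ℕ) (hj : j < m) : p ^ j < p ^ m := Nat.pow_lt_pow_right hp hj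
  set d := p ^ (m + 1) * p ^ m with hd
  have hpm : 0 < p ^ m := pow_pos S.hp.pos _
  have hterm : (C (-s ^ p ^ m) * X ^ d : Polynomial Ω).degree = d :=
    degree_C_mul_X_pow _ (neg_ne_zero.2 (pow_ne_zero _ hs))
  set R : Polynomial Ω := ∑ j ∈ Finset.range (m + 1), (C (s ^ p ^ (m + 1)) * X) ^ p ^ j -
    ∑ j ∈ Finset.range m, (X ^ p ^ (m + 1) * C s) ^ p ^ j with hR
  have hRdeg : R.degree < (C (-s ^ p ^ m) * X ^ d : Polynomial Ω).degree := by
    rw [hterm, ← mem_degreeLT]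
    refine Submodule.sub_mem _ (Submodule.sum_mem _ fun j hj => ?_)
      (Submodule.sum_mem _ fun j hj => ?_)
    · rw [mem_degreeLT, mul_pow, ← C_pow]
      refine (degree_C_mul_X_pow_le _ _).trans_lt ?_
      have hj := Finset.mem_range.1 hj
      have : p ^ j ≤ p ^ m := Nat.pow_le_pow_right (by omega) (by omega)
      exact_mod_cast (show p ^ j < d by nlinarith)
    · rw [mem_degreeLT, mul_pow, ← C_pow, mul_comm, ← pow_mul]
      refine (degree_C_mul_X_pow_le _ _).trans_lt ?_
      have hj := hlt j (Finset.mem_range.1 hj)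
      exact_mod_cast (show p ^ (m + 1) * p ^ j < d by nlinarith)
  have heq : S.pairingPoly s = R + C (-s ^ p ^ m) * X ^ d := by
    rw [pairingPoly, hR, Finset.sum_range_succ (fun j => (X ^ p ^ (m + 1) * C s) ^ p ^ j) m, hd,
      mul_pow _ (C s) (p ^ m), ← C_pow, ← pow_mul, C_neg]
    ring
  have hdeg := degree_add_eq_right_of_degree_lt hRdeg
  rw [← heq, hterm] at hdeg
  refine ⟨?_, ?_, ?_⟩
  · intro h
    rw [h, degree_zero] at hdeg
    exact WithBot.bot_ne_coe hdeg
  · rw [natDegree_eq_of_degree_eq_some hdeg, hd]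
    have : p ^ m < p ^ (m + 1) := Nat.pow_lt_pow_right hp (by omega)
    exact Nat.mul_lt_mul_of_pos_left this (by omega)
  · rw [heq, leadingCoeff_add_of_degree_lt hRdeg, leadingCoeff_C_mul_X_pow]
    rfl

namespace IsRt

variable {y z : Ω}

lemma ne_zero_of_pow (hy : S.IsRt y) (hz : z ^ p = S.f y) : z ≠ 0 := by
  rintro rfl
  rw [zero_pow S.hp.ne_zero] at hz
  exact hy.f_unit.1 hz.symm

lemma div_sub_approx_mem (hy : S.IsRt y) (hz : z ^ p = S.f y) (σ : Ω ≃ₐ[K] Ω) :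
    σ z / z - 1 - S.approx (S.A y σ) ∈ S.v.ge (S.Q + 1) := by
  obtain ⟨h0, h1⟩ := w_one_add_approx (hy.A_mem σ)
  have h2 := (S.v.ge _).sub_mem (hy.f_div σ) (one_add_approx_pow (hy.A_mem σ))
  have h3 := div_mem h2 (pow_ne_zero p h0)
  rw [w_pow _ h0, h1, mul_zero, sub_zero] at h3
  have h4 := sub_one_mem_of_pow (S := S) (r := σ z / z / (1 + S.approx (S.A y σ))) (by
    convert h3 using 1
    rw [div_pow, div_pow, ← map_pow, hz, S.map_f]
    have := pow_ne_zero p h0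
    generalize (1 + S.approx (S.A y σ)) ^ p = x at *
    field_simp
    ring)
  have h5 := mul_mem_of_ge_zero (mem_ge_of_eq h1) h4
  convert h5 using 1
  field_simp
  ring

lemma div_sub_one_mem (hy : S.IsRt y) (hz : z ^ p = S.f y) (σ : Ω ≃ₐ[K] Ω) :
    σ z / z - 1 ∈ S.v.ge S.Q := by
  have := (S.v.ge S.Q).add_mem (ge_mono (hy.div_sub_approx_mem hz σ) (by linarith))
    (approx_mem (hy.A_mem σ))
  rwa [sub_add_cancel] at this

lemma map_div_sub_mem (hy : S.IsRt y) (hz : z ^ p = S.f y) (σ ρ : Ω ≃ₐ[K] Ω) :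
    σ (ρ z / z) - ρ z / z - (-1) ^ p ^ n * (S.lam * S.pairing (S.t y σ) (S.t y ρ)) ∈
      S.v.gt (S.Q + 1) := by
  have h1 := div_mem (hy.div_sub_approx_mem hz ρ) S.lam_ne
  rw [S.w_lam, sub_self] at h1
  have h2 := mul_mem_gt (mem_ge_of_eq S.w_lam) (S.inertia σ _ h1)
  rw [add_zero] at h2
  have h3 := (S.v.gt _).add_mem h2 (hy.map_approx_sub_mem σ ρ)
  convert h3 using 1
  rw [map_div₀ σ (_ - _) _, S.map_lam, map_sub, map_sub, map_one]
  have := S.lam_ne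
  field_simp
  ring

lemma pairing_mem (hy : S.IsRt y) (σ ρ : Ω ≃ₐ[K] Ω) :
    S.pairing (S.t y σ) (S.t y ρ) ∈ S.v.ge 0 := by
  refine (S.v.ge 0).sum_mem fun j _ => ?_
  have h := mul_mem (S.pow_q_mem (hy.t_mem σ)) (hy.t_mem ρ)
  simpa using pow_mem h (p ^ j)

lemma pairing_sub_mem (hy : S.IsRt y) (hz : z ^ p = S.f y) {σ ρ : Ω ≃ₐ[K] Ω}
    (hc : σ (ρ z) = ρ (σ z)) :
    S.pairing (S.t y σ) (S.t y ρ) - S.pairing (S.t y ρ) (S.t y σ) ∈ S.v.gt 0 := by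
  obtain ⟨hP, hPQ, -⟩ := S.facts
  have hz0 := hy.ne_zero_of_pow hz
  have h1 := hy.map_div_sub_mem hz σ ρ
  have h2 := hy.map_div_sub_mem hz ρ σ
  have aux (σ ρ : Ω ≃ₐ[K] Ω) : σ (ρ z / z) - ρ z / z ∈ S.v.ge (S.Q + 1) := by
    have h3 : (-1) ^ p ^ n * (S.lam * S.pairing (S.t y σ) (S.t y ρ)) ∈ S.v.ge (S.Q + 1) := by
      refine mul_mem_of_ge_zero (S.neg_one_pow_mem _) ?_
      simpa using mul_mem (mem_ge_of_eq S.w_lam) (hy.pairing_mem σ ρ)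
    have := (S.v.ge _).add_mem (ge_of_gt (hy.map_div_sub_mem hz σ ρ) le_rfl) h3
    rwa [sub_add_cancel] at this
  have h3 := mul_mem (aux σ ρ) (hy.div_sub_one_mem hz σ)
  have h4 := mul_mem (aux ρ σ) (hy.div_sub_one_mem hz ρ)
  have h5 : σ (ρ z / z) * (σ z / z) = ρ (σ z / z) * (ρ z / z) := by
    have hσ : σ z ≠ 0 := (_root_.map_ne_zero σ).2 hz0
    have hρ : ρ z ≠ 0 := (_root_.map_ne_zero ρ).2 hz0
    rw [map_div₀, map_div₀, hc]
    field_simp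
  have h6 := (S.v.gt (S.Q + 1)).sub_mem ((S.v.gt _).add_mem h2
    (gt_of_ge h4 (by linarith))) ((S.v.gt _).add_mem h1 (gt_of_ge h3 (by linarith)))
  have h7 : (-1) ^ p ^ n * S.lam * (S.pairing (S.t y σ) (S.t y ρ) - S.pairing (S.t y ρ) (S.t y σ)) ∈
      S.v.gt (S.Q + 1) := by
    convert h6 using 1
    linear_combination h5
  have hε : (-1 : Ω) ^ p ^ n ≠ 0 := by simp
  have h8 := div_mem_gt h7 (mul_ne_zero hε S.lam_ne)
  rw [mul_div_cancel_left₀ _ (mul_ne_zero hε S.lam_ne), S.v.map_mul _ _ hε S.lam_ne, S.w_lam,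
    w_pow _ (by simp), w_neg, w_one] at h8
  simpa using h8

/-- An automorphism commuting on `z` with sufficiently many automorphisms fixes `y`. -/
lemma map_eq_of_comm [IsAlgClosed Ω] (hy : S.IsRt y) (hz : z ^ p = S.f y)
    (T : Finset (Ω ≃ₐ[K] Ω)) (hT : p ^ n * p ^ n ≤ T.card)
    (hinj : ∀ ρ ∈ T, ∀ ρ' ∈ T, ρ y = ρ' y → ρ = ρ') {σ : Ω ≃ₐ[K] Ω}
    (hc : ∀ ρ ∈ T, σ (ρ z) = ρ (σ z)) : σ y = y := by
  classical
  by_contra hne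
  have hs : S.t y σ ≠ 0 := fun h => hne (t_eq_zero.1 h)
  obtain ⟨h0, hdeg, hlead⟩ := S.pairingPoly_facts hs
  have hcongr (ρ ρ' : Ω ≃ₐ[K] Ω) (h : S.t y ρ - S.t y ρ' ∈ S.v.gt 0) : ρ y = ρ' y := by
    refine (hy.map ρ').eq_of_sub_mem (hy.map ρ) ?_
    have := mul_mem_gt (mem_ge_of_eq S.w_mu_pow_p) h
    rw [add_zero, mul_comm, sub_mul, t_mul, t_mul] at this
    simpa using this
  have hTi : Set.InjOn (S.t y) T := fun ρ hρ ρ' hρ' h =>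
    hinj ρ hρ ρ' hρ' (hcongr ρ ρ' (by rw [h, sub_self]; exact (S.v.gt 0).zero_mem))
  have hcard := card_le_natDegree (v := S.v) (S.pairingPoly (S.t y σ))
    (by rw [hlead, w_neg, w_pow _ hs, hy.w_t hne, mul_zero]) h0 (T.image (S.t y))
    (by
      intro x hx
      obtain ⟨ρ, hρ, rfl⟩ := Finset.mem_image.1 hx
      rw [eval_pairingPoly]
      exact hy.pairing_sub_mem hz (hc ρ hρ))
    (by
      intro x hx x' hx' h
      obtain ⟨ρ, hρ, rfl⟩ := Finset.mem_image.1 hx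
      obtain ⟨ρ', hρ', rfl⟩ := Finset.mem_image.1 hx'
      rw [hinj ρ hρ ρ' hρ' (hcongr ρ ρ' h)])
  rw [Finset.card_image_of_injOn hTi] at hcard
  omega

/-- An automorphism fixing `y` multiplies `z` by a root of unity. -/
lemma exists_root_of_map_eq (hy : S.IsRt y) (hz : z ^ p = S.f y) {τ : Ω ≃ₐ[K] Ω}
    (hτ : τ y = y) : ∃ i < p, τ z = S.ζ ^ i * z := by
  have hz0 := hy.ne_zero_of_pow hz
  have h1 : (τ z / z) ^ p = 1 := by
    rw [div_pow, ← map_pow, hz, S.map_f, hτ, div_self hy.f_unit.1]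
  have := NeZero.mk S.hp.ne_zero
  obtain ⟨i, hi, h⟩ := S.hζ.eq_pow_of_pow_eq_one h1
  exact ⟨i, hi, by rw [h, div_mul_cancel₀ _ hz0]⟩

/-- Automorphisms fixing `y` commute with all automorphisms on `z`. -/
lemma comm_of_map_eq (hy : S.IsRt y) (hz : z ^ p = S.f y) {τ : Ω ≃ₐ[K] Ω}
    (hτ : τ y = y) (σ : Ω ≃ₐ[K] Ω) : σ (τ z) = τ (σ z) := by
  have hz0 := hy.ne_zero_of_pow hz
  have hσ0 : σ z ≠ 0 := (_root_.map_ne_zero σ).2 hz0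
  have ht : S.t y τ = 0 := t_eq_zero.2 hτ
  have h1 := hy.map_div_sub_mem hz τ σ
  have hpair : S.pairing (S.t y τ) (S.t y σ) = 0 := by
    refine Finset.sum_eq_zero fun j _ => ?_
    rw [ht, zero_pow (pow_ne_zero _ S.hp.ne_zero), zero_mul,
      zero_pow (pow_ne_zero _ S.hp.ne_zero)]
  rw [hpair, mul_zero, mul_zero, sub_zero] at h1
  have hH0 : σ z / z ≠ 0 := div_ne_zero hσ0 hz0
  have hH : S.v.w (σ z / z) = 0 := by rw [w_div _ hσ0 hz0, S.w_map, sub_self]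
  have h2 := div_mem_gt h1 hH0
  rw [hH, sub_zero, sub_div, div_self hH0] at h2
  have h3 : (τ (σ z / z) / (σ z / z)) ^ p = 1 := by
    have h4 : (σ z / z) ^ p = S.f (σ y) / S.f y := by
      rw [div_pow, ← map_pow, hz, S.map_f]
    rw [div_pow, ← map_pow, h4, map_div₀, S.map_f, S.map_f, ← hy.map_comm, hτ, div_self]
    exact div_ne_zero (hy.map σ).f_unit.1 hy.f_unit.1
  have h5 := S.root_eq_one h3 h2
  have hτ0 : τ z ≠ 0 := (_root_.map_ne_zero τ).2 hz0
  rw [map_div₀, div_eq_one_iff_eq hH0, div_eq_iff hτ0] at h5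
  obtain ⟨i, -, hi⟩ := hy.exists_root_of_map_eq hz hτ
  rw [h5, hi, _root_.map_mul, map_pow, S.map_ζ]
  field_simp

end IsRt

end MonodromySetting

namespace MonodromySetting

open RatVal

variable {K Ω : Type} [Field K] [Field Ω] [Algebra K Ω] {p n : ℕ}
variable {S : MonodromySetting K Ω p n}

lemma aeval_Lpoly (S : MonodromySetting K Ω p n) (y : Ω) :
    aeval y (Lpoly K p n S.c) =
      y ^ (p ^ n * p ^ n) - S.a * (S.cc + y) * S.f y ^ (p ^ n - 1) := by
  simp [Lpoly, fqc, aCoef, a, f, cc]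

lemma isRt_iff {y : Ω} : S.IsRt y ↔ aeval y (Lpoly K p n S.c) = 0 := by
  rw [aeval_Lpoly, sub_eq_zero, IsRt]

lemma Lpoly_ne_zero (S : MonodromySetting K Ω p n) : Lpoly K p n S.c ≠ 0 := by
  intro h
  have h1 : S.IsRt (0 : Ω) := by rw [isRt_iff, h, map_zero]
  exact h1.ne_zero rfl

lemma natDegree_Lpoly_le (S : MonodromySetting K Ω p n) :
    (Lpoly K p n S.c).natDegree ≤ p ^ n * p ^ n := by
  have hq : 1 ≤ p ^ n := Nat.one_le_pow _ _ S.hp.pos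
  have hf : (fqc K p n S.c).natDegree ≤ p ^ n + 1 := by
    unfold fqc
    refine natDegree_add_le_of_degree_le (natDegree_add_le_of_degree_le (by simp) ?_) (by simp)
    exact (natDegree_C_mul_X_pow_le _ _).trans (by omega)
  unfold Lpoly
  refine (natDegree_sub_le _ _).trans (max_le (natDegree_X_pow_le _) ?_)
  refine (natDegree_mul_le_of_le (natDegree_mul_le_of_le (natDegree_C _).le
    (natDegree_add_le_of_degree_le (n := 1) (by simp) (by simp)))
    (natDegree_pow_le_of_le (p ^ n - 1) hf)).trans ?_
  obtain ⟨m, hm⟩ : ∃ m, p ^ n = m + 1 := ⟨p ^ n - 1, by omega⟩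
  rw [hm, Nat.add_sub_cancel]
  exact le_of_eq (by ring)

namespace IsRt

variable {y : Ω}

lemma isIntegral (hy : S.IsRt y) : IsIntegral K y :=
  IsAlgebraic.isIntegral ⟨_, S.Lpoly_ne_zero, isRt_iff.1 hy⟩

lemma natDegree_minpoly_le (hy : S.IsRt y) : (minpoly K y).natDegree ≤ p ^ n * p ^ n :=
  (natDegree_le_of_dvd (minpoly.dvd K y (isRt_iff.1 hy)) S.Lpoly_ne_zero).trans
    S.natDegree_Lpoly_le

/-- The field `K(y)` contains an element of valuation `1 - 1 / q ^ 2`. -/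
lemma exists_w_eq (hy : S.IsRt y) : ∃ d ∈ IntermediateField.adjoin K {y}, d ≠ 0 ∧
    (S.Q * S.Q) * S.v.w d = S.Q * S.Q - 1 := by
  obtain ⟨hP, hPQ, hPQ1, hPQ2, hκ0, hκ1, hτ0, hτκ, hκQ, hτQ, hτQQ⟩ := S.facts
  have hw := S.w_p'
  set b : Ω := (-1) ^ p ^ (n - 1) * (-(p : Ω)) ^ ∑ i ∈ Finset.range n, p ^ i with hb
  have hb0 : b ≠ 0 := mul_ne_zero (by simp) (pow_ne_zero _ S.neg_p_ne)
  have hn : p ^ n = p ^ (n - 1) * p := by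
    rw [← pow_succ, Nat.sub_add_cancel S.hn]
  have hbp : b ^ p = S.a := by
    rw [hb, mul_pow, ← pow_mul, ← pow_mul, ← hn, a_eq, expo, Finset.sum_mul]
    simp_rw [pow_succ]
  set u : Ω := y ^ (p ^ n * p ^ (n - 1)) / b with hu
  have hup : u ^ p = (S.cc + y) * S.f y ^ (p ^ n - 1) := by
    have e1 : y ^ (p ^ n * p ^ n) = S.a * (S.cc + y) * S.f y ^ (p ^ n - 1) := hy
    rw [hu, div_pow, hbp, ← pow_mul, mul_assoc, ← hn, e1, mul_assoc, mul_div_cancel_left₀ _ S.a_ne]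
  have hu0 : u ≠ 0 := div_ne_zero (pow_ne_zero _ hy.ne_zero) hb0
  have hwu : S.v.w u = 0 := by
    apply w_eq_of_pow S.hp.ne_zero hu0
    rw [hup, S.v.map_mul _ _ hy.c_add_unit.1 (pow_ne_zero _ hy.f_unit.1), w_pow _ hy.f_unit.1,
      hy.c_add_unit.2, hy.f_unit.2]
    ring
  have hd : u - S.cc ∈ S.v.ge 0 := (S.v.ge 0).sub_mem (mem_ge_of_eq hwu) (mem_ge_of_eq S.w_cc)
  have h1 := add_pow_sub_mem (k := 1) S.hp le_rfl hd (mem_ge_of_eq S.w_cc)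
  rw [sub_add_cancel, pow_one, pow_one, sub_self, mul_zero, add_zero, hup, hw] at h1
  have hF := mul_mem (mem_ge_of_eq hy.c_add_unit.2)
    (pow_sub_one_mem (by nlinarith) hy.f_sub_one (p ^ n - 1))
  have hc := S.c_pow
  rw [hw] at hc
  have h2 : (u - S.cc) ^ p - y ∈ S.v.gt (S.v.w y) := by
    rw [hy.w_eq]
    have := (S.v.gt (S.P - S.τ)).sub_mem ((S.v.gt _).sub_mem (gt_of_ge hF (by linarith))
      (gt_of_ge h1 (by linarith))) (gt_of_ge hc (by linarith))
    convert this using 1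
    rw [cc]
    ring
  have h3 := w_eq_of_sub hy.ne_zero h2
  have hd0 : u - S.cc ≠ 0 := fun h => h3.1 (by rw [h, zero_pow S.hp.ne_zero])
  refine ⟨u - S.cc, ?_, hd0, ?_⟩
  · have hy' := IntermediateField.mem_adjoin_simple_self K y
    have hp' : (p : Ω) ∈ IntermediateField.adjoin K {y} := _root_.natCast_mem _ p
    exact _root_.sub_mem (_root_.div_mem (_root_.pow_mem hy' _)
      (MulMemClass.mul_mem (_root_.pow_mem (neg_mem (OneMemClass.one_mem _)) _)
        (_root_.pow_mem (neg_mem hp') _))) (IntermediateField.algebraMap_mem _ _)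
  · have h4 := h3.2
    rw [w_pow _ hd0, hy.w_eq] at h4
    change S.P * _ = _ at h4
    have h5 : S.P * (S.Q * S.Q * S.v.w (u - S.cc)) = S.P * (S.Q * S.Q - 1) := by
      linear_combination S.Q * S.Q * h4 - hτQQ
    exact mul_left_cancel₀ (by linarith) h5

lemma natDegree_minpoly (hy : S.IsRt y) : (minpoly K y).natDegree = p ^ n * p ^ n := by
  refine le_antisymm hy.natDegree_minpoly_le ?_
  obtain ⟨d, hdmem, hd0, hwd⟩ := hy.exists_w_eq
  rw [← IntermediateField.adjoin.finrank hy.isIntegral]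
  have := IntermediateField.adjoin.finiteDimensional hy.isIntegral
  set N := p ^ n * p ^ n with hN
  have hNQ : (N : ℚ) = S.Q * S.Q := S.cast_qq
  have hli : LinearIndependent K fun i : Fin N => d ^ (i : ℕ) := by
    apply linearIndependent_of_w (v := S.v) _ fun i => pow_ne_zero _ hd0
    intro i j hij x hx hcon
    obtain ⟨m, hm⟩ := S.w_int x hx
    rw [hm, w_pow _ hd0, w_pow _ hd0] at hcon
    have h1 : ((i : ℤ) - j) * (N - 1) = m * N := by
      have : (((i : ℚ) - j) * (N - 1) : ℚ) = m * N := by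
        rw [hNQ, ← hwd, ← hcon]
        ring
      exact_mod_cast this
    have h2 : (N : ℤ) ∣ (i : ℤ) - j := ⟨(i : ℤ) - j - m, by linear_combination -h1⟩
    have hi := i.2
    have hj := j.2
    have h3 := Int.eq_zero_of_abs_lt_dvd h2 (by rw [abs_lt]; omega)
    exact hij (Fin.ext (by omega))
  have hli' : LinearIndependent K fun i : Fin N =>
      (⟨d, hdmem⟩ : IntermediateField.adjoin K {y}) ^ (i : ℕ) := by
    apply LinearIndependent.of_comp (IntermediateField.val _).toLinearMap
    exact hli
  simpa using hli'.fintype_card_le_finrank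

end IsRt

end MonodromySetting

section ExtraSpecial

open Subgroup
open scoped commutatorElement

variable {G : Type*} [Group G] {p : ℕ}

/-- A subgroup of prime index is maximal. -/
lemma Subgroup.isCoatom_of_prime_index {H : Subgroup G} (h : H.index.Prime) : IsCoatom H := by
  refine ⟨fun h1 => h.ne_one (by rw [h1, index_top]), fun L hL => ?_⟩
  have h1 := relIndex_mul_index hL.le
  rcases (Nat.dvd_prime h).1 (Dvd.intro_left _ h1) with h2 | h2
  · exact index_eq_one.1 h2
  · rw [h2] at h1
    have h3 : H.relIndex L = 1 := by
      have := h.pos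
      nlinarith
    exact absurd (relIndex_eq_one.1 h3) (not_le_of_gt hL)

/-- For `s` whose commutators with all elements are central, `x ↦ ⁅x, s⁆` is a homomorphism. -/
def commutatorHom (s : G) (hs : ∀ x : G, ⁅x, s⁆ ∈ center G) : G →* center G where
  toFun x := ⟨⁅x, s⁆, hs x⟩
  map_one' := by ext; simp
  map_mul' x y := by
    ext
    have h := mem_center_iff.1 (hs y) x
    simp only [Subgroup.coe_mul, commutatorElement_def] at h ⊢
    calc x * y * s * (x * y)⁻¹ * s⁻¹ = x * (y * s * y⁻¹ * s⁻¹) * (s * x⁻¹ * s⁻¹) := by group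
      _ = y * s * y⁻¹ * s⁻¹ * (x * s * x⁻¹ * s⁻¹) := by rw [h]; group
      _ = x * s * x⁻¹ * s⁻¹ * (y * s * y⁻¹ * s⁻¹) := (mem_center_iff.1 (hs y) _).symm

lemma commutator_eq_center (hp : p.Prime) (hcard : Nat.card (center G) = p)
    (hcomm : ∀ a b : G, ⁅a, b⁆ ∈ center G) (hna : ∃ a b : G, a * b ≠ b * a) :
    commutator G = center G := by
  have hle : commutator G ≤ center G := commutator_le.2 fun a _ b _ => hcomm a b
  have : Finite (center G) := Nat.finite_of_card_ne_zero (hcard ▸ hp.ne_zero)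
  obtain ⟨a, b, hab⟩ := hna
  have hdvd := card_dvd_of_le hle
  rw [hcard] at hdvd
  rcases (Nat.dvd_prime hp).1 hdvd with h | h
  · have h1 : ⁅a, b⁆ ∈ commutator G := commutator_mem_commutator (mem_top a) (mem_top b)
    rw [card_eq_one.1 h, mem_bot, commutatorElement_eq_one_iff_mul_comm] at h1
    exact absurd h1 hab
  · exact eq_of_le_of_card_ge hle (by rw [h, hcard])

lemma frattini_eq_center [Finite G] (hp : p.Prime) (hcard : Nat.card (center G) = p)
    (hcomm : ∀ a b : G, ⁅a, b⁆ ∈ center G) (hna : ∃ a b : G, a * b ≠ b * a) :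
    frattini G = center G := by
  apply le_antisymm
  · intro g hg
    by_contra hgz
    obtain ⟨s, hs⟩ : ∃ s, s * g ≠ g * s := by simpa [mem_center_iff] using hgz
    set φ := commutatorHom s fun x => hcomm x s
    have hker : g ∉ φ.ker := fun h => hs
      (commutatorElement_eq_one_iff_mul_comm.1 (congrArg Subtype.val (MonoidHom.mem_ker.1 h))).symm
    have hidx : φ.ker.index.Prime := by
      have hdvd := card_subgroup_dvd_card φ.range
      rw [hcard, ← index_ker] at hdvd
      rcases (Nat.dvd_prime hp).1 hdvd with h | h
      · exact absurd (index_eq_one.1 h ▸ mem_top g) hker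
      · rwa [h]
    exact hker (frattini_le_coatom (isCoatom_of_prime_index hidx) hg)
  · refine le_iInf₂ fun H hH => ?_
    by_contra hle
    have htop : H ⊔ center G = ⊤ :=
      hH.2 _ (lt_of_le_of_ne le_sup_left fun h => hle (h ▸ le_sup_right))
    refine hle ?_
    rw [← commutator_eq_center hp hcard hcomm hna]
    refine commutator_le.2 fun a _ b _ => ?_
    obtain ⟨h, hh, z, hz, rfl⟩ := mem_sup_of_normal_right.1
      (show a ∈ H ⊔ center G from htop ▸ mem_top a)
    obtain ⟨k, hk, w, hw, rfl⟩ := mem_sup_of_normal_right.1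
      (show b ∈ H ⊔ center G from htop ▸ mem_top b)
    have e : ⁅h * z, k * w⁆ = ⁅h, k⁆ := by
      rw [mem_center_iff] at hz hw
      simp only [commutatorElement_def, mul_inv_rev]
      calc h * z * (k * w) * (z⁻¹ * h⁻¹) * (w⁻¹ * k⁻¹)
          = h * (z * (k * w) * z⁻¹) * h⁻¹ * (w⁻¹ * k⁻¹) := by group
        _ = h * k * (w * h⁻¹ * w⁻¹) * k⁻¹ := by rw [← hz (k * w)]; group
        _ = h * k * h⁻¹ * k⁻¹ := by rw [← hw h⁻¹]; group
    rw [e]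
    exact mul_mem (mul_mem (mul_mem hh hk) (inv_mem hh)) (inv_mem hk)

end ExtraSpecial

/-- An element is in `F(s)` if it is fixed by all automorphisms that fix `s` pointwise. -/
lemma IntermediateField.mem_adjoin_of_forall_fixed {F E : Type*} [Field F] [Field E] [Algebra F E]
    [IsGalois F E] {s : Set E} {x : E}
    (h : ∀ σ : E ≃ₐ[F] E, (∀ a ∈ s, σ a = a) → σ x = x) : x ∈ adjoin F s := by
  rw [← InfiniteGalois.fixedField_fixingSubgroup (adjoin F s), mem_fixedField_iff]
  intro σ hσ
  rw [mem_fixingSubgroup_iff] at hσ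
  exact h σ fun a ha => hσ a (subset_adjoin F s ha)

/-- There are enough automorphisms to move a separable element to all of its conjugates. -/
lemma exists_finset_algEquiv {F E : Type*} [Field F] [Field E] [Algebra F E] [IsGalois F E]
    (y : E) : ∃ T : Finset (E ≃ₐ[F] E), T.card = (minpoly F y).natDegree ∧
      ∀ ρ ∈ T, ∀ ρ' ∈ T, ρ y = ρ' y → ρ = ρ' := by
  classical
  have hroot (x : (minpoly F y).rootSet E) : ∃ σ : E ≃ₐ[F] E, σ y = x :=
    ((isConjRoot_iff_mem_minpoly_rootSet (IsGalois.integral F y)).2 x.2).symm.exists_algEquiv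
  choose g hg using hroot
  have hginj : Function.Injective g := fun a b h => Subtype.ext (by rw [← hg, ← hg, h])
  refine ⟨Finset.univ.image g, ?_, ?_⟩
  · rw [Finset.card_image_of_injective _ hginj, Finset.card_univ]
    exact card_rootSet_eq_natDegree (IsGalois.separable F y) (IsGalois.splits F y)
  · simp only [Finset.mem_image, Finset.mem_univ, true_and]
    rintro _ ⟨a, rfl⟩ _ ⟨b, rfl⟩ h
    rw [hg, hg] at h
    rw [Subtype.ext h]

open scoped commutatorElement

namespace MonodromySetting

variable {K Ω : Type} [Field K] [Field Ω] [Algebra K Ω] {p n : ℕ}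
variable {S : MonodromySetting K Ω p n}

namespace IsRt

variable {y z : Ω}

lemma isIntegral_of_pow (hy : S.IsRt y) (hz : z ^ p = S.f y) : IsIntegral K z := by
  refine IsIntegral.of_pow S.hp.pos ?_
  rw [hz]
  have hc : IsIntegral K S.cc := isIntegral_algebraMap
  exact (isIntegral_one.add (hc.mul (hy.isIntegral.pow _))).add (hy.isIntegral.pow _)

lemma two_le_sq (S : MonodromySetting K Ω p n) : 2 ≤ p ^ n * p ^ n := by
  have h1 : 2 ^ 1 ≤ p ^ n :=
    (Nat.pow_le_pow_right two_pos S.hn).trans (Nat.pow_le_pow_left S.hp.two_le n)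
  nlinarith

variable {M : IntermediateField K Ω}

lemma finiteDimensional_adjoin (hy : S.IsRt y) (hz : z ^ p = S.f y)
    (hM : M = IntermediateField.adjoin K {y, z}) : FiniteDimensional K M := by
  subst hM
  apply IntermediateField.finiteDimensional_adjoin
  rintro x (rfl | rfl)
  exacts [hy.isIntegral, hy.isIntegral_of_pow hz]

lemma restrictNormalHom_eq_iff (hM : M = IntermediateField.adjoin K {y, z}) [Normal K M]
    {σ ρ : Ω ≃ₐ[K] Ω} : AlgEquiv.restrictNormalHom M σ = AlgEquiv.restrictNormalHom M ρ ↔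
      σ y = ρ y ∧ σ z = ρ z := by
  constructor
  · intro h
    have key (x : Ω) (hx : x ∈ M) : σ x = ρ x := by
      rw [← AlgEquiv.restrictNormalHom_apply M σ ⟨x, hx⟩,
        ← AlgEquiv.restrictNormalHom_apply M ρ ⟨x, hx⟩, h]
    have hs : ({y, z} : Set Ω) ⊆ M := hM ▸ IntermediateField.subset_adjoin K _
    exact ⟨key y (hs (by simp)), key z (hs (by simp))⟩
  · rintro ⟨hy, hz⟩
    apply AlgEquiv.coe_toAlgHom_injective
    apply IntermediateField.algHom_ext_of_eq_adjoin K hM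
    intro x hx
    apply Subtype.ext
    change ((AlgEquiv.restrictNormalHom M σ _ : M) : Ω) = (AlgEquiv.restrictNormalHom M ρ _ : M)
    rw [AlgEquiv.restrictNormalHom_apply, AlgEquiv.restrictNormalHom_apply]
    rcases hx with rfl | rfl
    exacts [hy, hz]

variable [IsGalois K Ω]

lemma normal_adjoin (hy : S.IsRt y) (hz : z ^ p = S.f y) :
    Normal K (IntermediateField.adjoin K {y, z}) := by
  rw [IntermediateField.normal_iff_forall_map_le']
  intro σ
  rw [IntermediateField.adjoin_map, IntermediateField.adjoin_le_iff]
  rintro _ ⟨a, ha, rfl⟩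
  apply IntermediateField.mem_adjoin_of_forall_fixed
  intro τ hτ
  have hτy : τ y = y := hτ y (by simp)
  have hτz : τ z = z := hτ z (by simp)
  rcases ha with rfl | rfl
  · exact hy.map_eq (hy.map σ) hτy
  · exact (hy.comm_of_map_eq hz hτy σ).symm.trans (congrArg σ hτz)

lemma isGalois_adjoin (hy : S.IsRt y) (hz : z ^ p = S.f y)
    (hM : M = IntermediateField.adjoin K {y, z}) : IsGalois K M := by
  subst hM
  have := hy.normal_adjoin hz
  have : Algebra.IsSeparable K (IntermediateField.adjoin K {y, z}) :=
    Algebra.isSeparable_tower_bot_of_isSeparable K _ Ω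
  exact ⟨⟩

lemma mem_center_iff (hM : M = IntermediateField.adjoin K {y, z}) [Normal K M] [IsAlgClosed Ω]
    (hy : S.IsRt y) (hz : z ^ p = S.f y) {σ : Ω ≃ₐ[K] Ω} :
    AlgEquiv.restrictNormalHom M σ ∈ Subgroup.center (M ≃ₐ[K] M) ↔ σ y = y := by
  rw [Subgroup.mem_center_iff]
  constructor
  · intro h
    obtain ⟨T, hT, hinj⟩ := exists_finset_algEquiv (F := K) y
    refine hy.map_eq_of_comm hz T (by rw [hT, hy.natDegree_minpoly]) hinj fun ρ _ => ?_
    have h1 := h (AlgEquiv.restrictNormalHom M ρ)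
    rw [← _root_.map_mul, ← _root_.map_mul, restrictNormalHom_eq_iff hM] at h1
    exact h1.2.symm
  · intro h g
    obtain ⟨ρ, rfl⟩ := AlgEquiv.restrictNormalHom_surjective Ω g
    rw [← _root_.map_mul, ← _root_.map_mul, restrictNormalHom_eq_iff hM]
    exact ⟨hy.map_comm ρ σ, hy.comm_of_map_eq hz h ρ⟩

lemma commutator_mem_center (hM : M = IntermediateField.adjoin K {y, z}) [Normal K M]
    [IsAlgClosed Ω] (hy : S.IsRt y) (hz : z ^ p = S.f y) (a b : M ≃ₐ[K] M) :
    ⁅a, b⁆ ∈ Subgroup.center (M ≃ₐ[K] M) := by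
  obtain ⟨σ, rfl⟩ := AlgEquiv.restrictNormalHom_surjective Ω a
  obtain ⟨ρ, rfl⟩ := AlgEquiv.restrictNormalHom_surjective Ω b
  rw [← map_commutatorElement, mem_center_iff hM hy hz, commutatorElement_def]
  change σ (ρ (σ⁻¹ (ρ⁻¹ y))) = y
  rw [hy.map_comm σ⁻¹ ρ⁻¹]
  change σ (ρ (ρ.symm (σ.symm y))) = y
  simp

lemma exists_not_comm (hM : M = IntermediateField.adjoin K {y, z}) [Normal K M]
    [IsAlgClosed Ω] (hy : S.IsRt y) (hz : z ^ p = S.f y) : ∃ a b : M ≃ₐ[K] M, a * b ≠ b * a := by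
  by_contra! hcon
  obtain ⟨T, hT, hinj⟩ := exists_finset_algEquiv (F := K) y
  have h1 : 1 < T.card := by
    rw [hT, hy.natDegree_minpoly]
    exact two_le_sq S
  obtain ⟨σ, hσ, ρ, hρ, hne⟩ := Finset.one_lt_card.1 h1
  have key (τ : Ω ≃ₐ[K] Ω) : τ y = y :=
    (mem_center_iff hM hy hz).1 (Subgroup.mem_center_iff.2 fun g => hcon _ _)
  exact hne (hinj σ hσ ρ hρ (by rw [key, key]))

lemma card_center (hM : M = IntermediateField.adjoin K {y, z}) [Normal K M] [IsAlgClosed Ω]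
    (hy : S.IsRt y) (hz : z ^ p = S.f y) : Nat.card (Subgroup.center (M ≃ₐ[K] M)) = p := by
  have := Fact.mk S.hp
  have hex (g : Subgroup.center (M ≃ₐ[K] M)) : ∃ σ : Ω ≃ₐ[K] Ω, ∃ i : Fin p,
      AlgEquiv.restrictNormalHom M σ = g.1 ∧ σ y = y ∧ σ z = S.ζ ^ (i : ℕ) * z := by
    obtain ⟨g, hg⟩ := g
    obtain ⟨σ, rfl⟩ := AlgEquiv.restrictNormalHom_surjective Ω g
    have hσ := (mem_center_iff hM hy hz).1 hg
    obtain ⟨i, hi, h⟩ := hy.exists_root_of_map_eq hz hσ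
    exact ⟨σ, ⟨i, hi⟩, rfl, hσ, h⟩
  choose s i hsg hsy hsz using hex
  have hinj : Function.Injective i := by
    intro g g' h
    apply Subtype.ext
    rw [← hsg, ← hsg, restrictNormalHom_eq_iff hM, hsy, hsy, hsz, hsz, h]
    exact ⟨rfl, rfl⟩
  have hfin := Finite.of_injective i hinj
  have hle : Nat.card (Subgroup.center (M ≃ₐ[K] M)) ≤ p := by
    simpa using Nat.card_le_card_of_injective i hinj
  have hpow (g : Subgroup.center (M ≃ₐ[K] M)) : g ^ p = 1 := by
    have hk (k : ℕ) : (s g ^ k) y = y ∧ (s g ^ k) z = (S.ζ ^ (i g : ℕ)) ^ k * z := by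
      induction k with
      | zero => simp
      | succ k ih =>
        rw [pow_succ', AlgEquiv.mul_apply, AlgEquiv.mul_apply, ih.1, ih.2, hsy, _root_.map_mul,
          map_pow, map_pow, S.map_ζ, hsz]
        exact ⟨rfl, by ring⟩
    apply Subtype.ext
    rw [Subgroup.coe_pow, Subgroup.coe_one, ← hsg, ← map_pow,
      ← map_one (AlgEquiv.restrictNormalHom (F := K) (K₁ := Ω) M), restrictNormalHom_eq_iff hM,
      (hk p).1, (hk p).2, ← pow_mul, mul_comm _ p, pow_mul,
      S.hζ.pow_eq_one]
    simp
  obtain ⟨a, b, hab⟩ := exists_not_comm hM hy hz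
  have hne : (⟨_, commutator_mem_center hM hy hz a b⟩ : Subgroup.center (M ≃ₐ[K] M)) ≠ 1 :=
    fun h => hab (commutatorElement_eq_one_iff_mul_comm.1 (congrArg Subtype.val h))
  have hord := orderOf_eq_prime (hpow _) hne
  exact le_antisymm hle (hord ▸ Nat.le_of_dvd Nat.card_pos (orderOf_dvd_natCard _))

lemma finrank_adjoin (hM : M = IntermediateField.adjoin K {y, z}) [IsAlgClosed Ω]
    (hy : S.IsRt y) (hz : z ^ p = S.f y) : Module.finrank K M = p * (p ^ n * p ^ n) := by
  have := hy.isGalois_adjoin hz hM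
  have := hy.finiteDimensional_adjoin hz hM
  have hyM : y ∈ M := hM ▸ IntermediateField.subset_adjoin K _ (by simp)
  set y' : M := ⟨y, hyM⟩ with hy'
  have hmin : minpoly K y' = minpoly K y :=
    (minpoly.algebraMap_eq (B' := Ω) (algebraMap M Ω).injective y').symm
  have hcen : (IntermediateField.adjoin K {y'}).fixingSubgroup = Subgroup.center (M ≃ₐ[K] M) := by
    ext g
    obtain ⟨σ, rfl⟩ := AlgEquiv.restrictNormalHom_surjective Ω g
    rw [mem_center_iff hM hy hz, IntermediateField.mem_fixingSubgroup_iff]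
    have := IntermediateField.forall_mem_adjoin_smul_eq_self_iff K (S := {y'})
      (AlgEquiv.restrictNormalHom M σ)
    simp only [AlgEquiv.smul_def] at this
    rw [this]
    simp only [Set.mem_singleton_iff, forall_eq]
    rw [← Subtype.coe_inj, AlgEquiv.restrictNormalHom_apply]
  rw [← Module.finrank_mul_finrank K (IntermediateField.adjoin K {y'}) M,
    ← IsGalois.card_fixingSubgroup_eq_finrank, hcen, card_center hM hy hz,
    IntermediateField.adjoin.finrank (IsGalois.integral K y'), hmin, hy.natDegree_minpoly, mul_comm]

theorem isExtraSpecial (hM : M = IntermediateField.adjoin K {y, z}) [IsAlgClosed Ω]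
    (hy : S.IsRt y) (hz : z ^ p = S.f y) {G : Type} [Group G] (e : G ≃* (M ≃ₐ[K] M)) :
    (∃ a b : G, a * b ≠ b * a) ∧ commutator G = Subgroup.center G ∧
      frattini G = Subgroup.center G ∧ Nat.card (Subgroup.center G) = p := by
  have := hy.isGalois_adjoin hz hM
  have := hy.finiteDimensional_adjoin hz hM
  have : Finite G := Finite.of_equiv _ e.symm.toEquiv
  obtain ⟨a, b, hab⟩ := exists_not_comm hM hy hz
  have hna : ∃ a b : G, a * b ≠ b * a :=
    ⟨e.symm a, e.symm b, by rw [← _root_.map_mul, ← _root_.map_mul]; exact e.symm.injective.ne hab⟩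
  have hcard : Nat.card (Subgroup.center G) = p := by
    rw [Nat.card_congr (Subgroup.centerCongr e).toEquiv, card_center hM hy hz]
  have hcomm (a b : G) : ⁅a, b⁆ ∈ Subgroup.center G := by
    have h := commutator_mem_center hM hy hz (e a) (e b)
    rw [Subgroup.mem_center_iff] at h ⊢
    intro g
    apply e.injective
    rw [_root_.map_mul, _root_.map_mul, map_commutatorElement]
    exact h (e g)
  exact ⟨hna, commutator_eq_center S.hp hcard hcomm hna, frattini_eq_center S.hp hcard hcomm hna,
    hcard⟩

end IsRt

end MonodromySetting

namespace RatVal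

variable {Ω : Type} [Field Ω] (v : RatVal Ω)

/-- The multiplicative absolute value of an additive valuation. -/
def absVal : AbsoluteValue Ω ℝ where
  toFun x := open Classical in if x = 0 then 0 else (2 : ℝ) ^ (-(v.w x : ℝ))
  map_mul' x y := by
    by_cases hx : x = 0
    · simp [hx]
    by_cases hy : y = 0
    · simp [hy]
    rw [if_neg hx, if_neg hy, if_neg (mul_ne_zero hx hy), v.map_mul x y hx hy,
      ← Real.rpow_add two_pos]
    push_cast
    ring_nf
  nonneg' x := by
    split_ifs
    · exact le_rfl
    · positivity
  eq_zero' x := by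
    split_ifs with h
    · simpa using h
    · simpa [h] using (Real.rpow_pos_of_pos two_pos _).ne'
  add_le' x y := by
    by_cases hx : x = 0
    · rw [hx, zero_add, if_pos rfl, zero_add]
    by_cases hy : y = 0
    · rw [hy, add_zero, if_pos rfl, add_zero]
    by_cases hxy : x + y = 0
    · rw [if_pos hxy, if_neg hx, if_neg hy]
      positivity
    rw [if_neg hx, if_neg hy, if_neg hxy]
    have hx' := Real.rpow_pos_of_pos two_pos (-(v.w x : ℝ))
    have hy' := Real.rpow_pos_of_pos two_pos (-(v.w y : ℝ))
    rcases min_le_iff.1 (v.map_add x y hx hy hxy) with h | h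
    · have : (2 : ℝ) ^ (-(v.w (x + y) : ℝ)) ≤ 2 ^ (-(v.w x : ℝ)) :=
        Real.rpow_le_rpow_of_exponent_le one_le_two (neg_le_neg (by exact_mod_cast h))
      linarith
    · have : (2 : ℝ) ^ (-(v.w (x + y) : ℝ)) ≤ 2 ^ (-(v.w y : ℝ)) :=
        Real.rpow_le_rpow_of_exponent_le one_le_two (neg_le_neg (by exact_mod_cast h))
      linarith

variable {v}

lemma absVal_of_ne {x : Ω} (hx : x ≠ 0) : v.absVal x = (2 : ℝ) ^ (-(v.w x : ℝ)) := if_neg hx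

lemma absVal_le_iff {x : Ω} {r : ℚ} : v.absVal x ≤ (2 : ℝ) ^ (-(r : ℝ)) ↔ x ∈ v.ge r := by
  rw [mem_ge]
  by_cases hx : x = 0
  · simp [hx, (Real.rpow_pos_of_pos two_pos _).le]
  · rw [absVal_of_ne hx, Real.rpow_le_rpow_left_iff one_lt_two, neg_le_neg_iff, Rat.cast_le]
    simp [hx]

lemma absVal_add_le_max (x y : Ω) : v.absVal (x + y) ≤ max (v.absVal x) (v.absVal y) := by
  by_cases hx : x = 0
  · simp [hx]
  by_cases hy : y = 0
  · simp [hy]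
  rcases le_total (v.w x) (v.w y) with h | h
  · refine le_max_of_le_left ?_
    rw [absVal_of_ne hx, absVal_le_iff]
    exact (v.ge _).add_mem (mem_ge_self x) (ge_mono (mem_ge_self y) h)
  · refine le_max_of_le_right ?_
    rw [absVal_of_ne hy, absVal_le_iff]
    exact (v.ge _).add_mem (ge_mono (mem_ge_self x) h) (mem_ge_self y)

lemma w_eq_of_absVal {x y : Ω} (hx : x ≠ 0) (hy : y ≠ 0) (h : v.absVal x = v.absVal y) :
    v.w x = v.w y := by
  rw [absVal_of_ne hx, absVal_of_ne hy] at h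
  have := Real.rpow_right_inj two_pos (by norm_num) |>.1 h
  exact_mod_cast neg_injective this

/-- A valuation on an algebraic extension of a complete field is invariant under automorphisms. -/
lemma w_map_of_complete {K : Type} [Field K] [Algebra K Ω] [Algebra.IsAlgebraic K Ω]
    (hπ : ∃ a : K, algebraMap K Ω a ≠ 0 ∧ v.w (algebraMap K Ω a) < 0)
    (hc : ∀ u : ℕ → K, (∀ m n : ℕ, m ≤ n → algebraMap K Ω (u m - u n) ∈ v.ge m) →
      ∃ L, ∀ n : ℕ, algebraMap K Ω (u n - L) ∈ v.ge n) (σ : Ω ≃ₐ[K] Ω) (x : Ω) :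
    v.w (σ x) = v.w x := by
  by_cases hx : x = 0
  · simp [hx]
  let N : NontriviallyNormedField K :=
    { (v.absVal.comp (algebraMap K Ω).injective).toNormedField with
      non_trivial := by
        obtain ⟨a, ha, hw⟩ := hπ
        refine ⟨a, ?_⟩
        change 1 < v.absVal (algebraMap K Ω a)
        rw [absVal_of_ne ha]
        exact Real.one_lt_rpow one_lt_two (by simpa using hw) }
  have hnorm (a : K) : ‖a‖ = v.absVal (algebraMap K Ω a) := rfl
  have hult : IsUltrametricDist K := by
    apply IsUltrametricDist.isUltrametricDist_of_isNonarchimedean_norm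
    intro a b
    rw [hnorm, hnorm, hnorm, _root_.map_add]
    exact absVal_add_le_max _ _
  have hcomp : CompleteSpace K := by
    refine Metric.complete_of_convergent_controlled_sequences
      (fun m => (2 : ℝ) ^ (-(((m : ℕ) : ℚ) : ℝ))) (fun m => by positivity) fun u hu => ?_
    obtain ⟨L, hL⟩ := hc u fun m k hmk => by
      rw [← absVal_le_iff, ← hnorm, ← dist_eq_norm]
      exact (hu m m k le_rfl hmk).le
    refine ⟨L, ?_⟩
    rw [tendsto_iff_dist_tendsto_zero]
    refine squeeze_zero (g := fun m : ℕ => ((1 : ℝ) / 2) ^ m) (fun _ => dist_nonneg)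
      (fun m => ?_) (tendsto_pow_atTop_nhds_zero_of_lt_one (by norm_num) (by norm_num))
    have := absVal_le_iff.2 (hL m)
    rw [← hnorm, ← dist_eq_norm] at this
    refine this.trans_eq ?_
    rw [Real.rpow_neg zero_le_two, Rat.cast_natCast, Real.rpow_natCast, one_div, inv_pow]
  have hf (y : Ω) : v.absVal y = spectralNorm K Ω y :=
    spectralNorm_unique_field_norm_ext (fun a => (hnorm a).symm) y
  apply w_eq_of_absVal ((_root_.map_ne_zero σ).2 hx) hx
  rw [hf, hf, ← spectralNorm_eq_of_equiv]

end RatVal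

namespace RatVal

variable {Ω : Type} [Field Ω] (v : RatVal Ω)

/-- The valuation ring. -/
def ring : Subring Ω where
  __ := v.ge 0
  one_mem' := one_mem
  mul_mem' := mul_mem_of_ge_zero

variable {v}

/-- Multiplying a valuation by a positive number. -/
def scale (v : RatVal Ω) {e : ℚ} (he : 0 < e) : RatVal Ω where
  w x := e * v.w x
  map_mul x y hx hy := by rw [v.map_mul x y hx hy, mul_add]
  map_add x y hx hy hxy := by
    rw [← mul_min_of_nonneg _ _ he.le]
    exact mul_le_mul_of_nonneg_left (v.map_add x y hx hy hxy) he.le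

lemma scale_w {e : ℚ} (he : 0 < e) (x : Ω) : (v.scale he).w x = e * v.w x := rfl

lemma mem_scale_ge_zero {e : ℚ} (he : 0 < e) {x : Ω} : x ∈ (v.scale he).ge 0 ↔ x ∈ v.ge 0 := by
  rw [mem_ge, mem_ge, scale_w, mul_nonneg_iff_of_pos_left he]

lemma mem_scale_gt_zero {e : ℚ} (he : 0 < e) {x : Ω} : x ∈ (v.scale he).gt 0 ↔ x ∈ v.gt 0 := by
  rw [mem_gt, mem_gt, scale_w, mul_pos_iff_of_pos_left he]

/-- The minimal polynomial of an integral element over a field with invariant valuation has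
integral coefficients. -/
lemma coeff_minpoly_mem {K : Type} [Field K] [Algebra K Ω] [Normal K Ω]
    (h_map : ∀ (σ : Ω ≃ₐ[K] Ω) (x : Ω), v.w (σ x) = v.w x) {x : Ω} (hx : x ∈ v.ge 0) (i : ℕ) :
    algebraMap K Ω ((minpoly K x).coeff i) ∈ v.ge 0 := by
  have hint := Normal.isIntegral (F := K) ‹_› x
  have hmem (r : Ω) (hr : r ∈ ((minpoly K x).map (algebraMap K Ω)).roots) : r ∈ v.ring := by
    have h1 : IsConjRoot K x r := by
      rw [isConjRoot_iff_mem_minpoly_aroots hint]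
      exact hr
    obtain ⟨σ, rfl⟩ := h1.exists_algEquiv
    rw [mem_ge, h_map] at hx
    exact hx.imp_left (map_eq_zero σ).1
  have hlift : (minpoly K x).map (algebraMap K Ω) ∈ lifts v.ring.subtype := by
    rw [(Normal.splits ‹_› x).eq_prod_roots_of_monic ((minpoly.monic hint).map _)]
    refine multiset_prod_mem _ fun f hf => ?_
    obtain ⟨r, hr, rfl⟩ := Multiset.mem_map.1 hf
    exact ⟨X - C ⟨r, hmem r hr⟩, by simp⟩
  obtain ⟨a, ha⟩ := (lifts_iff_coeff_lifts _).1 hlift i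
  rw [coeff_map] at ha
  rw [← ha]
  exact a.2

end RatVal

section Witt

open RatVal WittVector

variable {p : ℕ} [Fact p.Prime]

local notation "𝕜" => AlgebraicClosure (ZMod p)

/-- The inclusion of the ring of Witt vectors into the algebraic closure of its fraction field. -/
def wittHom (p : ℕ) [Fact p.Prime] : WittVector p (AlgebraicClosure (ZMod p)) →+* Omg p :=
  (algebraMap (Kzero p) (Omg p)).comp (algebraMap _ (Kzero p))

lemma wittHom_injective : Function.Injective (wittHom p) :=
  (algebraMap (Kzero p) (Omg p)).injective.comp (IsFractionRing.injective _ _)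

/-- A valuation on the algebraic closure of the fraction field of the Witt vectors that extends
the `p`-adic valuation. -/
structure WittVal (p : ℕ) [Fact p.Prime] extends RatVal (Omg p) where
  w_p : w (p : Omg p) = 1
  w_nonneg : ∀ x : WittVector p (AlgebraicClosure (ZMod p)), x ≠ 0 → 0 ≤ w (wittHom p x)

lemma charZero_wittVector : CharZero (WittVector p 𝕜) := by
  obtain ⟨q, hq⟩ := CharP.exists (WittVector p 𝕜)
  rcases CharP.char_is_prime_or_zero (WittVector p 𝕜) q with h | rfl
  · have h0 : (q : WittVector p 𝕜) = 0 := CharP.cast_eq_zero _ _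
    have h1 : (q : 𝕜) = 0 := by
      rw [← map_natCast (WittVector.constantCoeff (p := p) (R := 𝕜)), h0, map_zero]
    have h2 := (Nat.prime_dvd_prime_iff_eq (Fact.out : p.Prime) h).1
      ((CharP.cast_eq_zero_iff 𝕜 p q).1 h1)
    subst h2
    exact absurd h0 (p_nonzero p 𝕜)
  · exact CharP.charP_to_charZero _

instance : CharZero (Omg p) :=
  have := charZero_wittVector (p := p)
  charZero_of_injective_algebraMap (R := WittVector p 𝕜) (A := Omg p) wittHom_injective

namespace WittVal

variable (v : WittVal p)

lemma mem (x : WittVector p 𝕜) : wittHom p x ∈ v.ge 0 := by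
  by_cases hx : x = 0
  · simp [hx, (v.ge 0).zero_mem]
  · exact Or.inr (v.w_nonneg x hx)

lemma w_unit (u : (WittVector p 𝕜)ˣ) : v.w (wittHom p u) = 0 := by
  have hu : wittHom p u ≠ 0 := (map_ne_zero_iff _ wittHom_injective).2 u.ne_zero
  have h1 := v.w_nonneg u u.ne_zero
  have h2 := v.w_nonneg ↑u⁻¹ u⁻¹.ne_zero
  rw [map_units_inv, w_inv _ hu] at h2
  linarith

lemma w_pow_p (m : ℕ) : v.w ((p : Omg p) ^ m) = m := by
  rw [w_pow _ (Nat.cast_ne_zero.2 (Fact.out : p.Prime).ne_zero), v.w_p, mul_one]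

lemma exists_eq (a : Kzero p) (ha : a ≠ 0) : ∃ (m k : ℕ) (u : (WittVector p 𝕜)ˣ),
    algebraMap (Kzero p) (Omg p) a = (p : Omg p) ^ m / (p : Omg p) ^ k * wittHom p u ∧
      v.w (algebraMap (Kzero p) (Omg p) a) = m - k := by
  have hp : (p : Omg p) ≠ 0 := Nat.cast_ne_zero.2 (Fact.out : p.Prime).ne_zero
  have hu0 (u : (WittVector p 𝕜)ˣ) : wittHom p u ≠ 0 :=
    (map_ne_zero_iff _ wittHom_injective).2 u.ne_zero
  obtain ⟨x, y, hy, rfl⟩ := IsFractionRing.div_surjective (A := WittVector p 𝕜) a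
  have hx : x ≠ 0 := by
    rintro rfl
    simp at ha
  obtain ⟨m, b, rfl⟩ := exists_eq_pow_p_mul' x hx
  obtain ⟨k, d, rfl⟩ := exists_eq_pow_p_mul' y (nonZeroDivisors.ne_zero hy)
  have h : algebraMap (Kzero p) (Omg p) (algebraMap _ (Kzero p) ((p : WittVector p 𝕜) ^ m * b) /
      algebraMap _ (Kzero p) ((p : WittVector p 𝕜) ^ k * d)) =
      (p : Omg p) ^ m / (p : Omg p) ^ k * wittHom p ↑(b * d⁻¹) := by
    rw [map_div₀, Units.val_mul, _root_.map_mul (wittHom p), map_units_inv]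
    change wittHom p _ / wittHom p _ = _
    rw [_root_.map_mul, _root_.map_mul, map_pow, map_pow, map_natCast, mul_div_mul_comm,
      div_eq_mul_inv (wittHom p b)]
  refine ⟨m, k, b * d⁻¹, h, ?_⟩
  rw [h, v.map_mul _ _ (div_ne_zero (pow_ne_zero _ hp) (pow_ne_zero _ hp)) (hu0 _), w_unit,
    w_div _ (pow_ne_zero _ hp) (pow_ne_zero _ hp), w_pow_p, w_pow_p, add_zero]

lemma exists_witt_eq {a : Kzero p} {j : ℕ} (ha : algebraMap (Kzero p) (Omg p) a ∈ v.ge j) :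
    ∃ x : WittVector p 𝕜, algebraMap _ (Kzero p) ((p : WittVector p 𝕜) ^ j * x) = a := by
  by_cases ha0 : a = 0
  · exact ⟨0, by simp [ha0]⟩
  have hp : (p : Omg p) ≠ 0 := Nat.cast_ne_zero.2 (Fact.out : p.Prime).ne_zero
  obtain ⟨m, k, u, h1, h2⟩ := v.exists_eq a ha0
  have h3 := le_w ha (by simpa using ha0)
  rw [h2, le_sub_iff_add_le] at h3
  have h4 : j + k ≤ m := by exact_mod_cast h3
  refine ⟨(p : WittVector p 𝕜) ^ (m - (j + k)) * u, ?_⟩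
  apply (algebraMap (Kzero p) (Omg p)).injective
  change wittHom p _ = _
  rw [h1, _root_.map_mul, _root_.map_mul, map_pow, map_pow, map_natCast, ← mul_assoc, ← pow_add,
    div_mul_eq_mul_div, eq_div_iff (pow_ne_zero _ hp), mul_right_comm, ← pow_add]
  congr 2
  omega

lemma complete (u : ℕ → Kzero p)
    (hu : ∀ m n : ℕ, m ≤ n → algebraMap (Kzero p) (Omg p) (u m - u n) ∈ v.ge m) :
    ∃ L, ∀ n : ℕ, algebraMap (Kzero p) (Omg p) (u n - L) ∈ v.ge n := by
  have h0 (n : ℕ) : ∃ x : WittVector p 𝕜, algebraMap _ (Kzero p) x = u 0 - u n := by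
    obtain ⟨x, hx⟩ := v.exists_witt_eq (hu 0 n n.zero_le)
    exact ⟨_, hx⟩
  choose x hx using h0
  have key (m n : ℕ) (hmn : m ≤ n) : (p : WittVector p 𝕜) ^ m ∣ x m - x n := by
    have h1 := (v.ge m).neg_mem (hu m n hmn)
    rw [← _root_.map_neg] at h1
    obtain ⟨b, hb⟩ := v.exists_witt_eq h1
    refine ⟨b, IsFractionRing.injective _ (Kzero p) ?_⟩
    rw [hb, _root_.map_sub, hx, hx]
    ring
  obtain ⟨L, hL⟩ := IsPrecomplete.prec
    (inferInstance : IsPrecomplete (Ideal.span {(p : WittVector p 𝕜)}) (WittVector p 𝕜))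
    (f := x) fun {m n} hmn => by
      simpa [Ideal.span_singleton_pow, SModEq.sub_mem, Ideal.mem_span_singleton] using key m n hmn
  refine ⟨u 0 - algebraMap _ (Kzero p) L, fun n => ?_⟩
  have h1 : (p : WittVector p 𝕜) ^ n ∣ x n - L := by
    simpa [Ideal.span_singleton_pow, SModEq.sub_mem, Ideal.mem_span_singleton] using hL n
  obtain ⟨b, hb⟩ := h1
  have h2 : u n - (u 0 - algebraMap _ (Kzero p) L) =
      -algebraMap _ (Kzero p) ((p : WittVector p 𝕜) ^ n * b) := by
    rw [← hb, _root_.map_sub, hx]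
    ring
  rw [h2, _root_.map_neg]
  refine (v.ge n).neg_mem ?_
  change wittHom p _ ∈ _
  rw [_root_.map_mul, map_pow, map_natCast, mul_comm]
  exact mul_mem_of_ge_zero (v.mem b) (mem_ge_of_eq (v.w_pow_p n))

lemma w_map (σ : Omg p ≃ₐ[Kzero p] Omg p) (x : Omg p) : v.w (σ x) = v.w x := by
  refine w_map_of_complete ⟨(p : Kzero p)⁻¹, ?_, ?_⟩ v.complete σ x
  · simp [(Fact.out : p.Prime).ne_zero]
  · rw [map_inv₀, map_natCast, w_inv _ (Nat.cast_ne_zero.2 (Fact.out : p.Prime).ne_zero), v.w_p]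
    norm_num

/-- The residue field of `Ω` is the residue field of the Witt vectors. -/
lemma exists_witt_sub_mem {x : Omg p} (hx : x ∈ v.ge 0) :
    ∃ b : WittVector p 𝕜, x - wittHom p b ∈ v.gt 0 := by
  have hint : IsIntegral (Kzero p) x := Algebra.IsIntegral.isIntegral x
  have hlift : minpoly (Kzero p) x ∈ lifts (algebraMap (WittVector p 𝕜) (Kzero p)) := by
    rw [lifts_iff_coeff_lifts]
    intro i
    obtain ⟨b, hb⟩ := v.exists_witt_eq (j := 0)
      (by simpa using coeff_minpoly_mem v.w_map hx i)
    exact ⟨_, hb⟩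
  obtain ⟨g, hg, -, hmon⟩ := lifts_and_natDegree_eq_and_monic hlift (minpoly.monic hint)
  have hgx : g.eval₂ (wittHom p) x = 0 := by
    rw [wittHom, ← eval₂_map, hg]
    exact minpoly.aeval _ x
  set red : WittVector p 𝕜 →+* 𝕜 := WittVector.constantCoeff with hred
  obtain ⟨s, hs⟩ : ∃ s : Multiset (WittVector p 𝕜), s.map red = (g.map red).roots :=
    ⟨(g.map red).roots.map (teichmuller p), by
      simp [Multiset.map_map, Function.comp_def, hred, WittVector.constantCoeff_apply,
        teichmuller_coeff_zero]⟩
  set h : Polynomial (WittVector p 𝕜) := (s.map fun r => X - C r).prod with hh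
  have hgh : h.map red = g.map red := by
    rw [(IsAlgClosed.splits (g.map red)).eq_prod_roots_of_monic (hmon.map _), ← hs, hh,
      Polynomial.map_multiset_prod, Multiset.map_map, Multiset.map_map]
    simp
  have hdvd : C (p : WittVector p 𝕜) ∣ h - g := by
    rw [C_dvd_iff_dvd_coeff]
    intro i
    rw [← Ideal.mem_span_singleton, ← WittVector.ker_constantCoeff, RingHom.mem_ker, ← coeff_map,
      Polynomial.map_sub]
    exact by rw [hgh, sub_self, coeff_zero]
  obtain ⟨d, hd⟩ := hdvd
  have hhx : h.eval₂ (wittHom p) x ∈ v.gt 0 := by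
    rw [← sub_add_cancel h g, eval₂_add, hgx, add_zero, hd, eval₂_mul, eval₂_C, map_natCast,
      mul_comm]
    have hd0 : d.eval₂ (wittHom p) x ∈ v.ge 0 := by
      rw [eval₂_eq_sum_range]
      exact (v.ge 0).sum_mem fun i _ => mul_mem_of_ge_zero (v.mem _) (by simpa using pow_mem hx i)
    have hp0 : (p : Omg p) ∈ v.gt 0 := Or.inr (by rw [v.w_p]; exact one_pos)
    simpa using mul_mem_gt hd0 hp0
  rw [hh, eval₂_multiset_prod, Multiset.map_map] at hhx
  obtain ⟨a, ha, hxa⟩ := exists_sub_mem_gt_of_prod (v := v.toRatVal) (s.map (wittHom p)) (x := x)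
    (r := 0) (by simpa [Multiset.map_map] using hhx)
  obtain ⟨b, -, rfl⟩ := Multiset.mem_map.1 ha
  exact ⟨b, hxa⟩

lemma inertia (σ : Omg p ≃ₐ[Kzero p] Omg p) {x : Omg p} (hx : x ∈ v.ge 0) :
    σ x - x ∈ v.gt 0 := by
  obtain ⟨b, hb⟩ := v.exists_witt_sub_mem hx
  have h1 : σ (x - wittHom p b) ∈ v.gt 0 := by
    rw [mem_gt, v.w_map]
    exact hb.imp_left fun h => by rw [h, map_zero]
  have h2 : σ (wittHom p b) = wittHom p b := σ.commutes _
  rw [_root_.map_sub, h2] at h1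
  simpa using (v.gt 0).sub_mem h1 hb

end WittVal

end Witt

namespace WittVal

open RatVal

variable {p : ℕ} [Fact p.Prime] (v : WittVal p)

lemma w_int (a : Kzero p) (ha : a ≠ 0) : ∃ m : ℤ, v.w (algebraMap (Kzero p) (Omg p) a) = m := by
  obtain ⟨m, k, -, -, h⟩ := v.exists_eq a ha
  exact ⟨m - k, by rw [h]; push_cast; rfl⟩

/-- An element of valuation `1 / e` in an extension of degree at most `e` of `K₀` is a
uniformizer. -/
lemma exists_int_of_finrank_le {L : IntermediateField (Kzero p) (Omg p)}
    [FiniteDimensional (Kzero p) L] {e : ℕ} (he : Module.finrank (Kzero p) L ≤ e) {π : L}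
    (hπ0 : π ≠ 0) (hπ : e * v.w (π : Omg p) = 1) {a : L} (ha : a ≠ 0) :
    ∃ m : ℤ, e * v.w (a : Omg p) = m := by
  by_contra! hcon
  have hπ' : (π : Omg p) ≠ 0 := by simpa using hπ0
  have hpow (i : ℕ) : e * v.w ((π : Omg p) ^ i) = i := by
    rw [w_pow _ hπ', mul_left_comm, hπ, mul_one]
  set x : Option (Fin e) → L := fun o => o.elim a fun i => π ^ (i : ℕ) with hx
  have hli : LinearIndependent (Kzero p) fun o => ((x o : L) : Omg p) := by
    refine linearIndependent_of_w (v := v.toRatVal) _ ?_ ?_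
    · rintro (_ | i) <;> simp [hx, ha, hπ0]
    · intro i j hij b hb h
      obtain ⟨m, hm⟩ := v.w_int b hb
      rw [hm] at h
      have h' : e * v.w ((x i : L) : Omg p) - e * v.w ((x j : L) : Omg p) = e * m := by
        rw [← mul_sub, h]
      rcases i with _ | i <;> rcases j with _ | j
      · exact hij rfl
      · simp only [hx, Option.elim, IntermediateField.coe_pow, hpow] at h'
        exact hcon (e * m + j) (by push_cast; linarith)
      · simp only [hx, Option.elim, IntermediateField.coe_pow, hpow] at h'
        exact hcon (i - e * m) (by push_cast; linarith)
      · simp only [hx, Option.elim, IntermediateField.coe_pow, hpow] at h'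
        have h2 : ((i : ℕ) : ℤ) - (j : ℕ) = e * m := by exact_mod_cast h'
        have h3 := Int.eq_zero_of_abs_lt_dvd (Dvd.intro _ h2.symm)
          (abs_lt.2 ⟨by omega, by omega⟩)
        exact hij (congrArg some (Fin.ext (by omega)))
  have hli' : LinearIndependent (Kzero p) x :=
    LinearIndependent.of_comp (IntermediateField.val L).toLinearMap hli
  have := hli'.fintype_card_le_finrank
  rw [Fintype.card_option, Fintype.card_fin] at this
  omega

variable {n : ℕ} {ζ μ : Omg p}

lemma isIntegral (x : Omg p) : IsIntegral (Kzero p) x := Algebra.IsIntegral.isIntegral x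

lemma finrank_adjoin_le (hζ : IsPrimitiveRoot ζ p) (hμ : μ ^ (p ^ n + 1) = ζ - 1) :
    Module.finrank (Kzero p) (IntermediateField.adjoin (Kzero p) {μ}) ≤ (p - 1) * (p ^ n + 1) := by
  have hp : p.Prime := Fact.out
  set g : Polynomial (Kzero p) := (cyclotomic p (Kzero p)).comp (X ^ (p ^ n + 1) + C 1) with hg
  have hdeg : g.natDegree = (p - 1) * (p ^ n + 1) := by
    rw [hg, natDegree_comp, natDegree_cyclotomic, Nat.totient_prime hp, natDegree_X_pow_add_C]
  have hg0 : g ≠ 0 := by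
    intro h
    rw [h, natDegree_zero] at hdeg
    exact (Nat.mul_pos (Nat.sub_pos_of_lt hp.one_lt) (Nat.succ_pos _)).ne hdeg
  have hroot : aeval μ g = 0 := by
    rw [hg, aeval_comp, _root_.map_add, map_pow, aeval_X, aeval_C, map_one, hμ, sub_add_cancel,
      ← eval_map_algebraMap, map_cyclotomic]
    exact hζ.isRoot_cyclotomic hp.pos
  rw [IntermediateField.adjoin.finrank (isIntegral μ), ← hdeg]
  exact natDegree_le_of_dvd (minpoly.dvd _ _ hroot) hg0

variable {c : IntermediateField.adjoin (Kzero p) {μ}}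

lemma mul_w_eq_one (hζ : IsPrimitiveRoot ζ p) (hμ : μ ^ (p ^ n + 1) = ζ - 1) :
    (((p - 1) * (p ^ n + 1) : ℕ) : ℚ) * v.w μ = 1 := by
  have hp : p.Prime := Fact.out
  obtain ⟨h1, h2, -⟩ := primitiveRoot_sub_one (v := v.toRatVal) hp
    (Nat.cast_ne_zero.2 hp.ne_zero) (by rw [v.w_p]; exact one_pos) hζ
  have hμ0 : μ ≠ 0 := by
    rintro rfl
    rw [zero_pow (Nat.succ_ne_zero _)] at hμ
    exact h1 hμ.symm
  rw [← hμ, w_pow _ hμ0, v.w_p] at h2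
  rw [Nat.cast_mul, Nat.cast_sub hp.one_le, Nat.cast_one, mul_assoc, h2]

/-- The setting of the theorem, with the valuation normalized on `K₀(μ)`. -/
def monodromySetting (hn : 1 ≤ n) (hζ : IsPrimitiveRoot ζ p) (hμ : μ ^ (p ^ n + 1) = ζ - 1)
    (hc0 : (c : Omg p) ≠ 0) (hc_nonneg : 0 ≤ v.w (c : Omg p))
    (hcp : (c : Omg p) ^ p - (c : Omg p) = 0 ∨ 1 ≤ v.w ((c : Omg p) ^ p - (c : Omg p)))
    (hc_lt : v.w (c : Omg p) < (p : ℚ) / (((p : ℚ) ^ n + 1) * ((p : ℚ) - 1))) :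
    MonodromySetting (IntermediateField.adjoin (Kzero p) {μ}) (Omg p) p n :=
  have hp : p.Prime := Fact.out
  have hp1 : (0 : ℚ) < p - 1 := sub_pos.2 (by exact_mod_cast hp.one_lt)
  have he : 0 < ((p : ℚ) - 1) * ((p : ℚ) ^ n + 1) := by positivity
  have hcast : (((p - 1) * (p ^ n + 1) : ℕ) : ℚ) = ((p : ℚ) - 1) * ((p : ℚ) ^ n + 1) := by
    rw [Nat.cast_mul, Nat.cast_sub hp.one_le]
    push_cast
    rfl
  have hμ1 := v.mul_w_eq_one hζ hμ
  { v := v.toRatVal.scale he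
    hp := hp
    hn := hn
    p_ne := Nat.cast_ne_zero.2 hp.ne_zero
    w_p := by rw [scale_w, v.w_p, mul_one]
    w_map := fun σ x => by
      rw [scale_w, scale_w]
      exact congrArg _ (v.w_map (σ.restrictScalars (Kzero p)) x)
    inertia := fun σ x hx => (mem_scale_gt_zero he).2
      (v.inertia (σ.restrictScalars (Kzero p)) ((mem_scale_ge_zero he).1 hx))
    w_int := fun a ha => by
      have := IntermediateField.adjoin.finiteDimensional (K := Kzero p) (isIntegral μ)
      have hμ0 : IntermediateField.AdjoinSimple.gen (Kzero p) μ ≠ 0 := by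
        intro h
        have h0 : μ = 0 := congrArg Subtype.val h
        rw [h0, zero_pow (Nat.succ_ne_zero _), eq_comm, sub_eq_zero] at hμ
        exact hζ.ne_one hp.one_lt hμ
      obtain ⟨m, hm⟩ := v.exists_int_of_finrank_le (finrank_adjoin_le hζ hμ) hμ0 hμ1 ha
      rw [hcast] at hm
      exact ⟨m, hm⟩
    ζ := ζ
    hζ := hζ
    μ := IntermediateField.AdjoinSimple.gen (Kzero p) μ
    hμ := hμ
    c := c
    c_ne := by
      rintro rfl
      exact hc0 rfl
    c_nonneg := mul_nonneg he.le hc_nonneg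
    c_lt := by
      rw [lt_div_iff₀ (by positivity)] at hc_lt
      rw [scale_w]
      change _ * v.w (c : Omg p) < _
      linarith
    c_pow := by
      refine hcp.imp id fun h => ?_
      rw [scale_w, scale_w, v.w_p]
      exact mul_le_mul_of_nonneg_left h he.le }

end WittVal
/-- `M = K(y, z)` with `z^p = f_{q,c}(y)` is Galois over `K` of degree `p·q²`,
and `Gal(M/K)` is an extra-special `p`-group of order `p·q² = p^(2n+1)`: it is non-abelian and
its derived subgroup, its center and its Frattini subgroup coincide and have order `p`. -/
theorem stmt_16 (p n : ℕ) [Fact p.Prime] (hn : 1 ≤ n)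
    (v : Omg p → ℚ)
    (hv_mul : ∀ x y : Omg p, x ≠ 0 → y ≠ 0 → v (x * y) = v x + v y)
    (hv_add : ∀ x y : Omg p, x ≠ 0 → y ≠ 0 → x + y ≠ 0 → min (v x) (v y) ≤ v (x + y))
    (hv_p : v ((p : ℕ) : Omg p) = 1)
    (hv_W : ∀ x : WittVector p (AlgebraicClosure (ZMod p)), x ≠ 0 →
      0 ≤ v (algebraMap (Kzero p) (Omg p)
        (algebraMap (WittVector p (AlgebraicClosure (ZMod p))) (Kzero p) x)))
    (ζ : Omg p) (hζ : IsPrimitiveRoot ζ p)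
    (μ : Omg p) (hμ : μ ^ (p ^ n + 1) = ζ - 1)
    (c : ↥(IntermediateField.adjoin (Kzero p) {μ}))
    (hc0 : (c : Omg p) ≠ 0) (hc_nonneg : 0 ≤ v (c : Omg p))
    (hcp : (c : Omg p) ^ p - (c : Omg p) = 0 ∨ 1 ≤ v ((c : Omg p) ^ p - (c : Omg p)))
    (hc_lt : v (c : Omg p) < (p : ℚ) / (((p : ℚ) ^ n + 1) * ((p : ℚ) - 1)))
    (y : Omg p)
    (hy : Polynomial.aeval y (Lpoly ↥(IntermediateField.adjoin (Kzero p) {μ}) p n c) = 0)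
    (z : Omg p) (hz : z ^ p = (fqc (Omg p) p n (c : Omg p)).eval y) :
    ∀ M : IntermediateField ↥(IntermediateField.adjoin (Kzero p) {μ}) (Omg p),
      M = IntermediateField.adjoin ↥(IntermediateField.adjoin (Kzero p) {μ})
        ({y, z} : Set (Omg p)) →
      IsGalois ↥(IntermediateField.adjoin (Kzero p) {μ}) ↥M ∧
      Module.finrank ↥(IntermediateField.adjoin (Kzero p) {μ}) ↥M = p * (p ^ n * p ^ n) ∧
      ∀ G : Type, ∀ _ : Group G, ∀ _e : G ≃*
          (↥M ≃ₐ[↥(IntermediateField.adjoin (Kzero p) {μ})] ↥M),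
        (∃ a b : G, a * b ≠ b * a) ∧
        commutator G = Subgroup.center G ∧
        frattini G = Subgroup.center G ∧
        Nat.card (Subgroup.center G) = p := by
  rintro M hM
  set w : WittVal p := ⟨⟨v, hv_mul, hv_add⟩, hv_p, hv_W⟩
  set S := w.monodromySetting hn hζ hμ hc0 hc_nonneg hcp hc_lt
  have : IsGalois ↥(IntermediateField.adjoin (Kzero p) {μ}) (Omg p) :=
    have : IsAlgClosure ↥(IntermediateField.adjoin (Kzero p) {μ}) (Omg p) :=
      ⟨inferInstance, Algebra.IsAlgebraic.tower_top (K := Kzero p) _⟩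
    have : Normal ↥(IntermediateField.adjoin (Kzero p) {μ}) (Omg p) := IsAlgClosure.normal _ _
    { }
  have hy' : S.IsRt y := S.isRt_iff.2 hy
  have hz' : z ^ p = S.f y := by
    rw [hz]
    simp only [fqc, eval_add, eval_one, eval_mul, eval_C, eval_pow, eval_X]
    rfl
  exact ⟨hy'.isGalois_adjoin hz' hM, MonodromySetting.IsRt.finrank_adjoin hM hy' hz', fun G _ e =>
    MonodromySetting.IsRt.isExtraSpecial hM hy' hz' e⟩
end
end

section
/- In the polynomial ring ℤ[b₂, b₃, b₄], let f(X) = 1 + b₂X² + b₃X³ + b₄X⁴ + X⁵ ∈ ℤ[b₂,b₃,b₄][X], let s_i(Y) be its Taylor coefficients defined by f(X+Y) = Σ_{i=0}^{5} s_i(Y)X^i, and set T_f(Y) = s₁(Y)² − 4·s₀(Y)·s₂(Y), a polynomial of degree 8 in Y with leading coefficient −15. Then the discriminant disc(T_f) ∈ ℤ[b₂,b₃,b₄] (defined by disc(T_f) = (−1)^{8·7/2}·Res_Y(T_f, T_f′)/(−15), where Res_Y denotes the resultant with respect to Y and T_f′ the derivative with respect to Y) is divisible by 2^{16}, and one has the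 congruence 2^{−16}·disc(T_f) ≡ b₃^{8}·(1 + b₂b₃ + b₃²b₄)^{4} (mod 2) in ℤ[b₂,b₃,b₄]. -/
open Polynomial

noncomputable section

/-- The Taylor coefficient `s_i(Y)` of `f`, defined by `f(X + Y) = Σ_i s_i(Y)·X^i`. -/
def taylorCoeff (R : Type) [CommRing R] (f : Polynomial R) (i : ℕ) : Polynomial R :=
  ((f.map (C : R →+* Polynomial R)).comp (X + C X)).coeff i

/-- `T_f(Y) = s₁(Y)² − 4·s₀(Y)·s₂(Y)`. -/
def Tf (R : Type) [CommRing R] (f : Polynomial R) : Polynomial R :=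
  taylorCoeff R f 1 ^ 2 - 4 * taylorCoeff R f 0 * taylorCoeff R f 2

/-- The Sylvester matrix of `f` (of degree `≤ m`) and `g` (of degree `≤ n`): an
`(m+n) × (m+n)` matrix whose first `n` rows carry the coefficients of `f` and whose last `m`
rows carry the coefficients of `g`. -/
def sylvester (R : Type) [CommRing R] (f g : Polynomial R) (m n : ℕ) :
    Matrix (Fin (n + m)) (Fin (n + m)) R :=
  Matrix.of fun i j =>
    if (i : ℕ) < n then
      (if (i : ℕ) ≤ (j : ℕ) ∧ (j : ℕ) ≤ (i : ℕ) + m then f.coeff (m + i - j) else 0)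
    else
      (if (i : ℕ) - n ≤ (j : ℕ) ∧ (j : ℕ) ≤ ((i : ℕ) - n) + n then
        g.coeff (n + ((i : ℕ) - n) - j) else 0)

/-- The resultant of `f` (of degree `≤ m`) and `g` (of degree `≤ n`), as the determinant of the
Sylvester matrix. -/
def resultant (R : Type) [CommRing R] (f g : Polynomial R) (m n : ℕ) : R :=
  (sylvester R f g m n).det

/-- The generic quintic `f = 1 + b₂X² + b₃X³ + b₄X⁴ + X⁵` over `ℤ[b₂,b₃,b₄]`, with
`b₂, b₃, b₄` the variables `X 0, X 1, X 2` of `MvPolynomial (Fin 3) ℤ`. -/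
def fgen : Polynomial (MvPolynomial (Fin 3) ℤ) :=
  1 + C (MvPolynomial.X 0) * X ^ 2 + C (MvPolynomial.X 1) * X ^ 3 +
    C (MvPolynomial.X 2) * X ^ 4 + X ^ 5

/-- The Sylvester determinant for degrees `8` and `7` agrees with Mathlib's resultant. -/
lemma resultant_eq_polynomial_resultant (R : Type) [CommRing R] (f g : R[X]) :
    _root_.resultant R f g 8 7 = Polynomial.resultant f g 8 7 := by
  let τ : Equiv.Perm (Fin (7 + 8)) :=
    finSumFinEquiv.symm.trans ((Equiv.sumCongr Fin.revPerm Fin.revPerm).trans finSumFinEquiv)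
  have hM : _root_.sylvester R f g 8 7 =
      ((Polynomial.sylvester g f 7 8).transpose.submatrix τ id).submatrix id
        (Fin.revPerm : Equiv.Perm (Fin (7 + 8))) := by
    ext i j
    induction i using Fin.addCases with
    | left i =>
      have h1 : τ (Fin.castAdd 8 i) = Fin.castAdd 8 i.rev := by
        simp only [τ, Equiv.trans_apply, Equiv.sumCongr_apply, finSumFinEquiv_symm_apply_castAdd]
        exact finSumFinEquiv_apply_left _
      have hi := i.isLt
      have hj := j.isLt
      simp only [_root_.sylvester, Polynomial.sylvester, Matrix.submatrix_apply,
        Matrix.transpose_apply, Matrix.of_apply, id, h1, Fin.addCases_left, Set.mem_Icc,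
        Fin.revPerm_apply, Fin.val_rev, Fin.val_castAdd, hi, if_true]
      split_ifs
      · congr 1; omega
      · omega
      · omega
      · rfl
    | right i =>
      have h1 : τ (Fin.natAdd 7 i) = Fin.natAdd 7 i.rev := by
        simp only [τ, Equiv.trans_apply, Equiv.sumCongr_apply, finSumFinEquiv_symm_apply_natAdd]
        exact finSumFinEquiv_apply_right _
      have hi := i.isLt
      have hj := j.isLt
      have h7 : ¬ (7 + (i : ℕ) < 7) := by omega
      simp only [_root_.sylvester, Polynomial.sylvester, Matrix.submatrix_apply,
        Matrix.transpose_apply, Matrix.of_apply, id, h1, Fin.addCases_right, Set.mem_Icc,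
        Fin.revPerm_apply, Fin.val_rev, Fin.val_natAdd, h7, if_false]
      split_ifs
      · congr 1; omega
      · omega
      · omega
      · rfl
  have hs : Equiv.Perm.sign τ * Equiv.Perm.sign (Fin.revPerm : Equiv.Perm (Fin (7 + 8))) = 1 := by
    decide +kernel
  have hs' : ((Equiv.Perm.sign τ : ℤ) : R) *
      ((Equiv.Perm.sign (Fin.revPerm : Equiv.Perm (Fin (7 + 8))) : ℤ) : R) = 1 := by
    rw [← Int.cast_mul, ← Units.val_mul, hs]; simp
  rw [_root_.resultant, hM, Matrix.det_permute', Matrix.det_permute, Matrix.det_transpose,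
    ← mul_assoc, mul_comm ((_ : ℤ) : R), hs', one_mul, Polynomial.resultant_comm,
    Polynomial.resultant]
  norm_num

section Generic

variable {R : Type} [CommRing R]

/-- The quintic `1 + bX² + cX³ + dX⁴ + X⁵`. -/
def quintic (b c d : R) : R[X] := 1 + C b * X ^ 2 + C c * X ^ 3 + C d * X ^ 4 + X ^ 5

/-- Half of the second derivative of `quintic b c d`. -/
def quinticHalfSecondDeriv (b c d : R) : R[X] :=
  10 * X ^ 3 + 6 * C d * X ^ 2 + 3 * C c * X + C b

/-- One third of the derivative of `quinticHalfSecondDeriv b c d`. -/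
def quinticQuadratic (c d : R) : R[X] := 10 * X ^ 2 + 4 * C d * X + C c

lemma derivative_quintic (b c d : R) :
    derivative (quintic b c d) =
      5 * X ^ 4 + 4 * C d * X ^ 3 + 3 * C c * X ^ 2 + 2 * C b * X := by
  simp [quintic, map_ofNat]
  ring

lemma quintic_comp_expansion (b c d : R) :
    ((quintic b c d).map (C : R →+* R[X])).comp (X + C X) =
      C (quintic b c d) + C (derivative (quintic b c d)) * X +
        C (quinticHalfSecondDeriv b c d) * X ^ 2 +
        C (10 * X ^ 2 + 4 * C d * X + C c) * X ^ 3 + C (5 * X + C d) * X ^ 4 + X ^ 5 := by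
  rw [derivative_quintic]
  simp [quintic, quinticHalfSecondDeriv, map_ofNat]
  ring

lemma Tf_quintic (b c d : R) :
    Tf R (quintic b c d) = derivative (quintic b c d) ^ 2 -
      4 * quintic b c d * quinticHalfSecondDeriv b c d := by
  simp only [Tf, taylorCoeff, quintic_comp_expansion]
  simp only [coeff_add, coeff_C_mul, coeff_X_pow, coeff_C, coeff_X]
  norm_num

lemma Tf_quintic_expanded (b c d : R) :
    Tf R (quintic b c d) = C (-15) * X ^ 8 + C (-24 * d) * X ^ 7 +
      C (-8 * d ^ 2 - 22 * c) * X ^ 6 + C (-24 * b - 12 * c * d) * X ^ 5 +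
      C (-3 * c ^ 2 - 12 * b * d) * X ^ 4 + C (-4 * b * c - 40) * X ^ 3 +
      C (-24 * d) * X ^ 2 + C (-12 * c) * X + C (-4 * b) := by
  rw [Tf_quintic, derivative_quintic, quintic, quinticHalfSecondDeriv]
  simp [map_ofNat]
  ring

lemma natDegree_Tf_quintic_le (b c d : R) : (Tf R (quintic b c d)).natDegree ≤ 8 := by
  rw [Tf_quintic_expanded]
  compute_degree

lemma coeff_Tf_quintic (b c d : R) : (Tf R (quintic b c d)).coeff 8 = -15 := by
  rw [Tf_quintic_expanded]
  simp [-map_mul, -map_neg, -map_sub]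

lemma derivative_Tf_quintic (b c d : R) :
    derivative (Tf R (quintic b c d)) = C (-12) * (quintic b c d * quinticQuadratic c d) := by
  rw [Tf_quintic, derivative_quintic, quintic, quinticHalfSecondDeriv, quinticQuadratic]
  simp [derivative_pow, map_ofNat]
  ring

lemma natDegree_quintic [Nontrivial R] (b c d : R) : (quintic b c d).natDegree = 5 := by
  rw [quintic]
  compute_degree!

lemma map_quintic {S : Type} [CommRing S] (φ : R →+* S) (b c d : R) :
    (quintic b c d).map φ = quintic (φ b) (φ c) (φ d) := by
  simp [quintic]

lemma map_quinticQuadratic {S : Type} [CommRing S] (φ : R →+* S) (c d : R) :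
    (quinticQuadratic c d).map φ = quinticQuadratic (φ c) (φ d) := by
  simp [quinticQuadratic]

lemma map_Tf_quintic {S : Type} [CommRing S] (φ : R →+* S) (b c d : R) :
    (Tf R (quintic b c d)).map φ = Tf S (quintic (φ b) (φ c) (φ d)) := by
  simp [Tf_quintic_expanded, map_ofNat]

lemma resultant_Tf_quintic_quintic [CharZero R] (b c d : R) :
    Polynomial.resultant (Tf R (quintic b c d)) (quintic b c d) 8 5 =
      Polynomial.resultant (derivative (quintic b c d)) (quintic b c d) 4 5 ^ 2 := by
  have h5 : (5 : R) ≠ 0 := by norm_num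
  have hn : Nontrivial R := ⟨5, 0, h5⟩
  have hd : (derivative (quintic b c d)).natDegree = 4 := by
    rw [derivative_quintic]
    compute_degree!
  have hT : Tf R (quintic b c d) = derivative (quintic b c d) * derivative (quintic b c d) +
      quintic b c d * (C (-4) * quinticHalfSecondDeriv b c d) := by
    rw [Tf_quintic]
    simp [map_ofNat]
    ring
  have hh : (C (-4) * quinticHalfSecondDeriv b c d).natDegree ≤ 3 := by
    rw [quinticHalfSecondDeriv]
    compute_degree
  rw [hT, Polynomial.resultant_add_mul_left _ _ _ _ _ (by omega) (natDegree_quintic b c d).le]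
  have := Polynomial.resultant_mul_left (derivative (quintic b c d)) (derivative (quintic b c d))
    (quintic b c d) 5 (natDegree_quintic b c d).le
  rw [hd] at this
  rw [this, sq]

lemma resultant_Tf_quintic_derivative [CharZero R] (b c d : R) :
    Polynomial.resultant (Tf R (quintic b c d)) (derivative (Tf R (quintic b c d))) 8 7 =
      12 ^ 8 * Polynomial.resultant (derivative (quintic b c d)) (quintic b c d) 4 5 ^ 2 *
        Polynomial.resultant (Tf R (quintic b c d)) (quinticQuadratic c d) 8 2 := by
  have h10 : (10 : R) ≠ 0 := by norm_num
  have hn : Nontrivial R := ⟨10, 0, h10⟩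
  have hq : (quinticQuadratic c d).natDegree = 2 := by
    rw [quinticQuadratic]
    compute_degree!
  have := Polynomial.resultant_mul_right (Tf R (quintic b c d)) (quintic b c d)
    (quinticQuadratic c d) 8 (natDegree_Tf_quintic_le b c d)
  rw [natDegree_quintic, hq, resultant_Tf_quintic_quintic] at this
  rw [derivative_Tf_quintic, Polynomial.resultant_C_mul_right, this]
  ring

lemma resultant_Tf_quintic_quadratic_of_five_eq_zero (h5 : (5 : R) = 0) (b c d : R) :
    Polynomial.resultant (Tf R (quintic b c d)) (quinticQuadratic c d) 8 2 = 0 := by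
  apply Polynomial.resultant_eq_zero_of_lt_lt
  · have h15 : (-15 : R) = 0 := by linear_combination -3 * h5
    rw [Tf_quintic_expanded, h15, C_0, zero_mul, zero_add]
    refine Nat.lt_of_le_of_lt (m := 7) ?_ (by norm_num)
    compute_degree
  · have h10 : (10 : R[X]) = 0 := by
      have : (C (5 : R)) = 0 := by rw [h5, C_0]
      rw [map_ofNat] at this
      linear_combination 2 * this
    rw [quinticQuadratic, h10, zero_mul, zero_add]
    refine Nat.lt_of_le_of_lt (m := 1) ?_ (by norm_num)
    compute_degree

lemma resultant_Tf_quintic_quadratic_of_two_eq_zero (h2 : (2 : R) = 0) (b c d : R) :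
    Polynomial.resultant (Tf R (quintic b c d)) (quinticQuadratic c d) 8 2 = c ^ 8 := by
  have h2' : (2 : R[X]) = 0 := by
    have : (C (2 : R)) = 0 := by rw [h2, C_0]
    rwa [map_ofNat] at this
  have hq : quinticQuadratic c d = C c := by
    rw [quinticQuadratic]
    linear_combination (5 * X ^ 2 + 2 * C d * X) * h2'
  rw [hq, Polynomial.resultant_C_right, coeff_Tf_quintic]
  linear_combination 112 * c ^ 8 * h2

lemma resultant_derivative_quintic_of_two_eq_zero [Nontrivial R] (h2 : (2 : R) = 0) (b c d : R) :
    Polynomial.resultant (derivative (quintic b c d)) (quintic b c d) 4 5 =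
      (1 + b * c + c ^ 2 * d) ^ 2 := by
  have h2' : (2 : R[X]) = 0 := by
    have : (C (2 : R)) = 0 := by rw [h2, C_0]
    rwa [map_ofNat] at this
  have hd : derivative (quintic b c d) = X ^ 2 * (X ^ 2 + C c) := by
    rw [derivative_quintic]
    linear_combination (2 * X ^ 4 + 2 * C d * X ^ 3 + C c * X ^ 2 + C b * X) * h2'
  have hc : (X ^ 2 + C c).natDegree = 2 := by compute_degree!
  have hf : quintic b c d = C (1 + b * c + c ^ 2 * d) +
      (X ^ 2 + C c) * (C b + C c * X + (C d + X) * (X ^ 2 + C c)) := by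
    rw [quintic]
    simp
    linear_combination (-(C b * C c) - C c ^ 2 * C d - C c ^ 2 * X - C c * X ^ 3
      - C c * C d * X ^ 2) * h2'
  have hp : (C b + C c * X + (C d + X) * (X ^ 2 + C c)).natDegree ≤ 3 := by compute_degree
  have hm := Polynomial.resultant_mul_left (X ^ 2) (X ^ 2 + C c) (quintic b c d) 5
    (natDegree_quintic b c d).le
  rw [hc, natDegree_X_pow,
    Polynomial.resultant_X_pow_left _ _ _ (natDegree_quintic b c d).le] at hm
  have h0 : (quintic b c d).eval 0 = 1 := by simp [quintic]
  have h1 : Polynomial.resultant (X ^ 2 + C c) (quintic b c d) 2 5 =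
      (1 + b * c + c ^ 2 * d) ^ 2 := by
    rw [hf, Polynomial.resultant_add_mul_right _ _ _ _ _ (by omega) hc.le,
      Polynomial.resultant_C_right]
    simp
  rw [hd, hm, h1]
  simp [coeff_zero_eq_eval_zero, h0]

end Generic

lemma fgen_eq_quintic :
    fgen = quintic (MvPolynomial.X 0) (MvPolynomial.X 1) (MvPolynomial.X 2) := rfl

/-- `T_f ∈ ℤ[b₂,b₃,b₄][Y]` has degree `8` and leading coefficient `−15`; its
discriminant `D`, defined by `(−15)·D = (−1)^(8·7/2)·Res_Y(T_f, T_f′)`, is divisible by `2^16`,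
and `2^(−16)·D ≡ b₃⁸·(1 + b₂b₃ + b₃²b₄)⁴ (mod 2)`. -/
theorem stmt_18 :
    (Tf (MvPolynomial (Fin 3) ℤ) fgen).natDegree = 8 ∧
    (Tf (MvPolynomial (Fin 3) ℤ) fgen).leadingCoeff = -15 ∧
    ∃ D E : MvPolynomial (Fin 3) ℤ,
      (-15 : MvPolynomial (Fin 3) ℤ) * D =
        (-1) ^ (8 * 7 / 2) *
          resultant (MvPolynomial (Fin 3) ℤ) (Tf (MvPolynomial (Fin 3) ℤ) fgen)
            (Polynomial.derivative (Tf (MvPolynomial (Fin 3) ℤ) fgen)) 8 7 ∧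
      D = 2 ^ 16 * E ∧
      MvPolynomial.map (Int.castRingHom (ZMod 2)) E =
        MvPolynomial.X 1 ^ 8 *
          (1 + MvPolynomial.X 0 * MvPolynomial.X 1 +
            MvPolynomial.X 1 ^ 2 * MvPolynomial.X 2) ^ 4 := by
  have h15 : (-15 : MvPolynomial (Fin 3) ℤ) ≠ 0 := by norm_num
  have hdeg : (Tf (MvPolynomial (Fin 3) ℤ) fgen).natDegree = 8 :=
    natDegree_eq_of_le_of_coeff_ne_zero (natDegree_Tf_quintic_le _ _ _)
      (by rw [fgen_eq_quintic, coeff_Tf_quintic]; exact h15)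
  refine ⟨hdeg, ?_, ?_⟩
  · rw [leadingCoeff, hdeg, fgen_eq_quintic, coeff_Tf_quintic]
  rw [resultant_eq_polynomial_resultant, fgen_eq_quintic, resultant_Tf_quintic_derivative]
  set r := Polynomial.resultant (derivative (quintic (MvPolynomial.X 0 : MvPolynomial (Fin 3) ℤ)
    (MvPolynomial.X 1) (MvPolynomial.X 2))) (quintic (MvPolynomial.X 0) (MvPolynomial.X 1)
    (MvPolynomial.X 2)) 4 5 with hr
  obtain ⟨s, hs⟩ : (5 : MvPolynomial (Fin 3) ℤ) ∣ Polynomial.resultant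
      (Tf _ (quintic (MvPolynomial.X 0) (MvPolynomial.X 1) (MvPolynomial.X 2)))
      (quinticQuadratic (MvPolynomial.X 1) (MvPolynomial.X 2)) 8 2 := by
    have h := MvPolynomial.C_dvd_iff_zmod 5 (Polynomial.resultant
      (Tf (MvPolynomial (Fin 3) ℤ)
        (quintic (MvPolynomial.X 0) (MvPolynomial.X 1) (MvPolynomial.X 2)))
      (quinticQuadratic (MvPolynomial.X 1) (MvPolynomial.X 2)) 8 2)
    have h5 : (5 : MvPolynomial (Fin 3) (ZMod 5)) = 0 := by
      exact_mod_cast CharP.cast_eq_zero (MvPolynomial (Fin 3) (ZMod 5)) 5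
    rw [Nat.cast_ofNat, map_ofNat] at h
    rw [h, ← Polynomial.resultant_map_map, map_Tf_quintic, map_quinticQuadratic]
    exact resultant_Tf_quintic_quadratic_of_five_eq_zero h5 _ _ _
  refine ⟨2 ^ 16 * (-3 ^ 7 * r ^ 2 * s), -3 ^ 7 * r ^ 2 * s, ?_, rfl, ?_⟩
  · rw [hs]
    norm_num
    ring
  · have h2 : (2 : MvPolynomial (Fin 3) (ZMod 2)) = 0 := by
      exact_mod_cast CharP.cast_eq_zero (MvPolynomial (Fin 3) (ZMod 2)) 2
    have hr2 : MvPolynomial.map (Int.castRingHom (ZMod 2)) r =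
        (1 + MvPolynomial.X 0 * MvPolynomial.X 1 +
          MvPolynomial.X 1 ^ 2 * MvPolynomial.X 2) ^ 2 := by
      rw [hr, ← Polynomial.resultant_map_map, ← derivative_map, map_quintic,
        resultant_derivative_quintic_of_two_eq_zero h2]
      simp only [MvPolynomial.map_X]
    have hs2 := congrArg (MvPolynomial.map (Int.castRingHom (ZMod 2))) hs
    rw [← Polynomial.resultant_map_map, map_Tf_quintic, map_quinticQuadratic,
      resultant_Tf_quintic_quadratic_of_two_eq_zero h2] at hs2
    simp only [MvPolynomial.map_X, map_mul, map_ofNat] at hs2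
    simp only [map_mul, map_neg, map_pow, map_ofNat, hr2]
    set t := MvPolynomial.map (Int.castRingHom (ZMod 2)) s
    linear_combination (-1096) * (1 + MvPolynomial.X 0 * MvPolynomial.X 1 +
      MvPolynomial.X 1 ^ 2 * MvPolynomial.X 2) ^ 4 * t * h2 -
      (1 + MvPolynomial.X 0 * MvPolynomial.X 1 +
        MvPolynomial.X 1 ^ 2 * MvPolynomial.X 2) ^ 4 * hs2
end
end

section
/- Fix a ∈ ℚ₂^alg with a⁹ = 2, let f(X) = 1 + a³X² + a⁶X³ + X⁵, let s_i(Y) be its Taylor coefficients defined by f(X+Y) = Σ_{i=0}^{5} s_i(Y)X^i, and set T_f(Y) = s₁(Y)² − 4·s₀(Y)·s₂(Y), a polynomial of degree 8. Then every root y ∈ ℚ₂^alg of T_f satisfies v(y) = 7/24; moreover, for any fixed root y₁ of T_f, exactly 3 of the remaining 7 roots y satisfy v(y − y₁) = 4/9 and exactly 4 of them satisfy v(y − y₁) = 1/3. -/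
open Polynomial

noncomputable section

section Valuation

variable {K : Type*} [Field K] (w : AddValuation K (WithTop ℚ))

lemma AddValuation.natCast_nonneg (n : ℕ) : 0 ≤ w (n : K) := by
  induction n with
  | zero => simp
  | succ n ih => push_cast; exact w.map_le_add ih (by simp)

variable {w}

lemma AddValuation.coe_le_mul_pow {c z : K} {p q t : ℚ} (k : ℕ) (hc : (p : WithTop ℚ) ≤ w c)
    (hz : w z = t) (hq : q ≤ p + k * t) : (q : WithTop ℚ) ≤ w (c * z ^ k) := by
  rw [w.map_mul, w.map_pow, hz, ← WithTop.coe_nsmul]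
  refine le_trans ?_ (add_le_add_left hc _)
  rw [← WithTop.coe_add, WithTop.coe_le_coe, nsmul_eq_mul]
  exact hq

lemma AddValuation.coe_lt_mul_pow {c z : K} {p q t : ℚ} (k : ℕ) (hc : (p : WithTop ℚ) ≤ w c)
    (hz : w z = t) (hq : q < p + k * t) : (q : WithTop ℚ) < w (c * z ^ k) :=
  lt_of_lt_of_le (WithTop.coe_lt_coe.2 hq) (coe_le_mul_pow k hc hz le_rfl)

lemma AddValuation.map_mul_pow_eq {c z : K} {p t : ℚ} (k : ℕ) (hc : w c = p)
    (hz : w z = t) : w (c * z ^ k) = ((p + k * t : ℚ) : WithTop ℚ) := by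
  rw [w.map_mul, w.map_pow, hz, hc, ← WithTop.coe_nsmul, ← WithTop.coe_add, nsmul_eq_mul]

lemma AddValuation.add_ne_zero_of_lt {x r : K} {q : ℚ} (hx : w x = q)
    (hr : (q : WithTop ℚ) < w r) : x + r ≠ 0 := by
  rw [← w.ne_top_iff, w.map_add_eq_of_lt_left (hx ▸ hr), hx]
  exact WithTop.coe_ne_top

lemma AddValuation.exists_map_eq_coe {x : K} (hx : x ≠ 0) : ∃ t : ℚ, w x = t :=
  ⟨_, (WithTop.coe_untop _ (w.ne_top_iff.2 hx)).symm⟩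

lemma AddValuation.map_odd_eq_zero (h2 : w 2 = 1) (n : ℕ) :
    w ((2 * n + 1 : ℕ) : K) = ((0 : ℚ) : WithTop ℚ) := by
  have h : w (1 : K) < w ((2 * n : ℕ) : K) := by
    rw [w.map_one]
    push_cast
    rw [w.map_mul, h2]
    exact lt_of_lt_of_le (by norm_num) (le_add_of_nonneg_right (w.natCast_nonneg n))
  rw [Nat.cast_add, Nat.cast_one, w.map_add_eq_of_lt_right h, w.map_one, WithTop.coe_zero]

lemma AddValuation.map_cbrt_two (h2 : w 2 = 1) {b : K} (hb : b ^ 3 = 2) :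
    w b = ((1 / 3 : ℚ) : WithTop ℚ) := by
  have hb0 : b ≠ 0 := by
    rintro rfl
    rw [← hb] at h2
    simp at h2
  obtain ⟨t, ht⟩ := exists_map_eq_coe (w := w) hb0
  rw [← hb, w.map_pow, ht, ← WithTop.coe_nsmul, ← WithTop.coe_one, WithTop.coe_inj,
    nsmul_eq_mul] at h2
  rw [ht, WithTop.coe_inj]
  push_cast at h2
  linarith

lemma AddValuation.coe_le_monomial {b y : K} {t : ℚ} (hb : w b = ((1 / 3 : ℚ) : WithTop ℚ))
    (hy : w y = t) (n i j : ℕ) {q : ℚ} (hq : q ≤ i / 3 + j * t) :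
    (q : WithTop ℚ) ≤ w ((n : K) * b ^ i * y ^ j) :=
  coe_le_mul_pow j (coe_le_mul_pow (q := i / 3) (p := 0) i (w.natCast_nonneg n) hb
    (by linarith)) hy hq

lemma AddValuation.coe_lt_monomial {b y : K} {t : ℚ} (hb : w b = ((1 / 3 : ℚ) : WithTop ℚ))
    (hy : w y = t) (n i j : ℕ) {q : ℚ} (hq : q < i / 3 + j * t) :
    (q : WithTop ℚ) < w ((n : K) * b ^ i * y ^ j) :=
  lt_of_lt_of_le (WithTop.coe_lt_coe.2 hq) (coe_le_monomial hb hy n i j le_rfl)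

lemma AddValuation.map_odd_monomial (h2 : w 2 = 1) {b y : K} {t : ℚ}
    (hb : w b = ((1 / 3 : ℚ) : WithTop ℚ)) (hy : w y = t) (n i j : ℕ) :
    w (((2 * n + 1 : ℕ) : K) * b ^ i * y ^ j) = ((i / 3 + j * t : ℚ) : WithTop ℚ) := by
  rw [map_mul_pow_eq j (map_mul_pow_eq i (map_odd_eq_zero h2 n) hb) hy]
  congr 1
  ring

end Valuation

section NegTf

variable {K : Type*} [Field K] {w : AddValuation K (WithTop ℚ)} {b y z : K}

/-- The polynomial `-T_f` for `f = 1 + bX² + b²X³ + X⁵` with `b³ = 2`, every even integer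
coefficient being written as an odd multiple of a power of `b`. -/
def negTf (b y : K) : K :=
  15 * y ^ 8 + 11 * b ^ 5 * y ^ 6 + 3 * b ^ 10 * y ^ 5 + 3 * b ^ 4 * y ^ 4 + 3 * b ^ 12 * y ^ 3
    + 3 * b ^ 8 * y + b ^ 7

/-- The derivative of `negTf b`. -/
def negTfDeriv (b y : K) : K :=
  15 * b ^ 9 * y ^ 7 + 33 * b ^ 8 * y ^ 5 + 15 * b ^ 10 * y ^ 4 + 3 * b ^ 10 * y ^ 3
    + 9 * b ^ 12 * y ^ 2 + 3 * b ^ 8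

open AddValuation

lemma map_root_negTf (h2 : w 2 = 1) (hb : b ^ 3 = 2) (hy : negTf b y = 0) :
    w y = ((7 / 24 : ℚ) : WithTop ℚ) := by
  have wb := map_cbrt_two h2 hb
  have hb0 : b ≠ 0 := by
    rintro rfl
    simp at wb
  have hy0 : y ≠ 0 := by
    rintro rfl
    simp [negTf, hb0] at hy
  obtain ⟨t, ht⟩ := exists_map_eq_coe (w := w) hy0
  rcases lt_trichotomy t (7 / 24) with h | h | h
  · refine absurd ?_ (add_ne_zero_of_lt (r := ((11 : ℕ) : K) * b ^ 5 * y ^ 6 +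
      ((3 : ℕ) : K) * b ^ 10 * y ^ 5 + ((3 : ℕ) : K) * b ^ 4 * y ^ 4 +
      ((3 : ℕ) : K) * b ^ 12 * y ^ 3 + ((3 : ℕ) : K) * b ^ 8 * y ^ 1 +
      ((1 : ℕ) : K) * b ^ 7 * y ^ 0) (map_odd_monomial h2 wb ht 7 0 8) ?_)
    · linear_combination (norm := (simp only [negTf]; push_cast; ring1)) hy
    · repeat' apply AddValuation.map_lt_add
      all_goals
        apply coe_lt_monomial wb ht
        push_cast
        linarith
  · rw [ht, h]
  · refine absurd ?_ (add_ne_zero_of_lt (r := ((15 : ℕ) : K) * b ^ 0 * y ^ 8 +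
      ((11 : ℕ) : K) * b ^ 5 * y ^ 6 +
      ((3 : ℕ) : K) * b ^ 10 * y ^ 5 + ((3 : ℕ) : K) * b ^ 4 * y ^ 4 +
      ((3 : ℕ) : K) * b ^ 12 * y ^ 3 + ((3 : ℕ) : K) * b ^ 8 * y ^ 1)
      (map_odd_monomial h2 wb ht 0 7 0) ?_)
    · linear_combination (norm := (simp only [negTf]; push_cast; ring1)) hy
    · repeat' apply AddValuation.map_lt_add
      all_goals
        apply coe_lt_monomial wb ht
        push_cast
        linarith

lemma map_negTfDeriv (h2 : w 2 = 1) (hb : b ^ 3 = 2) (hy : negTf b y = 0) :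
    w (negTfDeriv b y) = ((8 / 3 : ℚ) : WithTop ℚ) := by
  have wb := map_cbrt_two h2 hb
  have wy := map_root_negTf h2 hb hy
  have key : negTfDeriv b y = ((2 * 1 + 1 : ℕ) : K) * b ^ 8 * y ^ 0 +
      (((15 : ℕ) : K) * b ^ 9 * y ^ 7 + ((33 : ℕ) : K) * b ^ 8 * y ^ 5 +
      ((15 : ℕ) : K) * b ^ 10 * y ^ 4 + ((3 : ℕ) : K) * b ^ 10 * y ^ 3 +
      ((9 : ℕ) : K) * b ^ 12 * y ^ 2) := by
    simp only [negTfDeriv]; push_cast; ring1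
  have lead := map_odd_monomial h2 wb wy 1 8 0
  rw [key, map_add_eq_of_lt_left, lead]
  · congr 1; norm_num
  · rw [lead]
    repeat' apply AddValuation.map_lt_add
    all_goals
      apply coe_lt_monomial wb wy
      norm_num

lemma map_root_sub_root_negTf (h2 : w 2 = 1) (hb : b ^ 3 = 2) (hy : negTf b y = 0)
    (hz : negTf b z = 0) (hne : z ≠ y) :
    w (z - y) = ((4 / 9 : ℚ) : WithTop ℚ) ∨ w (z - y) = ((1 / 3 : ℚ) : WithTop ℚ) := by
  have wb := map_cbrt_two h2 hb
  have wy := map_root_negTf h2 hb hy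
  have hd0 : z - y ≠ 0 := sub_ne_zero.2 hne
  obtain ⟨t, ht⟩ := exists_map_eq_coe (w := w) hd0
  obtain ⟨d, rfl⟩ : ∃ d, z = y + d := ⟨z - y, by ring⟩
  rw [add_sub_cancel_left] at hd0 ht ⊢
  set c₁ := negTfDeriv b y
  have w₁ : w c₁ = ((8 / 3 : ℚ) : WithTop ℚ) := map_negTfDeriv h2 hb hy
  obtain ⟨c₂, hc₂⟩ : ∃ c, c = ((105 : ℕ) : K) * b ^ 6 * y ^ 6 + ((165 : ℕ) : K) * b ^ 5 * y ^ 4 +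
    ((15 : ℕ) : K) * b ^ 13 * y ^ 3 + ((9 : ℕ) : K) * b ^ 7 * y ^ 2 +
    ((9 : ℕ) : K) * b ^ 12 * y ^ 1 := ⟨_, rfl⟩
  obtain ⟨c₃, hc₃⟩ : ∃ c, c = ((105 : ℕ) : K) * b ^ 9 * y ^ 5 + ((55 : ℕ) : K) * b ^ 11 * y ^ 3 +
    ((15 : ℕ) : K) * b ^ 13 * y ^ 2 + ((3 : ℕ) : K) * b ^ 10 * y ^ 1 +
    ((3 : ℕ) : K) * b ^ 12 * y ^ 0 := ⟨_, rfl⟩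
  obtain ⟨c₄, hc₄⟩ : ∃ c, c = ((2 * 1 + 1 : ℕ) : K) * b ^ 4 * y ^ 0 +
    (((525 : ℕ) : K) * b ^ 3 * y ^ 4 + ((165 : ℕ) : K) * b ^ 5 * y ^ 2 +
    ((15 : ℕ) : K) * b ^ 10 * y ^ 1) := ⟨_, rfl⟩
  obtain ⟨c₅, hc₅⟩ : ∃ c, c = ((105 : ℕ) : K) * b ^ 9 * y ^ 3 + ((33 : ℕ) : K) * b ^ 8 * y ^ 1 +
    ((3 : ℕ) : K) * b ^ 10 * y ^ 0 := ⟨_, rfl⟩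
  obtain ⟨c₆, hc₆⟩ : ∃ c, c = ((105 : ℕ) : K) * b ^ 6 * y ^ 2 + ((11 : ℕ) : K) * b ^ 5 * y ^ 0 :=
    ⟨_, rfl⟩
  obtain ⟨c₇, hc₇⟩ : ∃ c, c = ((15 : ℕ) : K) * b ^ 9 * y ^ 1 := ⟨_, rfl⟩
  obtain ⟨c₈, hc₈⟩ : ∃ c, c = ((2 * 7 + 1 : ℕ) : K) := ⟨_, rfl⟩
  have w₂ : ((8 / 3 : ℚ) : WithTop ℚ) ≤ w c₂ := by
    rw [hc₂]
    repeat' apply AddValuation.map_le_add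
    all_goals
      apply coe_le_monomial wb wy
      norm_num
  have w₃ : ((3 : ℚ) : WithTop ℚ) ≤ w c₃ := by
    rw [hc₃]
    repeat' apply AddValuation.map_le_add
    all_goals
      apply coe_le_monomial wb wy
      norm_num
  have w₄ : w c₄ = ((4 / 3 : ℚ) : WithTop ℚ) := by
    have lead := map_odd_monomial h2 wb wy 1 4 0
    rw [hc₄, map_add_eq_of_lt_left, lead]
    · congr 1; norm_num
    · rw [lead]
      repeat' apply AddValuation.map_lt_add
      all_goals
        apply coe_lt_monomial wb wy
        norm_num
  have w₅ : ((2 : ℚ) : WithTop ℚ) ≤ w c₅ := by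
    rw [hc₅]
    repeat' apply AddValuation.map_le_add
    all_goals
      apply coe_le_monomial wb wy
      norm_num
  have w₆ : ((1 : ℚ) : WithTop ℚ) ≤ w c₆ := by
    rw [hc₆]
    repeat' apply AddValuation.map_le_add
    all_goals
      apply coe_le_monomial wb wy
      norm_num
  have w₇ : ((3 : ℚ) : WithTop ℚ) ≤ w c₇ := by
    rw [hc₇]
    apply coe_le_monomial wb wy
    norm_num
  have w₈ : w c₈ = ((0 : ℚ) : WithTop ℚ) := hc₈ ▸ map_odd_eq_zero h2 7
  have eq : c₁ * d ^ 0 + c₂ * d ^ 1 + c₃ * d ^ 2 + c₄ * d ^ 3 + c₅ * d ^ 4 + c₆ * d ^ 5 +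
      c₇ * d ^ 6 + c₈ * d ^ 7 = 0 := by
    apply mul_left_cancel₀ hd0
    rw [hc₂, hc₃, hc₄, hc₅, hc₆, hc₇, hc₈]
    have expand : negTf b (y + d) - negTf b y = 0 := by rw [hz, hy, sub_zero]
    simp only [c₁, negTf, negTfDeriv] at expand ⊢
    push_cast
    have e6 : b ^ 6 = 4 := by linear_combination (b ^ 3 + 2) * hb
    have e9 : b ^ 9 = 8 := by linear_combination (b ^ 6 + 2 * b ^ 3 + 4) * hb
    have e7 : b ^ 7 = 4 * b := by linear_combination b * e6
    have e8 : b ^ 8 = 4 * b ^ 2 := by linear_combination b ^ 2 * e6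
    have e10 : b ^ 10 = 8 * b := by linear_combination b * e9
    have e11 : b ^ 11 = 8 * b ^ 2 := by linear_combination b ^ 2 * e9
    have e12 : b ^ 12 = 16 := by linear_combination b ^ 3 * e9 + 8 * hb
    have e13 : b ^ 13 = 16 * b := by linear_combination b * e12
    have e4 : b ^ 4 = 2 * b := by linear_combination b * hb
    have e5 : b ^ 5 = 2 * b ^ 2 := by linear_combination b ^ 2 * hb
    simp only [hb, e4, e5, e6, e7, e8, e9, e10, e11, e12, e13] at expand ⊢
    linear_combination expand
  rcases lt_trichotomy t (4 / 9) with h | h | h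
  · rcases lt_trichotomy t (1 / 3) with h₃ | h₃ | h₃
    · refine absurd ?_ (add_ne_zero_of_lt (r := c₁ * d ^ 0 + c₂ * d ^ 1 + c₃ * d ^ 2 +
        c₄ * d ^ 3 + c₅ * d ^ 4 + c₆ * d ^ 5 + c₇ * d ^ 6) (map_mul_pow_eq 7 w₈ ht) ?_)
      · linear_combination eq
      · repeat' apply AddValuation.map_lt_add
        all_goals
          refine coe_lt_mul_pow _ (by first | assumption | exact w₁.ge | exact w₄.ge) ht ?_
          push_cast
          linarith
    · exact Or.inr (h₃ ▸ ht)
    · refine absurd ?_ (add_ne_zero_of_lt (r := c₁ * d ^ 0 + c₂ * d ^ 1 + c₃ * d ^ 2 +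
        c₅ * d ^ 4 + c₆ * d ^ 5 + c₇ * d ^ 6 + c₈ * d ^ 7) (map_mul_pow_eq 3 w₄ ht) ?_)
      · linear_combination eq
      · repeat' apply AddValuation.map_lt_add
        all_goals
          refine coe_lt_mul_pow _ (by first | assumption | exact w₁.ge | exact w₈.ge) ht ?_
          push_cast
          linarith
  · exact Or.inl (h ▸ ht)
  · refine absurd ?_ (add_ne_zero_of_lt (r := c₂ * d ^ 1 + c₃ * d ^ 2 +
      c₄ * d ^ 3 + c₅ * d ^ 4 + c₆ * d ^ 5 + c₇ * d ^ 6 + c₈ * d ^ 7)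
      (map_mul_pow_eq 0 w₁ ht) ?_)
    · linear_combination eq
    · repeat' apply AddValuation.map_lt_add
      all_goals
        refine coe_lt_mul_pow _ (by first | assumption | exact w₄.ge | exact w₈.ge) ht ?_
        push_cast
        linarith

end NegTf

lemma taylorCoeff_eq_of_comp_eq {R : Type} [CommRing R] {f s₀ s₁ s₂ : R[X]} {g : R[X][X]}
    (h : (f.map (C : R →+* R[X])).comp (X + C X) = C s₀ + C s₁ * X + C s₂ * X ^ 2 + g * X ^ 3) :
    taylorCoeff R f 0 = s₀ ∧ taylorCoeff R f 1 = s₁ ∧ taylorCoeff R f 2 = s₂ := by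
  refine ⟨?_, ?_, ?_⟩ <;> rw [taylorCoeff, h] <;>
    simp [coeff_X, coeff_C, coeff_mul_X_pow', coeff_X_pow]

lemma Tf_eq {R : Type} [CommRing R] {b : R} (hb : b ^ 3 = 2) :
    Tf R (1 + C b * X ^ 2 + C (b ^ 2) * X ^ 3 + X ^ 5) =
      -(15 * X ^ 8 + C (11 * b ^ 5) * X ^ 6 + C (3 * b ^ 10) * X ^ 5 + C (3 * b ^ 4) * X ^ 4 +
        C (3 * b ^ 12) * X ^ 3 + C (3 * b ^ 8) * X + C (b ^ 7)) := by
  have h : ((1 + C b * X ^ 2 + C (b ^ 2) * X ^ 3 + X ^ 5 : R[X]).map (C : R →+* R[X])).comp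
      (X + C X) = C (1 + C b * X ^ 2 + C (b ^ 2) * X ^ 3 + X ^ 5) +
      C (2 * C b * X + 3 * C (b ^ 2) * X ^ 2 + 5 * X ^ 4) * X +
      C (C b + 3 * C (b ^ 2) * X + 10 * X ^ 3) * X ^ 2 +
      (C (C (b ^ 2)) + 10 * C X ^ 2 + 5 * C X * X + X ^ 2) * X ^ 3 := by
    simp only [Polynomial.map_add, Polynomial.map_mul, Polynomial.map_pow, Polynomial.map_one,
      map_C, map_X, add_comp, mul_comp, pow_comp, one_comp, C_comp, X_comp, C_add, C_mul, C_pow,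
      C_1, C_ofNat]
    ring
  obtain ⟨h₀, h₁, h₂⟩ := taylorCoeff_eq_of_comp_eq h
  have hB : (C b : R[X]) ^ 3 = 2 := by rw [← C_pow, hb, C_ofNat]
  rw [Tf, h₀, h₁, h₂]
  simp only [C_mul, C_pow, C_ofNat]
  generalize (C b : R[X]) = B at hB
  have e4 : B ^ 4 = 2 * B := by linear_combination B * hB
  have e5 : B ^ 5 = 2 * B ^ 2 := by linear_combination B ^ 2 * hB
  have e7 : B ^ 7 = 4 * B := by linear_combination (B ^ 4 + 2 * B) * hB
  have e8 : B ^ 8 = 4 * B ^ 2 := by linear_combination B * e7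
  have e10 : B ^ 10 = 8 * B := by linear_combination B ^ 3 * e7 + 4 * e4
  have e12 : B ^ 12 = 16 := by linear_combination B ^ 2 * e10 + 8 * hB
  rw [e4, e5, e7, e8, e10, e12]
  ring_nf
  simp only [hB, e4]
  ring

section Roots

variable {K : Type} [Field K] {b : K}

lemma isRoot_Tf_iff (hb : b ^ 3 = 2) (y : K) :
    (Tf K (1 + C b * X ^ 2 + C (b ^ 2) * X ^ 3 + X ^ 5)).IsRoot y ↔ negTf b y = 0 := by
  rw [Tf_eq hb, IsRoot.def, eval_neg, neg_eq_zero]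
  simp [negTf]

lemma eval_derivative_Tf (hb : b ^ 3 = 2) (y : K) :
    (derivative (Tf K (1 + C b * X ^ 2 + C (b ^ 2) * X ^ 3 + X ^ 5))).eval y =
      -negTfDeriv b y := by
  rw [Tf_eq hb]
  simp only [C_mul, C_pow, C_ofNat, derivative_neg, derivative_add, derivative_mul,
    derivative_ofNat, derivative_pow, derivative_C, derivative_X, eval_neg,
    eval_add, eval_mul, eval_pow, eval_ofNat, eval_C, eval_X, eval_zero, eval_one, negTfDeriv]
  push_cast
  have e5 : b ^ 5 = 2 * b ^ 2 := by linear_combination b ^ 2 * hb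
  have e4 : b ^ 4 = 2 * b := by linear_combination b * hb
  have e9 : b ^ 9 = 8 := by linear_combination (b ^ 6 + 2 * b ^ 3 + 4) * hb
  have e8 : b ^ 8 = 4 * b ^ 2 := by linear_combination (b ^ 5 + 2 * b ^ 2) * hb
  have e10 : b ^ 10 = 8 * b := by linear_combination b * e9
  rw [e5, e4, e8, e9, e10]
  ring

lemma natDegree_Tf (h15 : (15 : K) ≠ 0) (hb : b ^ 3 = 2) :
    (Tf K (1 + C b * X ^ 2 + C (b ^ 2) * X ^ 3 + X ^ 5)).natDegree = 8 := by
  rw [Tf_eq hb, natDegree_neg, ← C_ofNat]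
  compute_degree!

lemma leadingCoeff_Tf (h15 : (15 : K) ≠ 0) (hb : b ^ 3 = 2) :
    (Tf K (1 + C b * X ^ 2 + C (b ^ 2) * X ^ 3 + X ^ 5)).leadingCoeff = -15 := by
  rw [leadingCoeff, natDegree_Tf h15 hb, Tf_eq hb, ← C_ofNat, coeff_neg]
  simp only [coeff_add, coeff_C_mul, coeff_X_pow, coeff_X, coeff_C]
  norm_num

end Roots

/-- The additive valuation extending a map `v` that satisfies the valuation laws on nonzero
elements. -/
def addValuationOfNonzero {K : Type*} [Field K] (v : K → ℚ)
    (hv_mul : ∀ x y : K, x ≠ 0 → y ≠ 0 → v (x * y) = v x + v y)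
    (hv_add : ∀ x y : K, x ≠ 0 → y ≠ 0 → x + y ≠ 0 → min (v x) (v y) ≤ v (x + y)) :
    AddValuation K (WithTop ℚ) :=
  open Classical in
  AddValuation.of (fun x ↦ if x = 0 then ⊤ else (v x : WithTop ℚ)) (by simp)
    (by
      have h := hv_mul 1 1 one_ne_zero one_ne_zero
      rw [mul_one, left_eq_add] at h
      simp [h])
    (by
      intro x y
      by_cases hx : x = 0
      · rw [if_pos hx, hx, zero_add]; exact min_le_right _ _
      by_cases hy : y = 0
      · rw [if_pos hy, hy, add_zero]; exact min_le_left _ _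
      by_cases hxy : x + y = 0
      · simp [hxy]
      simp only [hx, hy, hxy, if_false]
      exact_mod_cast hv_add x y hx hy hxy)
    (by
      intro x y
      by_cases hx : x = 0
      · simp [hx]
      by_cases hy : y = 0
      · simp [hy]
      simp only [hx, hy, mul_eq_zero, or_self, if_false]
      exact_mod_cast hv_mul x y hx hy)

lemma addValuationOfNonzero_eq_coe_iff {K : Type*} [Field K] {v : K → ℚ}
    {hv_mul : ∀ x y : K, x ≠ 0 → y ≠ 0 → v (x * y) = v x + v y}
    {hv_add : ∀ x y : K, x ≠ 0 → y ≠ 0 → x + y ≠ 0 → min (v x) (v y) ≤ v (x + y)}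
    {x : K} {q : ℚ} :
    addValuationOfNonzero v hv_mul hv_add x = (q : WithTop ℚ) ↔ x ≠ 0 ∧ v x = q := by
  classical
  change (if x = 0 then ⊤ else (v x : WithTop ℚ)) = (q : WithTop ℚ) ↔ _
  by_cases hx : x = 0 <;> simp [hx]

lemma AddValuation.map_finset_prod_eq_coe {K ι : Type*} [Field K]
    (w : AddValuation K (WithTop ℚ)) {s : Finset ι} {g : ι → K} {u : ι → ℚ}
    (h : ∀ i ∈ s, w (g i) = (u i : WithTop ℚ)) :
    w (∏ i ∈ s, g i) = ((∑ i ∈ s, u i : ℚ) : WithTop ℚ) := by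
  classical
  induction s using Finset.induction_on with
  | empty => simp
  | insert i s hi ih =>
    rw [Finset.prod_insert hi, Finset.sum_insert hi, w.map_mul, h i (by simp),
      ih fun j hj ↦ h j (by simp [hj]), WithTop.coe_add]

lemma Polynomial.eval_derivative_eq_leadingCoeff_mul_prod_erase {K : Type*} [Field K]
    [DecidableEq K] {p : K[X]} (hp : p.Splits) (hnd : p.roots.Nodup) {x : K}
    (hx : x ∈ p.roots.toFinset) :
    p.derivative.eval x = p.leadingCoeff * ∏ y ∈ p.roots.toFinset.erase x, (x - y) := by
  have hprod : p = C p.leadingCoeff * ((X - C x) * ∏ y ∈ p.roots.toFinset.erase x, (X - C y)) := by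
    rw [Finset.mul_prod_erase _ (fun y ↦ X - C y) hx, Finset.prod,
      Multiset.toFinset_val, hnd.dedup]
    exact hp.eq_prod_roots
  conv_lhs => rw [hprod]
  simp [derivative_mul, eval_prod]

lemma Finset.card_filter_eq_of_sum_eq {ι : Type*} {s : Finset ι} {u : ι → ℚ} (hs : s.card = 7)
    (hu : ∀ i ∈ s, u i = 4 / 9 ∨ u i = 1 / 3) (hsum : ∑ i ∈ s, u i = 8 / 3) :
    (s.filter fun i ↦ u i = 4 / 9).card = 3 ∧ (s.filter fun i ↦ u i = 1 / 3).card = 4 := by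
  have hfilter : (s.filter fun i ↦ ¬ u i = 4 / 9) = s.filter fun i ↦ u i = 1 / 3 := by
    refine Finset.filter_congr fun i hi ↦ ⟨(hu i hi).resolve_left, fun h ↦ ?_⟩
    rw [h]
    norm_num
  have hcard := s.card_filter_add_card_filter_not fun i ↦ u i = 4 / 9
  have hsplit := s.sum_filter_add_sum_filter_not (fun i ↦ u i = 4 / 9) u
  rw [hfilter] at hcard hsplit
  rw [Finset.sum_congr rfl fun i hi ↦ (Finset.mem_filter.1 hi).2, Finset.sum_const,
    Finset.sum_congr rfl fun i hi ↦ (Finset.mem_filter.1 hi).2, Finset.sum_const, hsum,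
    nsmul_eq_mul, nsmul_eq_mul] at hsplit
  rw [hs] at hcard
  have hlin : 4 * (s.filter fun i ↦ u i = 4 / 9).card +
      3 * (s.filter fun i ↦ u i = 1 / 3).card = 24 := by
    exact_mod_cast (by linarith : (4 : ℚ) * (s.filter fun i ↦ u i = 4 / 9).card +
      3 * (s.filter fun i ↦ u i = 1 / 3).card = 24)
  omega

/-- in an algebraic closure of `ℚ₂`, with `a⁹ = 2` and
`f = 1 + a³X² + a⁶X³ + X⁵`, the degree-`8` polynomial `T_f` has `8` (distinct) roots, all of
valuation `7/24`; and for any fixed root `y₁`, exactly `3` of the remaining `7` roots `y`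
satisfy `v(y − y₁) = 4/9` and exactly `4` of them satisfy `v(y − y₁) = 1/3`. -/
theorem stmt_19
    (v : AlgebraicClosure ℚ_[2] → ℚ)
    (hv_mul : ∀ x y : AlgebraicClosure ℚ_[2], x ≠ 0 → y ≠ 0 → v (x * y) = v x + v y)
    (hv_add : ∀ x y : AlgebraicClosure ℚ_[2], x ≠ 0 → y ≠ 0 → x + y ≠ 0 →
      min (v x) (v y) ≤ v (x + y))
    (hv_pad : ∀ x : ℚ_[2], x ≠ 0 →
      v (algebraMap ℚ_[2] (AlgebraicClosure ℚ_[2]) x) = (x.valuation : ℚ))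
    (a : AlgebraicClosure ℚ_[2]) (ha : a ^ 9 = 2) :
    (Tf (AlgebraicClosure ℚ_[2])
        (1 + C (a ^ 3) * X ^ 2 + C (a ^ 6) * X ^ 3 + X ^ 5)).natDegree = 8 ∧
    {y : AlgebraicClosure ℚ_[2] |
      (Tf (AlgebraicClosure ℚ_[2])
        (1 + C (a ^ 3) * X ^ 2 + C (a ^ 6) * X ^ 3 + X ^ 5)).IsRoot y}.ncard = 8 ∧
    (∀ y : AlgebraicClosure ℚ_[2],
      (Tf (AlgebraicClosure ℚ_[2])
        (1 + C (a ^ 3) * X ^ 2 + C (a ^ 6) * X ^ 3 + X ^ 5)).IsRoot y → v y = 7 / 24) ∧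
    ∀ y₁ : AlgebraicClosure ℚ_[2],
      (Tf (AlgebraicClosure ℚ_[2])
        (1 + C (a ^ 3) * X ^ 2 + C (a ^ 6) * X ^ 3 + X ^ 5)).IsRoot y₁ →
      {y : AlgebraicClosure ℚ_[2] |
        (Tf (AlgebraicClosure ℚ_[2])
          (1 + C (a ^ 3) * X ^ 2 + C (a ^ 6) * X ^ 3 + X ^ 5)).IsRoot y ∧
        y ≠ y₁ ∧ v (y - y₁) = 4 / 9}.ncard = 3 ∧
      {y : AlgebraicClosure ℚ_[2] |
        (Tf (AlgebraicClosure ℚ_[2])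
          (1 + C (a ^ 3) * X ^ 2 + C (a ^ 6) * X ^ 3 + X ^ 5)).IsRoot y ∧
        y ≠ y₁ ∧ v (y - y₁) = 1 / 3}.ncard = 4 := by
  classical
  have hb : (a ^ 3) ^ 3 = 2 := by rw [← ha]; ring
  rw [show a ^ 6 = (a ^ 3) ^ 2 by ring]
  generalize a ^ 3 = b at hb
  set w := addValuationOfNonzero v hv_mul hv_add
  have h2 : w 2 = 1 := by
    have hv2 := hv_pad 2 two_ne_zero
    rw [map_ofNat, show (2 : ℚ_[2]) = ((2 : ℕ) : ℚ_[2]) by norm_num, Padic.valuation_p] at hv2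
    exact addValuationOfNonzero_eq_coe_iff.2 ⟨two_ne_zero, by simpa using hv2⟩
  set p := Tf (AlgebraicClosure ℚ_[2]) (1 + C b * X ^ 2 + C (b ^ 2) * X ^ 3 + X ^ 5) with hp
  have hdeg : p.natDegree = 8 := natDegree_Tf (by norm_num) hb
  have hp0 : p ≠ 0 := by
    intro h
    simp [h] at hdeg
  have hroot (y) : p.IsRoot y ↔ negTf b y = 0 := isRoot_Tf_iff hb y
  have hderiv (y) (hy : p.IsRoot y) :
      w (p.derivative.eval y) = ((8 / 3 : ℚ) : WithTop ℚ) := by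
    rw [hp, eval_derivative_Tf hb, w.map_neg, map_negTfDeriv h2 hb ((hroot y).1 hy)]
  have hsplits : p.Splits := IsAlgClosed.splits p
  have hnodup : p.roots.Nodup := by
    refine Multiset.nodup_iff_count_le_one.2 fun y ↦ not_lt.1 fun h ↦ ?_
    rw [count_roots, one_lt_rootMultiplicity_iff_isRoot hp0] at h
    have hy := hderiv y h.1
    rw [h.2, w.map_zero] at hy
    exact WithTop.top_ne_coe hy
  have hmem (y) : y ∈ p.roots.toFinset ↔ p.IsRoot y := by simp [hp0]
  have hcard : p.roots.toFinset.card = 8 := by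
    rw [Multiset.toFinset_card_of_nodup hnodup, ← hsplits.natDegree_eq_card_roots, hdeg]
  refine ⟨hdeg, ?_, fun y hy ↦ (addValuationOfNonzero_eq_coe_iff.1
    (map_root_negTf h2 hb ((hroot y).1 hy))).2, fun y hy ↦ ?_⟩
  · rw [← hcard, ← Set.ncard_coe_finset]
    congr 1
    ext y
    simp only [Set.mem_ofPred_eq, Finset.mem_coe, hmem]
  have hdiff (z) (hz : z ∈ p.roots.toFinset.erase y) : v (z - y) = 4 / 9 ∨ v (z - y) = 1 / 3 := by
    rw [Finset.mem_erase, hmem, hroot] at hz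
    exact (map_root_sub_root_negTf h2 hb ((hroot y).1 hy) hz.2 hz.1).imp
      (fun h ↦ (addValuationOfNonzero_eq_coe_iff.1 h).2)
      (fun h ↦ (addValuationOfNonzero_eq_coe_iff.1 h).2)
  have hsum : ∑ z ∈ p.roots.toFinset.erase y, v (z - y) = 8 / 3 := by
    have h := hderiv y hy
    have hlead : w p.leadingCoeff = ((0 : ℚ) : WithTop ℚ) := by
      rw [leadingCoeff_Tf (by norm_num) hb, w.map_neg]
      exact_mod_cast AddValuation.map_odd_eq_zero h2 7
    rw [eval_derivative_eq_leadingCoeff_mul_prod_erase hsplits hnodup ((hmem y).2 hy), w.map_mul,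
      hlead, WithTop.coe_zero, zero_add,
      w.map_finset_prod_eq_coe (u := fun z ↦ v (z - y)) fun z hz ↦ ?_, WithTop.coe_inj] at h
    · exact h
    · rw [w.map_sub_swap]
      exact addValuationOfNonzero_eq_coe_iff.2 ⟨sub_ne_zero.2 (Finset.ne_of_mem_erase hz), rfl⟩
  obtain ⟨h3, h4⟩ := Finset.card_filter_eq_of_sum_eq
    (by rw [Finset.card_erase_of_mem ((hmem y).2 hy), hcard]) hdiff hsum
  constructor
  · rw [← h3, ← Set.ncard_coe_finset]
    congr 1
    ext z
    simp only [Set.mem_ofPred_eq, Finset.coe_filter, Finset.mem_erase, hmem]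
    tauto
  · rw [← h4, ← Set.ncard_coe_finset]
    congr 1
    ext z
    simp only [Set.mem_ofPred_eq, Finset.coe_filter, Finset.mem_erase, hmem]
    tauto
end
end
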